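/- arXiv:1407.8498 — 4 statements merged into one kernel-verified Lean document; each statement's English description precedes it below -/
import Mathlib

section
/- Let q = 2^h (h ≥ 1) and F = GF(q²). Let a,b,c,d,e,f ∈ F with c ≠ 0 and Tr(ab/c²) = 1 (so that 𝒬 is an elliptic quadric). Then the number of points of ℙ³(F) lying on both ℋ and 𝒬 belongs to the set {q³ − q² + 1, q³ − q² + q + 1, q³ − q + 1, q³ + 1, q³ + q + 1, q³ + q² − q + 1, q³ + q² + 1}. -/
section helper
set_option linter.unusedSectionVars false
variable {F : Type} [Field F] [Fintype F]

/-- partial trace -/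
def ptr (n : ℕ) (x : F) : F := ∑ i ∈ Finset.range n, x ^ 2 ^ i

open Classical in
/-- sign of a bit -/
noncomputable def sg (x : F) : ℤ := if x = 0 then 1 else -1

/-- the sign character -/
noncomputable def chi (h : ℕ) (x : F) : ℤ := sg (ptr (2 * h) x)

lemma ptr_add [CharP F 2] (n : ℕ) (x y : F) : ptr n (x + y) = ptr n x + ptr n y := by
  simp only [ptr, ← Finset.sum_add_distrib]
  exact Finset.sum_congr rfl fun i _ => add_pow_char_pow x y 2 i

lemma ptr_zero (n : ℕ) : ptr n (0 : F) = 0 := by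
  simp [ptr]

lemma ptr_two (h q : ℕ) [CharP F 2] (hq : q = 2 ^ h) (x : F) :
    ptr (2 * h) x = ptr h (x + x ^ q) := by
  rw [ptr_add, two_mul]
  simp only [ptr]
  rw [Finset.sum_range_add]
  congr 1
  refine Finset.sum_congr rfl fun i _ => ?_
  rw [hq, pow_add, pow_mul]

lemma ptr_sq_self (h q : ℕ) [CharP F 2] (hq : q = 2 ^ h) (hF : Fintype.card F = q ^ 2) (x : F) :
    ptr (2 * h) (x ^ 2) = ptr (2 * h) x := by
  have h1 : ∀ i, (x ^ 2) ^ 2 ^ i = x ^ 2 ^ (i + 1) := fun i => by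
    rw [← pow_mul, pow_succ' 2 i]
  have h2 : x ^ 2 ^ (2 * h) = x := by
    have := FiniteField.pow_card x
    rwa [hF, hq, ← pow_mul, mul_comm] at this
  have h3 := Finset.sum_range_succ (fun i => x ^ 2 ^ i) (2 * h)
  rw [Finset.sum_range_succ'] at h3
  simp only [h2, pow_zero, pow_one] at h3
  simp only [ptr, h1]
  exact add_right_cancel h3

lemma ptr_sq (n : ℕ) [CharP F 2] (x : F) : ptr n (x ^ 2) = (ptr n x) ^ 2 := by
  simp only [ptr]
  rw [sum_pow_char 2]
  refine Finset.sum_congr rfl fun i _ => ?_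
  rw [← pow_mul, ← pow_mul, mul_comm]

lemma ptr_01 (h q : ℕ) [CharP F 2] (hq : q = 2 ^ h) (hF : Fintype.card F = q ^ 2) (x : F) :
    ptr (2 * h) x = 0 ∨ ptr (2 * h) x = 1 := by
  have h1 := ptr_sq (2 * h) x
  rw [ptr_sq_self h q hq hF] at h1
  rcases eq_or_ne (ptr (2 * h) x) 0 with h0 | h0
  · exact Or.inl h0
  · right
    have : ptr (2 * h) x * 1 = ptr (2 * h) x * ptr (2 * h) x := by rw [mul_one, ← sq]; exact h1
    exact (mul_left_cancel₀ h0 this).symm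

lemma chi_add (h q : ℕ) [CharP F 2] (hq : q = 2 ^ h) (hF : Fintype.card F = q ^ 2) (x y : F) :
    chi h (x + y) = chi h x * chi h y := by
  simp only [chi, ptr_add]
  rcases ptr_01 h q hq hF x with hx | hx <;> rcases ptr_01 h q hq hF y with hy | hy <;>
    simp [hx, hy, sg, CharTwo.add_self_eq_zero]

lemma chi_zero (h : ℕ) : chi h (0 : F) = 1 := by simp [chi, sg, ptr_zero]

lemma chi_sq_self (h q : ℕ) [CharP F 2] (hq : q = 2 ^ h) (hF : Fintype.card F = q ^ 2) (x : F) :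
    chi h (x ^ 2) = chi h x := by
  simp only [chi, ptr_sq_self h q hq hF]

lemma chi_congr (h q : ℕ) [CharP F 2] (hq : q = 2 ^ h) {x y : F} (hxy : x + x ^ q = y + y ^ q) :
    chi h x = chi h y := by
  simp only [chi, ptr_two h q hq, hxy]

lemma chi_sum (h q : ℕ) [CharP F 2] (hq : q = 2 ^ h) (hF : Fintype.card F = q ^ 2)
    (u : F) (hu : ptr (2 * h) u = 1) (β : F) [Decidable (β = 0)] :
    ∑ x : F, chi h (β * x) = if β = 0 then (q : ℤ) ^ 2 else 0 := by
  split_ifs with hb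
  · simp [hb, chi_zero, hF]
  · have h1 : ∑ x : F, chi h (β * x) = ∑ x : F, chi h (β * (x + u / β)) :=
      (Equiv.sum_comp (Equiv.addRight (u / β)) (fun x => chi h (β * x))).symm
    have h2 : ∀ x : F, chi h (β * (x + u / β)) = - chi h (β * x) := by
      intro x
      rw [mul_add, mul_div_cancel₀ _ hb, chi_add h q hq hF]
      have : chi h u = -1 := by simp [chi, sg, hu]
      rw [this]; ring
    simp only [h2, Finset.sum_neg_distrib] at h1
    linarith

lemma frob_add (h q : ℕ) [CharP F 2] (hq : q = 2 ^ h) (x y : F) : (x + y) ^ q = x ^ q + y ^ q := by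
  rw [hq]; exact add_pow_char_pow x y 2 h

lemma frob_frob (q : ℕ) (hF : Fintype.card F = q ^ 2) (x : F) : (x ^ q) ^ q = x := by
  have := FiniteField.pow_card x
  rwa [hF, sq, pow_mul] at this

open Classical in
/-- the subfield of order q, as a finset -/
noncomputable def KK (F : Type) [Field F] [Fintype F] (q : ℕ) : Finset F :=
  Finset.univ.filter fun x => x ^ q = x

lemma mem_KK (q : ℕ) (x : F) : x ∈ KK F q ↔ x ^ q = x := by simp [KK]

lemma exists_theta (h q : ℕ) [CharP F 2] (hq : q = 2 ^ h) (hF : Fintype.card F = q ^ 2)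
    (u : F) (hu : ptr (2 * h) u = 1) : ∃ θ : F, θ + θ ^ q = 1 := by
  have h0 : u + u ^ q ≠ 0 := by
    intro h0
    rw [ptr_two h q hq, h0, ptr_zero] at hu
    exact zero_ne_one hu
  refine ⟨u / (u + u ^ q), ?_⟩
  rw [div_pow, frob_add h q hq, frob_frob q hF, add_comm (u ^ q) u, ← add_div, div_self h0]

lemma card_KK (h q : ℕ) [CharP F 2] (hq : q = 2 ^ h) (hF : Fintype.card F = q ^ 2)
    (θ : F) (hθ : θ + θ ^ q = 1) : (KK F q).card = q := by
  have key : (KK F q ×ˢ KK F q).card = (Finset.univ : Finset F).card := by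
    refine Finset.card_bij' (fun p _ => p.1 + p.2 * θ)
      (fun x _ => (x + (x + x ^ q) * θ, x + x ^ q)) ?_ ?_ ?_ ?_
    · intros; simp
    · intro x _
      simp only [Finset.mem_product, mem_KK]
      have hx := frob_frob q hF x
      have h2 : θ ^ q = 1 + θ := by
        rw [← hθ, add_comm θ, add_assoc, CharTwo.add_self_eq_zero, add_zero]
      constructor
      · rw [frob_add h q hq, mul_pow, frob_add h q hq, hx, h2]
        linear_combination (x ^ q) * CharTwo.two_eq_zero (R := F)
      · rw [frob_add h q hq, hx, add_comm]
    · rintro ⟨s, t⟩ hp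
      simp only [Finset.mem_product, mem_KK] at hp
      have h1 : s + t * θ + (s + t * θ) ^ q = t := by
        rw [frob_add h q hq, mul_pow, hp.1, hp.2]
        linear_combination t * hθ + s * CharTwo.two_eq_zero (R := F)
      simp only [h1]
      ext
      · simp only; linear_combination t * θ * CharTwo.two_eq_zero (R := F)
      · rfl
    · intro x _
      simp only
      linear_combination (x + x ^ q) * θ * CharTwo.two_eq_zero (R := F)
  rw [Finset.card_product, Finset.card_univ, hF, ← sq] at key
  exact Nat.pow_left_injective (n := 2) (by norm_num) key

lemma chi_sum_KK (h q : ℕ) [CharP F 2] (hq : q = 2 ^ h) (hF : Fintype.card F = q ^ 2)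
    (u : F) (hu : ptr (2 * h) u = 1) (z : F) [Decidable (z + z ^ q = 0)] :
    ∑ t ∈ KK F q, chi h (t * z) = if z + z ^ q = 0 then (q : ℤ) else 0 := by
  obtain ⟨θ, hθ⟩ := exists_theta h q hq hF u hu
  split_ifs with hz
  · have : ∀ t ∈ KK F q, chi h (t * z) = 1 := by
      intro t ht
      rw [mem_KK] at ht
      rw [← chi_zero (F := F) h]
      apply chi_congr h q hq
      have hq0 : q ≠ 0 := by rw [hq]; positivity
      rw [mul_pow, ht, ← mul_add, hz, zero_pow hq0]; simp
    rw [Finset.sum_congr rfl this]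
    simp [card_KK h q hq hF θ hθ]
  · set w := z + z ^ q with hw
    have hwq : w ^ q = w := by rw [hw, frob_add h q hq, frob_frob q hF, add_comm]
    set s := (u + u ^ q) / w with hs
    have hsq : s ^ q = s := by
      rw [hs, div_pow, hwq, frob_add h q hq, frob_frob q hF, add_comm]
    have hchi : chi h (s * z) = -1 := by
      have : chi h u = -1 := by simp [chi, sg, hu]
      rw [← this]
      apply chi_congr h q hq
      rw [mul_pow, hsq, ← mul_add, ← hw, hs, div_mul_cancel₀ _ hz]
    have h1 : ∑ t ∈ KK F q, chi h (t * z) = ∑ t ∈ KK F q, chi h ((t + s) * z) := by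
      symm
      refine Finset.sum_bij' (fun t _ => t + s) (fun t _ => t + s) ?_ ?_ ?_ ?_ ?_
      · intro t ht; rw [mem_KK] at *; rw [frob_add h q hq, ht, hsq]
      · intro t ht; rw [mem_KK] at *; rw [frob_add h q hq, ht, hsq]
      · intro t _; rw [add_assoc, CharTwo.add_self_eq_zero, add_zero]
      · intro t _; rw [add_assoc, CharTwo.add_self_eq_zero, add_zero]
      · intro t _; rfl
    have h2 : ∀ t : F, chi h ((t + s) * z) = - chi h (t * z) := by
      intro t
      rw [add_mul, chi_add h q hq hF, hchi]; ring
    simp only [h2, Finset.sum_neg_distrib] at h1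
    linarith

/-- the function whose relative trace is the affine equation -/
def gg (q : ℕ) (θ a b c d e f : F) (v : F × F) : F :=
  θ * (v.1 ^ (q + 1) + v.2 ^ (q + 1)) + a * v.1 ^ 2 + b * v.2 ^ 2 + c * v.1 * v.2
    + d * v.1 + e * v.2 + f

/-- polarization under the character -/
lemma chi_gg_add (h q : ℕ) [CharP F 2] (hq : q = 2 ^ h) (hF : Fintype.card F = q ^ 2)
    (θ : F) (hθ : θ + θ ^ q = 1) (a b c d e f : F) (t : F) (ht : t ^ q = t) (v w : F × F) :
    chi h (t * gg q θ a b c d e f (v + w)) =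
      chi h (t * gg q θ a b c d e f v) * chi h (t * gg q θ a b c 0 0 0 w)
       * chi h (t * (d * w.1 + e * w.2))
       * (chi h (t * (w.1 ^ q + c * w.2) * v.1) * chi h (t * (w.2 ^ q + c * w.1) * v.2)) := by
  simp only [← chi_add h q hq hF]
  have e2 := CharTwo.two_eq_zero (R := F)
  apply chi_congr h q hq
  obtain ⟨x, y⟩ := v
  obtain ⟨z, w⟩ := w
  have hx := frob_frob q hF x
  have hy := frob_frob q hF y
  have hz := frob_frob q hF z
  have hw := frob_frob q hF w
  simp only [gg, Prod.fst_add, Prod.snd_add, pow_succ, pow_zero, one_mul, mul_pow, frob_add h q hq, ht,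
    hx, hy, hz, hw]
  have h2 : θ ^ q = 1 + θ := by
    rw [← hθ, add_comm θ, add_assoc, CharTwo.add_self_eq_zero, add_zero]
  simp only [h2]
  generalize x ^ q = x1, y ^ q = y1, z ^ q = z1, w ^ q = w1, a ^ q = a1, b ^ q = b1, c ^ q = c1,
    d ^ q = d1, e ^ q = e1, f ^ q = f1
  rw [← sub_eq_zero, CharTwo.sub_eq_add]
  have hq0 : q ≠ 0 := by rw [hq]; positivity
  have e4 : (4 : F) = 0 := by linear_combination 2 * e2
  rw [zero_pow hq0]
  ring_nf
  simp only [e2, e4, mul_zero, add_zero]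

lemma chi_mul_self (h : ℕ) (x : F) : chi h x * chi h x = 1 := by
  simp only [chi, sg]; split_ifs <;> norm_num

open Classical in
lemma S_sq (h q : ℕ) [CharP F 2] (hq : q = 2 ^ h) (hF : Fintype.card F = q ^ 2)
    (u : F) (hu : ptr (2 * h) u = 1)
    (θ : F) (hθ : θ + θ ^ q = 1) (a b c d e f : F) (t : F) (ht : t ^ q = t) (ht0 : t ≠ 0) :
    (∑ v : F × F, chi h (t * gg q θ a b c d e f v)) ^ 2 =
      (q : ℤ) ^ 4 * ∑ w : F × F, if w.1 ^ q + c * w.2 = 0 ∧ w.2 ^ q + c * w.1 = 0 then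
        chi h (t * gg q θ a b c 0 0 0 w) * chi h (t * (d * w.1 + e * w.2)) else 0 := by
  have h1 : (∑ v : F × F, chi h (t * gg q θ a b c d e f v)) ^ 2 =
      ∑ v : F × F, ∑ w : F × F, chi h (t * gg q θ a b c d e f v) *
        chi h (t * gg q θ a b c d e f (v + w)) := by
    rw [sq, Finset.sum_mul]
    refine Finset.sum_congr rfl fun v _ => ?_
    rw [← Finset.mul_sum]
    congr 1
    exact (Equiv.sum_comp (Equiv.addLeft v) (fun w => chi h (t * gg q θ a b c d e f w))).symm
  rw [h1, Finset.sum_comm, Finset.mul_sum]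
  refine Finset.sum_congr rfl fun w _ => ?_
  have h2 : ∀ v : F × F, chi h (t * gg q θ a b c d e f v) *
        chi h (t * gg q θ a b c d e f (v + w)) =
      (chi h (t * gg q θ a b c 0 0 0 w) * chi h (t * (d * w.1 + e * w.2))) *
       (chi h (t * (w.1 ^ q + c * w.2) * v.1) * chi h (t * (w.2 ^ q + c * w.1) * v.2)) := by
    intro v
    rw [chi_gg_add h q hq hF θ hθ a b c d e f t ht v w]
    linear_combination (chi h (t * gg q θ a b c 0 0 0 w) * chi h (t * (d * w.1 + e * w.2))) *
       (chi h (t * (w.1 ^ q + c * w.2) * v.1) * chi h (t * (w.2 ^ q + c * w.1) * v.2)) *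
       chi_mul_self h (t * gg q θ a b c d e f v)
  rw [Finset.sum_congr rfl fun v _ => h2 v, ← Finset.mul_sum, Fintype.sum_prod_type]
  simp only [← Finset.mul_sum, ← Finset.sum_mul]
  rw [chi_sum h q hq hF u hu, chi_sum h q hq hF u hu]
  simp only [mul_eq_zero, ht0, false_or]
  by_cases c1 : w.1 ^ q + c * w.2 = 0 <;> by_cases c2 : w.2 ^ q + c * w.1 = 0 <;>
    simp [c1, c2]
  ring

open Classical in
lemma count_eq (h q : ℕ) [CharP F 2] (hq : q = 2 ^ h) (hF : Fintype.card F = q ^ 2)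
    (u : F) (hu : ptr (2 * h) u = 1) (g : F × F → F) :
    ((Finset.univ.filter fun v => g v + g v ^ q = 0).card : ℤ) * q =
      (q : ℤ) ^ 4 + ∑ t ∈ (KK F q).erase 0, ∑ v : F × F, chi h (t * g v) := by
  have hq0 : q ≠ 0 := by rw [hq]; positivity
  have h0 : (0 : F) ∈ KK F q := by rw [mem_KK, zero_pow hq0]
  have h1 : ∑ v : F × F, chi h (0 * g v) = (q : ℤ) ^ 4 := by
    simp [chi_zero, hF]; ring
  rw [← h1, Finset.add_sum_erase _ (fun t => ∑ v : F × F, chi h (t * g v)) h0, Finset.sum_comm]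
  simp only [chi_sum_KK h q hq hF u hu]
  rw [← Finset.sum_filter, Finset.sum_const, nsmul_eq_mul]

open Classical in
lemma rank_four (h q : ℕ) [CharP F 2] (hq : q = 2 ^ h) (hF : Fintype.card F = q ^ 2)
    (u : F) (hu : ptr (2 * h) u = 1)
    (θ : F) (hθ : θ + θ ^ q = 1) (a b c d e f : F) (hc : c ^ (q + 1) ≠ 1) :
    ∃ k : F, ∃ s : ℤ, (s = q ^ 2 ∨ s = - q ^ 2) ∧
     ∑ t ∈ (KK F q).erase 0, ∑ v : F × F, chi h (t * gg q θ a b c d e f v) =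
      s * ((if k + k ^ q = 0 then (q : ℤ) else 0) - 1) := by
  have hq0 : q ≠ 0 := by rw [hq]; positivity
  have h0 : (0 : F) ∈ KK F q := by rw [mem_KK, zero_pow hq0]
  have hrad : ∀ w : F × F, (w.1 ^ q + c * w.2 = 0 ∧ w.2 ^ q + c * w.1 = 0) ↔ w = 0 := by
    rintro ⟨x, y⟩
    constructor
    · rintro ⟨h1, h2⟩
      simp only at h1 h2
      rw [CharTwo.add_eq_zero] at h1 h2
      have hx := frob_frob q hF x
      have hx0 : x = 0 := by
        rw [h1, mul_pow, h2] at hx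
        by_contra hx0
        apply hc
        apply mul_right_cancel₀ hx0
        rw [pow_succ, one_mul, mul_assoc]; exact hx
      have hy0 : y = 0 := by
        rw [hx0, mul_zero] at h2
        exact pow_eq_zero_iff hq0 |>.1 h2
      simp [hx0, hy0]
    · rintro h; cases h; simp [hq0]
  let φ : F × F →+ F × F :=
    { toFun := fun w => (w.1 ^ q + c * w.2, w.2 ^ q + c * w.1)
      map_zero' := by simp [hq0]
      map_add' := by
        intro x y
        ext <;> simp [frob_add h q hq] <;> ring }
  have hinj : Function.Injective φ := by
    rw [injective_iff_map_eq_zero]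
    intro w hw
    apply (hrad w).1
    exact Prod.ext_iff.1 hw
  obtain ⟨w, hw⟩ := (Finite.injective_iff_surjective.1 hinj) (d, e)
  have hw1 : w.1 ^ q + c * w.2 = d := (Prod.ext_iff.1 hw).1
  have hw2 : w.2 ^ q + c * w.1 = e := (Prod.ext_iff.1 hw).2
  -- completing the square
  have hS : ∀ t : F, t ^ q = t → ∑ v : F × F, chi h (t * gg q θ a b c d e f v) =
      chi h (t * (gg q θ a b c 0 0 0 w + d * w.1 + e * w.2 + f)) *
      ∑ v : F × F, chi h (t * gg q θ a b c 0 0 0 v) := by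
    intro t ht
    rw [← Equiv.sum_comp (Equiv.addRight w) (fun v => chi h (t * gg q θ a b c d e f v)),
      Finset.mul_sum]
    refine Finset.sum_congr rfl fun v _ => ?_
    have h1 : gg q θ a b c d e f v = gg q θ a b c 0 0 0 v + d * v.1 + e * v.2 + f := by
      simp only [gg]; ring
    simp only [Equiv.coe_addRight]
    rw [chi_gg_add h q hq hF θ hθ a b c d e f t ht v w, hw1, hw2, h1]
    simp only [← chi_add h q hq hF]
    congr 1
    rw [← sub_eq_zero, CharTwo.sub_eq_add]
    generalize gg q θ a b c 0 0 0 v = A, gg q θ a b c 0 0 0 w = B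
    ring_nf
    simp only [CharTwo.two_eq_zero, mul_zero, add_zero]
  have hS1 : ∀ t : F, t ^ q = t → t ≠ 0 → ∑ v : F × F, chi h (t * gg q θ a b c 0 0 0 v) =
      ∑ v : F × F, chi h (1 * gg q θ a b c 0 0 0 v) := by
    intro t ht ht0
    obtain ⟨s, hs⟩ : ∃ s : F, s ^ 2 = t := by
      have : Function.Injective (fun x : F => x ^ 2) := CharTwo.sq_injective
      exact Finite.injective_iff_surjective.1 this t
    have hsq : s ^ q = s := by
      apply CharTwo.sq_injective
      simp only
      rw [← pow_mul, mul_comm, pow_mul, hs, ht]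
    have hs0 : s ≠ 0 := by rintro rfl; apply ht0; rw [← hs]; simp
    let E : F × F ≃ F × F := (Equiv.mulLeft₀ s hs0).prodCongr (Equiv.mulLeft₀ s hs0)
    refine Eq.trans ?_ (Equiv.sum_comp E (fun v => chi h (1 * gg q θ a b c 0 0 0 v)))
    refine Finset.sum_congr rfl fun v _ => ?_
    congr 1
    simp only [gg, E, Equiv.prodCongr_apply, Prod.map, Equiv.mulLeft₀_apply, pow_succ, pow_zero,
      mul_pow, hsq, ← hs]
    ring
  have h11 : ∑ v : F × F, chi h (1 * gg q θ a b c 0 0 0 v) = q ^ 2 ∨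
      ∑ v : F × F, chi h (1 * gg q θ a b c 0 0 0 v) = - q ^ 2 := by
    have := S_sq h q hq hF u hu θ hθ a b c 0 0 0 1 (one_pow q) one_ne_zero
    simp only [hrad] at this
    rw [Finset.sum_ite_eq' ] at this
    simp [gg, hq0, chi_zero] at this
    apply sq_eq_sq_iff_eq_or_eq_neg.1
    simp only [one_mul]
    simp only [gg, zero_mul, add_zero]
    rw [this]; ring
  refine ⟨gg q θ a b c 0 0 0 w + d * w.1 + e * w.2 + f, _, h11, ?_⟩
  rw [← chi_sum_KK h q hq hF u hu, ← Finset.sum_erase_add _ _ h0, zero_mul, chi_zero,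
    add_sub_cancel_right, Finset.mul_sum]
  refine Finset.sum_congr rfl fun t ht => ?_
  rw [Finset.mem_erase, mem_KK] at ht
  rw [hS t ht.2, hS1 t ht.2 ht.1, mul_comm]

open Classical in
lemma rank_two (h q : ℕ) [CharP F 2] (hq : q = 2 ^ h) (hF : Fintype.card F = q ^ 2)
    (θ : F) (hθ : θ + θ ^ q = 1) (a b c d e f : F) (hc : c ^ (q + 1) = 1)
    (hu : ptr (2 * h) (a * b / c ^ 2) = 1) :
     ∑ t ∈ (KK F q).erase 0, ∑ v : F × F, chi h (t * gg q θ a b c d e f v)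
       ∈ ({0, (q : ℤ) ^ 3, - (q : ℤ) ^ 3} : Set ℤ) := by
  have hq0 : q ≠ 0 := by rw [hq]; positivity
  have hc0 : c ≠ 0 := by rintro rfl; simp at hc
  have hcc : c ^ q * c = 1 := by rw [← pow_succ]; exact hc
  have hcq : c ^ q = c⁻¹ := eq_inv_of_mul_eq_one_left hcc
  set α := a + b ^ q * c ^ 2 with hα
  set β := d + e ^ q * c with hβ
  have hα0 : α ≠ 0 := by
    intro h0
    have ha : a = b ^ q * c ^ 2 := CharTwo.add_eq_zero.1 h0
    rw [ptr_two h q hq] at hu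
    have : a * b / c ^ 2 = b ^ q * b := by rw [ha]; field_simp
    rw [this, mul_pow, frob_frob q hF, mul_comm b, CharTwo.add_self_eq_zero, ptr_zero] at hu
    exact zero_ne_one hu
  have hsq : ∀ t : F, t ^ q = t → t ≠ 0 → 
      (∑ v : F × F, chi h (t * gg q θ a b c d e f v)) ^ 2 =
       if t * β ^ 2 = α then (q : ℤ) ^ 6 else 0 := by
    intro t ht ht0
    rw [S_sq h q hq hF _ hu θ hθ a b c d e f t ht ht0, Fintype.sum_prod_type]
    have h1 : ∀ x : F, (∑ y : F, if x ^ q + c * y = 0 ∧ y ^ q + c * x = 0 then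
        chi h (t * gg q θ a b c 0 0 0 (x, y)) * chi h (t * (d * x + e * y)) else 0) =
        chi h ((t * α + t ^ 2 * β ^ 2) * x ^ 2) := by
      intro x
      have h2 : ∀ y : F, (x ^ q + c * y = 0 ∧ y ^ q + c * x = 0) ↔ y = x ^ q * c⁻¹ := by
        intro y
        rw [CharTwo.add_eq_zero, CharTwo.add_eq_zero]
        constructor
        · rintro ⟨h1, _⟩
          rw [h1]; field_simp
        · rintro rfl
          constructor
          · field_simp
          · rw [mul_pow, frob_frob q hF, inv_pow, hcq, inv_inv, mul_comm]
      simp only [h2]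
      rw [Finset.sum_ite_eq']
      simp only [Finset.mem_univ, if_true]
      have h3 : (t * α + t ^ 2 * β ^ 2) * x ^ 2 = t * α * x ^ 2 + (t * β * x) ^ 2 := by ring
      rw [h3, chi_add h q hq hF, chi_sq_self h q hq hF]
      simp only [← chi_add h q hq hF]
      apply chi_congr h q hq
      have h4 : θ ^ q = 1 + θ := by
        rw [← hθ, add_comm θ, add_assoc, CharTwo.add_self_eq_zero, add_zero]
      have hx := frob_frob q hF x
      have hb := frob_frob q hF b
      have he := frob_frob q hF e
      simp only [gg, hα, hβ, pow_succ, pow_zero, one_mul, mul_pow, inv_pow, inv_inv,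
        frob_add h q hq, ht, hx, hb, he, h4, hcq]
      generalize x ^ q = x1, a ^ q = a1, b ^ q = b1, d ^ q = d1, e ^ q = e1
      have hci : c * c⁻¹ = 1 := mul_inv_cancel₀ hc0
      generalize c⁻¹ = c1 at *
      rw [← sub_eq_zero, CharTwo.sub_eq_add]
      have e2 := CharTwo.two_eq_zero (R := F)
      rw [zero_pow hq0]
      have hc2 : c ^ 2 * c1 ^ 2 = 1 := by rw [← mul_pow, hci, one_pow]
      grind
    rw [Finset.sum_congr rfl fun x _ => h1 x]
    have h5 : ∑ x : F, chi h ((t * α + t ^ 2 * β ^ 2) * x ^ 2) =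
       ∑ x : F, chi h ((t * α + t ^ 2 * β ^ 2) * x) := by
      have : Function.Bijective (fun x : F => x ^ 2) :=
        Finite.injective_iff_bijective.1 CharTwo.sq_injective
      exact Function.Bijective.sum_comp this (fun x => chi h ((t * α + t ^ 2 * β ^ 2) * x))
    rw [h5, chi_sum h q hq hF _ hu]
    have h6 : t * α + t ^ 2 * β ^ 2 = 0 ↔ t * β ^ 2 = α := by
      have : t * α + t ^ 2 * β ^ 2 = t * (α + t * β ^ 2) := by ring
      rw [this, mul_eq_zero, CharTwo.add_eq_zero]
      simp [ht0, eq_comm]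
    simp only [h6]
    split_ifs <;> ring
  by_cases hex : ∃ t ∈ (KK F q).erase 0, t * β ^ 2 = α
  · obtain ⟨t, ht, hta⟩ := hex
    have hb0 : β ^ 2 ≠ 0 := by
      intro hb; rw [hb, mul_zero] at hta; exact hα0 hta.symm
    rw [Finset.sum_eq_single_of_mem t ht]
    · rw [Finset.mem_erase, mem_KK] at ht
      have := hsq t ht.2 ht.1
      rw [if_pos hta] at this
      right
      apply sq_eq_sq_iff_eq_or_eq_neg.1
      rw [this]; ring
    · intro s hs hst
      rw [Finset.mem_erase, mem_KK] at hs
      have := hsq s hs.2 hs.1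
      rw [if_neg] at this
      · exact pow_eq_zero_iff (two_ne_zero) |>.1 this
      · intro h; exact hst (mul_right_cancel₀ hb0 (h.trans hta.symm))
  · left
    apply Finset.sum_eq_zero
    intro s hs
    have hs' := hs
    rw [Finset.mem_erase, mem_KK] at hs
    have := hsq s hs.2 hs.1
    rw [if_neg] at this
    · exact pow_eq_zero_iff (two_ne_zero) |>.1 this
    · intro h; exact hex ⟨s, hs', h⟩

/-- the defining condition on vectors -/
def hqCond (q : ℕ) (a b c d e f : F) (v : Fin 4 → F) : Prop :=
  (v 1) ^ (q + 1) + (v 2) ^ (q + 1) + (v 3) ^ q * v 0 + v 3 * (v 0) ^ q = 0 ∧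
        a * (v 1) ^ 2 + b * (v 2) ^ 2 + c * v 1 * v 2
            + d * v 1 * v 0 + e * v 2 * v 0 + f * (v 0) ^ 2 + v 0 * v 3 = 0

lemma hqCond_smul (q : ℕ) (a b c d e f : F) (v : Fin 4 → F) (r : Fˣ) :
    hqCond q a b c d e f (r • v) ↔ hqCond q a b c d e f v := by
  have hr : (r : F) ≠ 0 := r.ne_zero
  simp only [hqCond, Pi.smul_apply, Units.smul_def, smul_eq_mul, mul_pow]
  constructor
  · rintro ⟨h1, h2⟩
    constructor
    · apply mul_left_cancel₀ (pow_ne_zero (q + 1) hr)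
      rw [mul_zero, ← h1]; ring
    · apply mul_left_cancel₀ (pow_ne_zero 2 hr)
      rw [mul_zero, ← h2]; ring
  · rintro ⟨h1, h2⟩
    constructor
    · linear_combination (r : F) ^ (q + 1) * h1
    · linear_combination (r : F) ^ 2 * h2

lemma hqCond_rep (q : ℕ) (a b c d e f : F) (v : Fin 4 → F) (hv : v ≠ 0) :
    hqCond q a b c d e f (Projectivization.mk F v hv).rep ↔ hqCond q a b c d e f v := by
  obtain ⟨r, hr⟩ := Projectivization.exists_smul_eq_mk_rep F v hv
  rw [← hr, hqCond_smul]

lemma aniso (h q : ℕ) [CharP F 2] (hq : q = 2 ^ h) (hF : Fintype.card F = q ^ 2)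
    (a b c : F) (hc : c ≠ 0) (hu : ptr (2 * h) (a * b / c ^ 2) = 1) (x y : F)
    (hxy : a * x ^ 2 + b * y ^ 2 + c * x * y = 0) : x = 0 ∧ y = 0 := by
  by_cases hy : y = 0
  · subst hy
    refine ⟨?_, rfl⟩
    have h1 : a * x ^ 2 = 0 := by linear_combination hxy
    rcases mul_eq_zero.1 h1 with h1 | h1
    · rw [h1, zero_mul, zero_div, ptr_zero] at hu
      exact absurd hu zero_ne_one
    · exact pow_eq_zero_iff two_ne_zero |>.1 h1
  · exfalso
    have h1 : a * b / c ^ 2 = (a * x / (c * y)) ^ 2 + a * x / (c * y) := by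
      field_simp
      have e2 := CharTwo.two_eq_zero (R := F)
      linear_combination a * hxy - (a * x * (a * x + c * y)) * e2
    rw [h1, ptr_add, ptr_sq_self h q hq hF, CharTwo.add_self_eq_zero] at hu
    exact zero_ne_one hu

lemma hqCond_affine (h q : ℕ) [CharP F 2] (hq : q = 2 ^ h) (hF : Fintype.card F = q ^ 2)
    (θ : F) (hθ : θ + θ ^ q = 1) (a b c d e f x y z : F) :
    hqCond q a b c d e f ![1, x, y, z] ↔
      z = a * x ^ 2 + b * y ^ 2 + c * x * y + d * x + e * y + f ∧
      gg q θ a b c d e f (x, y) + gg q θ a b c d e f (x, y) ^ q = 0 := by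
  have h1 : (a * x ^ 2 + b * y ^ 2 + c * x * y + d * x * 1 + e * y * 1 + f * 1 ^ 2 + 1 * z = 0) ↔
      z = a * x ^ 2 + b * y ^ 2 + c * x * y + d * x + e * y + f := by
    rw [CharTwo.add_eq_zero, one_mul, mul_one, mul_one, one_pow, mul_one, eq_comm]
  have h2 : gg q θ a b c d e f (x, y) = θ * (x ^ (q + 1) + y ^ (q + 1)) +
      (a * x ^ 2 + b * y ^ 2 + c * x * y + d * x + e * y + f) := by
    simp only [gg]; ring
  simp only [hqCond, Matrix.cons_val, h1]
  rw [and_comm]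
  refine and_congr_right fun hz => ?_
  rw [h2, ← hz]
  have hn : (x ^ (q + 1) + y ^ (q + 1)) ^ q = x ^ (q + 1) + y ^ (q + 1) := by
    rw [frob_add h q hq, pow_succ, pow_succ, mul_pow, mul_pow, frob_frob q hF, frob_frob q hF]
    ring
  rw [frob_add h q hq, mul_pow, hn]
  have h3 : θ * (x ^ (q + 1) + y ^ (q + 1)) + z + (θ ^ q * (x ^ (q + 1) + y ^ (q + 1)) + z ^ q) =
     x ^ (q + 1) + y ^ (q + 1) + z ^ q * 1 + z * 1 ^ q := by
    rw [one_pow]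
    linear_combination (x ^ (q + 1) + y ^ (q + 1)) * hθ
  rw [h3]

open Classical in
lemma ncard_proj (h q : ℕ) [CharP F 2] (hq : q = 2 ^ h) (hF : Fintype.card F = q ^ 2)
    (θ : F) (hθ : θ + θ ^ q = 1) (a b c d e f : F) (hc : c ≠ 0)
    (hu : ptr (2 * h) (a * b / c ^ 2) = 1) :
    Set.ncard {p : Projectivization F (Fin 4 → F) | hqCond q a b c d e f p.rep} =
      (Finset.univ.filter fun v =>
        gg q θ a b c d e f v + gg q θ a b c d e f v ^ q = 0).card + 1 := by
  have hq0 : q ≠ 0 := by rw [hq]; positivity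
  have hne : ∀ x y z : F, (![1, x, y, z] : Fin 4 → F) ≠ 0 := by
    intro x y z h0
    have := congrFun h0 0
    simp at this
  have hne' : (![0, 0, 0, 1] : Fin 4 → F) ≠ 0 := by
    intro h0
    have := congrFun h0 3
    simp at this
  let φ : F × F → Projectivization F (Fin 4 → F) := fun v =>
    Projectivization.mk F ![1, v.1, v.2,
      a * v.1 ^ 2 + b * v.2 ^ 2 + c * v.1 * v.2 + d * v.1 + e * v.2 + f] (hne _ _ _)
  have hφ : Function.Injective φ := by
    rintro ⟨x, y⟩ ⟨x1, y1⟩ hxy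
    obtain ⟨r, hr⟩ := (Projectivization.mk_eq_mk_iff F _ _ _ _).1 hxy
    have h0 := congrFun hr 0
    have h1 := congrFun hr 1
    have h2 := congrFun hr 2
    simp [Units.smul_def] at h0 h1 h2
    simp [h0] at h1 h2
    simp [h1, h2]
  have hset : {p : Projectivization F (Fin 4 → F) | hqCond q a b c d e f p.rep} =
      insert (Projectivization.mk F _ hne') (φ '' ((Finset.univ.filter fun v =>
        gg q θ a b c d e f v + gg q θ a b c d e f v ^ q = 0 : Finset (F × F)) : Set (F × F))) := by
    ext p
    simp only [Set.mem_ofPred_eq, Set.mem_insert_iff, Set.mem_image, Finset.coe_filter,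
      Finset.mem_univ, true_and]
    constructor
    · intro hp
      by_cases h0 : p.rep 0 = 0
      · left
        have h2 := hp.2
        rw [h0] at h2
        have h3 := aniso h q hq hF a b c hc hu (p.rep 1) (p.rep 2) (by linear_combination h2)
        have hr := p.rep_nonzero
        have h33 : p.rep 3 ≠ 0 := by
          intro h33
          apply hr
          ext i
          fin_cases i
          · exact h0
          · exact h3.1
          · exact h3.2
          · exact h33
        rw [← p.mk_rep, Projectivization.mk_eq_mk_iff]
        refine ⟨Units.mk0 _ h33, ?_⟩
        ext i
        fin_cases i <;> simp [Units.smul_def, h0, h3.1, h3.2]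
      · right
        have hpe : p = Projectivization.mk F ![1, p.rep 1 / p.rep 0, p.rep 2 / p.rep 0,
            p.rep 3 / p.rep 0] (hne _ _ _) := by
          conv_lhs => rw [← p.mk_rep]
          rw [Projectivization.mk_eq_mk_iff]
          refine ⟨Units.mk0 _ h0, ?_⟩
          ext i
          fin_cases i <;> simp [Units.smul_def, mul_div_cancel₀, h0]
        generalize p.rep 1 / p.rep 0 = x, p.rep 2 / p.rep 0 = y, p.rep 3 / p.rep 0 = z at hpe
        subst hpe
        rw [hqCond_rep, hqCond_affine h q hq hF θ hθ] at hp
        refine ⟨(x, y), hp.2, ?_⟩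
        simp only [φ, ← hp.1]
    · rintro (rfl | ⟨v, hv, rfl⟩)
      · rw [hqCond_rep]
        simp [hqCond, hq0]
      · simp only [φ]
        rw [hqCond_rep, hqCond_affine h q hq hF θ hθ]
        exact ⟨rfl, hv⟩
  rw [hset, Set.ncard_insert_of_notMem, Set.ncard_image_of_injective _ hφ, Set.ncard_coe_finset]
  rintro ⟨v, _, hv⟩
  obtain ⟨r, hr⟩ := (Projectivization.mk_eq_mk_iff F _ _ _ _).1 hv
  have h0 := congrFun hr 0
  simp [Units.smul_def] at h0

end helper


/-- Theorem 1.1 of the paper (elliptic case), in the normal form of Section 3: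
`ℋ : X^{q+1} + Y^{q+1} + Z^q J + Z J^q = 0` and
`𝒬 : aX² + bY² + cXY + dXJ + eYJ + fJ² + JZ = 0` in `ℙ³(GF(q²))`, with `q = 2^h`.
If `c ≠ 0` and the absolute trace of `ab/c²` is `1` (elliptic quadric), then
`|ℋ ∩ 𝒬|` lies in the stated set. -/
theorem stmt_0
    (h q : ℕ) (hh : 1 ≤ h) (hq : q = 2 ^ h)
    (F : Type) [Field F] [Fintype F] (hF : Fintype.card F = q ^ 2)
    (a b c d e f : F) (hc : c ≠ 0)
    (htr : ∑ i ∈ Finset.range (2 * h), (a * b / c ^ 2) ^ 2 ^ i = 1) :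
    Set.ncard {p : Projectivization F (Fin 4 → F) |
        (p.rep 1) ^ (q + 1) + (p.rep 2) ^ (q + 1)
            + (p.rep 3) ^ q * p.rep 0 + p.rep 3 * (p.rep 0) ^ q = 0 ∧
        a * (p.rep 1) ^ 2 + b * (p.rep 2) ^ 2 + c * p.rep 1 * p.rep 2
            + d * p.rep 1 * p.rep 0 + e * p.rep 2 * p.rep 0
            + f * (p.rep 0) ^ 2 + p.rep 0 * p.rep 3 = 0} ∈
      ({q ^ 3 - q ^ 2 + 1, q ^ 3 - q ^ 2 + q + 1, q ^ 3 - q + 1, q ^ 3 + 1,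
        q ^ 3 + q + 1, q ^ 3 + q ^ 2 - q + 1, q ^ 3 + q ^ 2 + 1} : Set ℕ) := by
  
  classical
  have hch : CharP F 2 := by
    haveI : Fact (Nat.Prime 2) := ⟨Nat.prime_two⟩
    apply charP_of_card_eq_prime_pow (f := h * 2)
    rw [hF, hq, pow_mul]
  have hu : ptr (2 * h) (a * b / c ^ 2) = 1 := htr
  obtain ⟨θ, hθ⟩ := exists_theta h q hq hF _ hu
  have hcard := ncard_proj h q hq hF θ hθ a b c d e f hc hu
  have hcnt := count_eq h q hq hF _ hu (gg q θ a b c d e f)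
  simp only [hqCond] at hcard
  rw [hcard]
  have hq2 : 2 ≤ q := by
    rw [hq]; calc 2 = 2 ^ 1 := rfl
      _ ≤ 2 ^ h := Nat.pow_le_pow_right (by norm_num) hh
  generalize (Finset.univ.filter fun v =>
        gg q θ a b c d e f v + gg q θ a b c d e f v ^ q = 0).card = N at hcnt ⊢
  have hqz : (q : ℤ) ≠ 0 := by positivity
  have l1 : q ^ 2 ≤ q ^ 3 := Nat.pow_le_pow_right (by omega) (by norm_num)
  have l2 : q ≤ q ^ 3 := Nat.le_self_pow (by norm_num) q
  have l3 : q ≤ q ^ 3 + q ^ 2 := by omega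
  have key : (N : ℤ) = q ^ 3 - q ^ 2 ∨ (N : ℤ) = q ^ 3 - q ^ 2 + q ∨ (N : ℤ) = q ^ 3 - q ∨
      (N : ℤ) = q ^ 3 ∨ (N : ℤ) = q ^ 3 + q ∨ (N : ℤ) = q ^ 3 + q ^ 2 - q ∨
      (N : ℤ) = q ^ 3 + q ^ 2 := by
    by_cases hc1 : c ^ (q + 1) = 1
    · have := rank_two h q hq hF θ hθ a b c d e f hc1 hu
      simp only [Set.mem_insert_iff, Set.mem_singleton_iff] at this
      rcases this with hs | hs | hs <;> rw [hs] at hcnt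
      · right; right; right; left
        apply mul_right_cancel₀ hqz; rw [hcnt]; ring
      · right; right; right; right; right; right
        apply mul_right_cancel₀ hqz; rw [hcnt]; ring
      · left
        apply mul_right_cancel₀ hqz; rw [hcnt]; ring
    · obtain ⟨k, s, hs, hsum⟩ := rank_four h q hq hF _ hu θ hθ a b c d e f hc1
      rw [hsum] at hcnt
      split_ifs at hcnt
      · rcases hs with rfl | rfl
        · right; right; right; right; right; left
          apply mul_right_cancel₀ hqz; rw [hcnt]; ring
        · right; left
          apply mul_right_cancel₀ hqz; rw [hcnt]; ring
      · rcases hs with rfl | rfl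
        · right; right; left
          apply mul_right_cancel₀ hqz; rw [hcnt]; ring
        · right; right; right; right; left
          apply mul_right_cancel₀ hqz; rw [hcnt]; ring
  simp only [Set.mem_insert_iff, Set.mem_singleton_iff]
  zify [l1, l2, l3]
  rcases key with h | h | h | h | h | h | h <;> rw [h] <;> simp
end

section
/- Let q = 2^h (h ≥ 1) and F = GF(q²). Let a,b,c,d,e,f ∈ F with c = 0 and (a,b) ≠ (0,0) (so that 𝒬 is a quadratic cone). Then the number of points of ℙ³(F) lying on both ℋ and 𝒬 belongs to the set {q³ − q² + q + 1, q³ − q + 1, q³ + q + 1, q³ + q² − q + 1, q³ + 2q² − q + 1}. -/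
section Helpers
open Finset Classical
set_option linter.unusedSectionVars false
set_option linter.unusedSimpArgs false
set_option linter.unusedVariables false

noncomputable def Tq {F : Type} [Field F] (q : ℕ) (hadd : ∀ x y : F, (x + y) ^ q = x ^ q + y ^ q) : F →+ F :=
  AddMonoidHom.mk' (fun x => x ^ q + x) (by intro x y; rw [hadd]; ring)

lemma fiber_card {A B : Type} [AddCommGroup A] [AddCommGroup B] [Fintype A] (f : A →+ B) (y : B)
    (hy : y ∈ f.range) : (univ.filter (fun x => f x = y)).card = Nat.card f.ker := by
  obtain ⟨x0, rfl⟩ := hy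
  rw [← SetLike.coe_sort_coe, Nat.card_coe_set_eq, ← Set.ncard_coe_finset]
  symm
  have : ((univ.filter (fun x => f x = f x0) : Finset A) : Set A) = (fun x => x + x0) '' (f.ker : Set A) := by
    ext x
    simp only [coe_filter, mem_univ, true_and, Set.mem_ofPred_eq, Set.mem_image, SetLike.mem_coe, AddMonoidHom.mem_ker]
    constructor
    · intro h
      exact ⟨x - x0, by simp [h], by simp⟩
    · rintro ⟨z, hz, rfl⟩
      simp [hz]
  rw [this, Set.ncard_image_of_injective _ (add_left_injective x0)]

lemma ker_range {A B : Type} [AddCommGroup A] [AddCommGroup B] [Fintype A] (f : A →+ B) :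
    Nat.card A = Nat.card f.ker * Nat.card f.range := by
  rw [← AddSubgroup.card_mul_index f.ker, AddSubgroup.index_ker]


lemma Kcard {F : Type} [Field F] [Fintype F] [CharP F 2] (q : ℕ) (hq : 2 ≤ q)
  (hF : Fintype.card F = q ^ 2)
  (hadd : ∀ x y : F, (x + y) ^ q = x ^ q + y ^ q) (hinv : ∀ x : F, (x ^ q) ^ q = x)
    : (univ.filter (fun x : F => x ^ q = x)).card = q ∧
    ∀ k : F, k ^ q = k → k ∈ (Tq q hadd).range := by
  set K := univ.filter (fun x : F => x ^ q = x) with hK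
  have h1 : K.card ≤ q := by
    have hne : (Polynomial.X ^ q - Polynomial.X : Polynomial F) ≠ 0 :=
      FiniteField.X_pow_card_sub_X_ne_zero F (by omega)
    have hd := FiniteField.X_pow_card_sub_X_natDegree_eq F (p := q) (by omega)
    rw [← hd]
    apply le_trans _ (Polynomial.card_roots' _)
    apply le_trans _ (Multiset.toFinset_card_le _)
    apply card_le_card
    intro x hx
    simp only [hK, mem_filter, mem_univ, true_and] at hx
    rw [Multiset.mem_toFinset, Polynomial.mem_roots hne]
    simp [hx]
  have hk : Nat.card (Tq q hadd).ker = K.card := by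
    rw [← SetLike.coe_sort_coe, Nat.card_coe_set_eq, ← Set.ncard_coe_finset]
    congr 1
    ext x
    simp [hK, Tq, AddMonoidHom.mem_ker, CharTwo.add_eq_zero]
  have hsub : ((Tq q hadd).range : Set F) ⊆ K := by
    rintro _ ⟨x, rfl⟩
    simp [hK, Tq, hadd, hinv, add_comm]
  have hr : Nat.card (Tq q hadd).range = ((Tq q hadd).range : Set F).ncard := by
    rw [← SetLike.coe_sort_coe, Nat.card_coe_set_eq]
  have h2 : Nat.card (Tq q hadd).range ≤ K.card := by
    rw [hr, ← Set.ncard_coe_finset]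
    exact Set.ncard_le_ncard hsub (Set.toFinite _)
  have h3 := ker_range (Tq q hadd)
  rw [Nat.card_eq_fintype_card, hF, hk] at h3
  have h4 : K.card = q := by nlinarith
  have h5 : Nat.card (Tq q hadd).range = q := by
    rw [h4] at h3; nlinarith
  refine ⟨h4, ?_⟩
  intro k hk
  have : ((Tq q hadd).range : Set F) = K := by
    apply Set.eq_of_subset_of_ncard_le hsub _ (Set.toFinite _)
    rw [Set.ncard_coe_finset, ← hr, h4, h5]
  have : k ∈ ((Tq q hadd).range : Set F) := by
    rw [this]; simp [hK, hk]
  exact this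

lemma Tker {F : Type} [Field F] [Fintype F] [CharP F 2] (q : ℕ) (hq : 2 ≤ q)
  (hF : Fintype.card F = q ^ 2)
  (hadd : ∀ x y : F, (x + y) ^ q = x ^ q + y ^ q) (hinv : ∀ x : F, (x ^ q) ^ q = x)
    : Nat.card (Tq q hadd).ker = q := by
  have := (Kcard q hq hF hadd hinv).1
  refine Eq.trans ?_ this
  rw [← SetLike.coe_sort_coe, Nat.card_coe_set_eq, ← Set.ncard_coe_finset]
  congr 1
  ext x
  simp [Tq, AddMonoidHom.mem_ker, CharTwo.add_eq_zero]

noncomputable def Bf {F : Type} [Field F] (q : ℕ) (hadd : ∀ x y : F, (x + y) ^ q = x ^ q + y ^ q)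
    (u : F × F) : F × F →+ F :=
  (Tq q hadd).comp (AddMonoidHom.mk' (fun v => u.1 ^ q * v.1 + u.2 ^ q * v.2)
    (by intro x y; simp only [Prod.fst_add, Prod.snd_add]; ring))

def Qf {F : Type} [Field F] (q : ℕ) (a b : F) (v : F × F) : F :=
  v.1 ^ (q + 1) + v.2 ^ (q + 1) + (a * v.1 ^ 2 + b * v.2 ^ 2) ^ q + (a * v.1 ^ 2 + b * v.2 ^ 2)

noncomputable def Gf {F : Type} [Field F] [Fintype F] (q : ℕ) (a b : F) (k : F) : ℕ :=
  (univ.filter (fun v : F × F => Qf q a b v = k)).card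


lemma Bfiber {F : Type} [Field F] [Fintype F] [CharP F 2] (q : ℕ) (hq : 2 ≤ q)
  (hF : Fintype.card F = q ^ 2)
  (hadd : ∀ x y : F, (x + y) ^ q = x ^ q + y ^ q) (hinv : ∀ x : F, (x ^ q) ^ q = x)
    (u : F × F) (hu : u ≠ 0) (k : F) (hk : k ^ q = k) :
    (univ.filter (fun v => Bf q hadd u v = k)).card = q ^ 3 := by
  have hz : ∀ x : F, x ≠ 0 → x ^ q ≠ 0 := fun x hx => pow_ne_zero _ hx
  have hs : ∀ k : F, k ^ q = k → k ∈ (Bf q hadd u).range := by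
    intro k hk
    obtain ⟨x, hx⟩ := (Kcard q hq hF hadd hinv).2 k hk
    by_cases h1 : u.1 = 0
    · have h2 : u.2 ≠ 0 := fun h => hu (Prod.ext h1 h)
      refine ⟨(0, x / u.2 ^ q), ?_⟩
      have := hz _ h2
      rw [← hx]
      simp only [Bf, AddMonoidHom.comp_apply, AddMonoidHom.mk'_apply]
      congr 1
      field_simp
      ring
    · refine ⟨(x / u.1 ^ q, 0), ?_⟩
      have := hz _ h1
      rw [← hx]
      simp only [Bf, AddMonoidHom.comp_apply, AddMonoidHom.mk'_apply]
      congr 1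
      field_simp
      ring
  rw [fiber_card _ _ (hs k hk)]
  have h3 := ker_range (Bf q hadd u)
  have h4 : Nat.card (Bf q hadd u).range = q := by
    refine Eq.trans ?_ (Kcard q hq hF hadd hinv).1
    rw [← SetLike.coe_sort_coe, Nat.card_coe_set_eq, ← Set.ncard_coe_finset]
    congr 1
    ext x
    simp only [SetLike.mem_coe, coe_filter, mem_univ, true_and, Set.mem_ofPred_eq]
    refine ⟨?_, hs x⟩
    rintro ⟨v, rfl⟩
    simp only [Bf, AddMonoidHom.comp_apply, AddMonoidHom.mk'_apply, Tq, hadd, hinv]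
    ring
  rw [h4, Nat.card_prod, Nat.card_eq_fintype_card, hF] at h3
  have : 0 < q := by omega
  apply Nat.eq_of_mul_eq_mul_right this
  rw [← h3]; ring

lemma Q_add {F : Type} [Field F] [Fintype F] [CharP F 2] (q : ℕ) (hq : 2 ≤ q)
  (hF : Fintype.card F = q ^ 2)
  (hadd : ∀ x y : F, (x + y) ^ q = x ^ q + y ^ q) (hinv : ∀ x : F, (x ^ q) ^ q = x)
    (a b : F) (u v : F × F) : Qf q a b (u + v) = Qf q a b u + Qf q a b v + Bf q hadd u v := by
  have h2 : (2 : F) = 0 := CharTwo.two_eq_zero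
  simp only [Qf, Bf, AddMonoidHom.comp_apply, AddMonoidHom.mk'_apply, Tq, hadd, hinv, Prod.fst_add,
    Prod.snd_add, pow_succ _ q, mul_pow, CharTwo.add_sq]
  simp only [← pow_mul, mul_add, add_mul, hadd, mul_pow]
  simp only [hadd, hinv, mul_comm 2 q, pow_mul, mul_pow]
  ring_nf

lemma Q_mem {F : Type} [Field F] [Fintype F] [CharP F 2] (q : ℕ) (hq : 2 ≤ q)
  (hF : Fintype.card F = q ^ 2)
  (hadd : ∀ x y : F, (x + y) ^ q = x ^ q + y ^ q) (hinv : ∀ x : F, (x ^ q) ^ q = x)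
    (a b : F) (v : F × F) : Qf q a b v ^ q = Qf q a b v := by
  simp only [Qf, hadd, hinv, pow_succ _ q, mul_pow]
  ring

lemma Q_smul {F : Type} [Field F] [Fintype F] [CharP F 2] (q : ℕ) (hq : 2 ≤ q)
  (hF : Fintype.card F = q ^ 2)
  (hadd : ∀ x y : F, (x + y) ^ q = x ^ q + y ^ q) (hinv : ∀ x : F, (x ^ q) ^ q = x)
    (a b t : F) (ht : t ^ q = t) (v : F × F) : Qf q a b (t * v.1, t * v.2) = t ^ 2 * Qf q a b v := by
  have : ∀ x y : F, (x * (t * y) ^ 2) ^ q = t ^ 2 * (x * y ^ 2) ^ q := by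
    intro x y
    rw [mul_pow, mul_pow t, mul_pow (t ^ 2), ← pow_mul t, mul_comm 2 q, pow_mul t, ht, mul_pow x]
    ring
  simp only [Qf, hadd, this]
  simp only [pow_succ _ q, mul_pow, ht]
  ring

lemma exists_sqrt {F : Type} [Field F] [Fintype F] [CharP F 2] (q : ℕ) (hq : 2 ≤ q)
  (hF : Fintype.card F = q ^ 2)
  (hadd : ∀ x y : F, (x + y) ^ q = x ^ q + y ^ q) (hinv : ∀ x : F, (x ^ q) ^ q = x)
    (k : F) : ∃ t : F, t ^ 2 = k := by
  have : Function.Surjective (frobenius F 2) :=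
    Finite.surjective_of_injective (frobenius_inj F 2)
  obtain ⟨t, ht⟩ := this k
  exact ⟨t, by simpa [frobenius_def] using ht⟩

lemma sq_inj' {F : Type} [Field F] [Fintype F] [CharP F 2] (q : ℕ) (hq : 2 ≤ q)
  (hF : Fintype.card F = q ^ 2)
  (hadd : ∀ x y : F, (x + y) ^ q = x ^ q + y ^ q) (hinv : ∀ x : F, (x ^ q) ^ q = x)
    {x y : F} (h : x ^ 2 = y ^ 2) : x = y := by
  apply frobenius_inj F 2
  simpa [frobenius_def] using h

lemma G_const {F : Type} [Field F] [Fintype F] [CharP F 2] (q : ℕ) (hq : 2 ≤ q)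
  (hF : Fintype.card F = q ^ 2)
  (hadd : ∀ x y : F, (x + y) ^ q = x ^ q + y ^ q) (hinv : ∀ x : F, (x ^ q) ^ q = x)
    (a b k : F) (hk : k ^ q = k) (hk0 : k ≠ 0) : Gf q a b k = Gf q a b 1 := by
  obtain ⟨t, rfl⟩ := exists_sqrt q hq hF hadd hinv k
  have ht : t ^ q = t := by
    apply sq_inj' q hq hF hadd hinv
    rw [← pow_mul, mul_comm, pow_mul, hk]
  have ht0 : t ≠ 0 := by rintro rfl; simp at hk0
  symm
  unfold Gf
  apply card_bij (fun v _ => (t * v.1, t * v.2))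
  · intro v hv
    simp only [mem_filter, mem_univ, true_and] at hv ⊢
    rw [Q_smul q hq hF hadd hinv a b t ht, hv, mul_one]
  · intro v _ w _ h
    simp only [Prod.mk.injEq, mul_eq_mul_left_iff, ht0, or_false] at h
    exact Prod.ext h.1 h.2
  · intro v hv
    simp only [mem_filter, mem_univ, true_and] at hv
    refine ⟨(v.1 / t, v.2 / t), ?_, ?_⟩
    · simp only [mem_filter, mem_univ, true_and]
      have := Q_smul q hq hF hadd hinv a b t ht (v.1 / t, v.2 / t)
      dsimp only at this
      have e1 : t * (v.1 / t) = v.1 := by field_simp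
      have e2 : t * (v.2 / t) = v.2 := by field_simp
      rw [e1, e2, Prod.mk.eta, hv] at this
      exact (mul_left_cancel₀ hk0 (by rw [← this, mul_one]))
    · ext <;> simp <;> field_simp

lemma sumK {F : Type} [Field F] [Fintype F] [CharP F 2] (q : ℕ) (hq : 2 ≤ q)
  (hF : Fintype.card F = q ^ 2)
  (hadd : ∀ x y : F, (x + y) ^ q = x ^ q + y ^ q) (hinv : ∀ x : F, (x ^ q) ^ q = x)
    (a b : F) (φ : ℕ → ℕ) : ∑ k ∈ univ.filter (fun x : F => x ^ q = x), φ (Gf q a b k)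
    = φ (Gf q a b 0) + (q - 1) * φ (Gf q a b 1) := by
  have h0 : (0 : F) ∈ univ.filter (fun x : F => x ^ q = x) := by
    simp; omega
  rw [← add_sum_erase _ _ h0]
  congr 1
  rw [sum_congr rfl (g := fun _ => φ (Gf q a b 1)), sum_const, card_erase_of_mem h0,
    (Kcard q hq hF hadd hinv).1, smul_eq_mul]
  intro k hk
  simp only [mem_erase, mem_filter, mem_univ, true_and] at hk
  rw [G_const q hq hF hadd hinv a b k hk.2 hk.1]

lemma G_sum {F : Type} [Field F] [Fintype F] [CharP F 2] (q : ℕ) (hq : 2 ≤ q)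
  (hF : Fintype.card F = q ^ 2)
  (hadd : ∀ x y : F, (x + y) ^ q = x ^ q + y ^ q) (hinv : ∀ x : F, (x ^ q) ^ q = x)
    (a b : F) : Gf q a b 0 + (q - 1) * Gf q a b 1 = q ^ 4 := by
  have h := sumK q hq hF hadd hinv a b id
  simp only [id] at h
  rw [← h]
  unfold Gf
  rw [← card_eq_sum_card_fiberwise (f := Qf q a b) (s := univ)]
  · rw [card_univ, Fintype.card_prod, hF]; ring
  · intro v _
    simp [Q_mem q hq hF hadd hinv]

lemma G_sumsq {F : Type} [Field F] [Fintype F] [CharP F 2] (q : ℕ) (hq : 2 ≤ q)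
  (hF : Fintype.card F = q ^ 2)
  (hadd : ∀ x y : F, (x + y) ^ q = x ^ q + y ^ q) (hinv : ∀ x : F, (x ^ q) ^ q = x)
    (a b : F) : Gf q a b 0 ^ 2 + (q - 1) * Gf q a b 1 ^ 2 = q ^ 4 + (q ^ 4 - 1) * q ^ 3 := by
  rw [← sumK q hq hF hadd hinv a b (fun x => x ^ 2)]
  have h1 : (univ.filter (fun p : (F × F) × (F × F) => Qf q a b p.1 = Qf q a b p.2)).card
      = ∑ k ∈ univ.filter (fun x : F => x ^ q = x), Gf q a b k ^ 2 := by
    rw [card_eq_sum_card_fiberwise (f := fun p => Qf q a b p.1)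
      (t := univ.filter (fun x : F => x ^ q = x))]
    · apply sum_congr rfl
      intro k _
      rw [sq, Gf, ← card_product]
      congr 1
      ext p
      simp only [mem_filter, mem_univ, true_and, mem_product]
      constructor
      · rintro ⟨h, rfl⟩; exact ⟨rfl, h.symm⟩
      · rintro ⟨h, h'⟩; exact ⟨h.trans h'.symm, h⟩
    · intro v _
      simp [Q_mem q hq hF hadd hinv]
  have h2 : (univ.filter (fun p : (F × F) × (F × F) => Qf q a b p.1 = Qf q a b p.2)).card
      = ∑ u : F × F, (univ.filter (fun v => Bf q hadd u v = Qf q a b u)).card := by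
    have : (univ.filter (fun p : (F × F) × (F × F) => Bf q hadd p.1 p.2 = Qf q a b p.1)).card
      = ∑ u : F × F, (univ.filter (fun v => Bf q hadd u v = Qf q a b u)).card := by
      rw [card_filter, Fintype.sum_prod_type]
      simp only [card_filter]
    rw [← this]
    symm
    apply card_bij (fun p _ => (p.1 + p.2, p.2))
    · intro p hp
      simp only [mem_filter, mem_univ, true_and] at hp ⊢
      rw [Q_add q hq hF hadd hinv, hp, add_right_comm, CharTwo.add_self_eq_zero, zero_add]
    · rintro ⟨p1, p2⟩ _ ⟨r1, r2⟩ _ h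
      simp only [Prod.mk.injEq] at h
      obtain ⟨h, rfl⟩ := h
      simpa using h
    · rintro ⟨p1, p2⟩ hp
      refine ⟨(p1 - p2, p2), ?_, by simp⟩
      simp only [mem_filter, mem_univ, true_and] at hp ⊢
      have := Q_add q hq hF hadd hinv a b (p1 - p2) p2
      rw [sub_add_cancel, hp] at this
      have h3 : Qf q a b (p1 - p2) + Bf q hadd (p1 - p2) p2 = 0 := by
        linear_combination -this
      exact (CharTwo.add_eq_zero.mp h3).symm
  rw [← h1, h2, ← add_sum_erase _ _ (mem_univ (0 : F × F))]
  have hq0 : q ≠ 0 := by omega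
  congr 1
  · have : ∀ v, Bf q hadd 0 v = Qf q a b 0 := by
      intro v; simp [Bf, Tq, Qf, hq0]
    rw [filter_true_of_mem (fun v _ => this v), card_univ, Fintype.card_prod, hF]; ring
  · rw [sum_congr rfl (g := fun _ => q ^ 3), sum_const, card_erase_of_mem (mem_univ _), card_univ,
      Fintype.card_prod, hF, smul_eq_mul]
    · congr 2; ring
    · intro u hu
      exact Bfiber q hq hF hadd hinv u (by simpa using hu) _ (Q_mem q hq hF hadd hinv a b u)

/-- The two possible distributions. -/
lemma G_cases {F : Type} [Field F] [Fintype F] [CharP F 2] (q : ℕ) (hq : 2 ≤ q)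
  (hF : Fintype.card F = q ^ 2)
  (hadd : ∀ x y : F, (x + y) ^ q = x ^ q + y ^ q) (hinv : ∀ x : F, (x ^ q) ^ q = x)
    (a b : F) :
    ((Gf q a b 0 : ℤ) = q ^ 3 + q ^ 2 - q ∧ (Gf q a b 1 : ℤ) = q ^ 3 - q) ∨
    ((Gf q a b 0 : ℤ) = q ^ 3 - q ^ 2 + q ∧ (Gf q a b 1 : ℤ) = q ^ 3 + q) := by
  have h1 := G_sum q hq hF hadd hinv a b
  have h2 := G_sumsq q hq hF hadd hinv a b
  generalize Gf q a b 0 = x at *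
  generalize Gf q a b 1 = y at *
  have hp : 1 ≤ q ^ 4 := Nat.one_le_pow _ _ (by omega)
  zify [hp, (by omega : 1 ≤ q)] at h1 h2
  have hq' : (2 : ℤ) ≤ q := by exact_mod_cast hq
  generalize (q : ℤ) = Q at *
  have e : ((x : ℤ) - y) ^ 2 = (Q ^ 2) ^ 2 := by
    apply mul_left_cancel₀ (a := Q - 1) (by omega)
    linear_combination Q * h2 - (x + (Q - 1) * y + Q ^ 4) * h1
  have hQ : Q ≠ 0 := by omega
  rcases sq_eq_sq_iff_eq_or_eq_neg.mp e with e | e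
  · left
    have : (y : ℤ) = Q ^ 3 - Q := by
      apply mul_left_cancel₀ hQ; linear_combination h1 - e
    exact ⟨by linear_combination e + this, this⟩
  · right
    have : (y : ℤ) = Q ^ 3 + Q := by
      apply mul_left_cancel₀ hQ; linear_combination h1 - e
    exact ⟨by linear_combination e + this, this⟩

/-- If `N(a) = N(b)`, there is a totally singular line, so many zeros. -/
lemma G_hyp {F : Type} [Field F] [Fintype F] [CharP F 2] (q : ℕ) (hq : 2 ≤ q)
  (hF : Fintype.card F = q ^ 2)
  (hadd : ∀ x y : F, (x + y) ^ q = x ^ q + y ^ q) (hinv : ∀ x : F, (x ^ q) ^ q = x)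
    (r s : F) (hrs : ¬ (r = 0 ∧ s = 0)) (hN : r ^ (q + 1) + s ^ (q + 1) = 0) :
    q ^ 3 - q + 1 ≤ Gf q (s ^ 2) (r ^ 2) 0 := by
  set a := s ^ 2
  set b := r ^ 2
  have hq0 : q ≠ 0 := by omega
  -- totally singular vectors
  have hU : ∀ t : F, Qf q a b (r * t, s * t) = 0 := by
    intro t
    have e1 : a * (r * t) ^ 2 + b * (s * t) ^ 2 = 0 := by
      have : a * (r * t) ^ 2 = b * (s * t) ^ 2 := by simp only [a, b]; ring
      rw [this, CharTwo.add_self_eq_zero]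
    simp only [Qf, e1, zero_pow hq0, add_zero]
    simp only [mul_pow]
    linear_combination t ^ (q + 1) * hN
  let c : F × F → F := fun v => v.1 ^ q * r + v.2 ^ q * s
  have hshift : ∀ v t, Qf q a b (v + (r * t, s * t)) = Qf q a b v + Tq q hadd (c v * t) := by
    intro v t
    rw [Q_add q hq hF hadd hinv, hU, add_zero]
    congr 1
    simp only [Bf, AddMonoidHom.comp_apply, AddMonoidHom.mk'_apply, c]
    congr 1
    ring
  -- number of v with c v = 0
  have hc : (univ.filter (fun v : F × F => c v = 0)).card = q ^ 2 := by
    let g : F × F →+ F := AddMonoidHom.mk' c (by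
      intro x y; simp only [c, Prod.fst_add, Prod.snd_add, hadd]; ring)
    have hg : g.range = ⊤ := by
      rw [AddMonoidHom.range_eq_top]
      intro x
      by_cases hr : r = 0
      · have hs : s ≠ 0 := fun h => hrs ⟨hr, h⟩
        refine ⟨(0, (x / s) ^ q), ?_⟩
        simp only [g, c, AddMonoidHom.mk'_apply, hinv, zero_pow hq0]
        field_simp
        ring
      · refine ⟨((x / r) ^ q, 0), ?_⟩
        simp only [g, c, AddMonoidHom.mk'_apply, hinv, zero_pow hq0]
        field_simp
        ring
    have hk := ker_range g
    rw [hg, ← fiber_card g 0 (zero_mem _), Nat.card_prod, AddSubgroup.card_top, Nat.card_eq_fintype_card, hF] at hk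
    have : 0 < q ^ 2 := by positivity
    exact (Nat.eq_of_mul_eq_mul_right this hk).symm
  -- double count
  have h1 : (univ.filter (fun p : (F × F) × F => Qf q a b (p.1 + (r * p.2, s * p.2)) = 0)).card
      = q ^ 2 * Gf q a b 0 := by
    rw [← hF, ← card_univ, Gf, mul_comm, ← card_product]
    apply card_bij (fun p _ => (p.1 + (r * p.2, s * p.2), p.2))
    · intro p hp
      simpa using hp
    · rintro ⟨p1, p2⟩ _ ⟨r1, r2⟩ _ h
      simp only [Prod.mk.injEq] at h
      obtain ⟨h, rfl⟩ := h
      simpa using h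
    · rintro ⟨p1, p2⟩ hp
      refine ⟨(p1 - (r * p2, s * p2), p2), ?_, by simp⟩
      simpa using hp
  have h2 : (univ.filter (fun p : (F × F) × F => Qf q a b (p.1 + (r * p.2, s * p.2)) = 0)).card
      = ∑ v : F × F, (univ.filter (fun t => Qf q a b (v + (r * t, s * t)) = 0)).card := by
    rw [card_filter, Fintype.sum_prod_type]
    simp only [card_filter]
  have h3 : ∀ v : F × F, c v ≠ 0 →
      (univ.filter (fun t => Qf q a b (v + (r * t, s * t)) = 0)).card = q := by
    intro v hv
    refine Eq.trans ?_ ((fiber_card (Tq q hadd) (Qf q a b v)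
      ((Kcard q hq hF hadd hinv).2 _ (Q_mem q hq hF hadd hinv a b v))).trans
        (Tker q hq hF hadd hinv))
    apply card_bij (fun t _ => c v * t)
    · intro t ht
      simp only [mem_filter, mem_univ, true_and, hshift] at ht ⊢
      exact (CharTwo.add_eq_zero.mp ht).symm
    · intro t _ t' _ h
      exact mul_left_cancel₀ hv h
    · intro x hx
      refine ⟨x / c v, ?_, by field_simp⟩
      simp only [mem_filter, mem_univ, true_and, hshift] at hx ⊢
      rw [show c v * (x / c v) = x by field_simp, hx, CharTwo.add_self_eq_zero]
  have h4 : (univ.filter (fun t => Qf q a b ((0 : F × F) + (r * t, s * t)) = 0)).card = q ^ 2 := by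
    simp [hU, hF]
  have h5 : q ^ 2 + q * (q ^ 4 - q ^ 2) ≤ q ^ 2 * Gf q a b 0 := by
    rw [← h1, h2, ← add_sum_erase _ _ (mem_univ (0 : F × F)), h4]
    apply Nat.add_le_add_left
    calc q * (q ^ 4 - q ^ 2) = ∑ v ∈ univ.filter (fun v : F × F => ¬ c v = 0), q := by
          rw [sum_const, smul_eq_mul, mul_comm, filter_not, card_sdiff_of_subset (filter_subset _ _), hc,
            card_univ, Fintype.card_prod, hF]
          congr 2; ring
      _ = ∑ v ∈ univ.filter (fun v : F × F => ¬ c v = 0),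
          (univ.filter (fun t => Qf q a b (v + (r * t, s * t)) = 0)).card := by
          apply sum_congr rfl
          intro v hv
          rw [h3 v (by simpa using hv)]
      _ ≤ _ := by
          apply sum_le_sum_of_subset
          intro v hv
          simp only [mem_filter, mem_univ, true_and] at hv
          simp only [mem_erase, mem_univ, and_true]
          rintro rfl
          exact hv (by simp [c, hq0])
  have p1 : q ^ 2 ≤ q ^ 4 := Nat.pow_le_pow_right (by omega) (by norm_num)
  have p2 : q ≤ q ^ 3 := by nlinarith [Nat.pow_le_pow_right (by omega : 0 < q) (by norm_num : 1 ≤ 3)]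
  zify [p1, p2] at h5 ⊢
  have hq' : (0 : ℤ) < q ^ 2 := by positivity
  apply le_of_mul_le_mul_left _ hq'
  linarith [h5, (by ring : (q : ℤ) ^ 2 * (q ^ 3 - q + 1) = q ^ 2 + q * (q ^ 4 - q ^ 2))]

/-- The equations of the Hermitian surface and the cone, on vectors. -/
def Ev {F : Type} [Field F] (q : ℕ) (a b d e f : F) (v : Fin 4 → F) : Prop :=
  v 1 ^ (q + 1) + v 2 ^ (q + 1) + v 3 ^ q * v 0 + v 3 * v 0 ^ q = 0 ∧
  a * v 1 ^ 2 + b * v 2 ^ 2 + d * v 1 * v 0 + e * v 2 * v 0 + f * v 0 ^ 2 + v 0 * v 3 = 0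

lemma Ev_smul {F : Type} [Field F] (q : ℕ) (a b d e f t : F) (ht : t ≠ 0) (v : Fin 4 → F) :
    Ev q a b d e f (t • v) ↔ Ev q a b d e f v := by
  unfold Ev
  simp only [Pi.smul_apply, smul_eq_mul]
  have e1 : (t * v 1) ^ (q + 1) + (t * v 2) ^ (q + 1) + (t * v 3) ^ q * (t * v 0)
      + t * v 3 * (t * v 0) ^ q = t ^ (q + 1) *
      (v 1 ^ (q + 1) + v 2 ^ (q + 1) + v 3 ^ q * v 0 + v 3 * v 0 ^ q) := by
    simp only [mul_pow]; ring
  have e2 : a * (t * v 1) ^ 2 + b * (t * v 2) ^ 2 + d * (t * v 1) * (t * v 0)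
      + e * (t * v 2) * (t * v 0) + f * (t * v 0) ^ 2 + t * v 0 * (t * v 3) = t ^ 2 *
      (a * v 1 ^ 2 + b * v 2 ^ 2 + d * v 1 * v 0 + e * v 2 * v 0 + f * v 0 ^ 2 + v 0 * v 3) := by
    ring
  rw [e1, e2]
  simp [ht]

lemma e3_ne {F : Type} [Field F] : (![0, 0, 0, 1] : Fin 4 → F) ≠ 0 := by
  intro h; simpa using congrFun h 3

/-- Projective point of a vector (junk value on `0`). -/
noncomputable def pt {F : Type} [Field F] (v : Fin 4 → F) : Projectivization F (Fin 4 → F) :=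
  if h : v ≠ 0 then Projectivization.mk F v h else Projectivization.mk F ![0, 0, 0, 1] e3_ne

lemma pt_rep {F : Type} [Field F] (q : ℕ) (a b d e f : F) (v : Fin 4 → F) (hv : v ≠ 0) :
    Ev q a b d e f (pt v).rep ↔ Ev q a b d e f v := by
  unfold pt
  rw [dif_pos hv]
  obtain ⟨u, hu⟩ := Projectivization.exists_smul_eq_mk_rep F v hv
  rw [← hu]
  exact Ev_smul q a b d e f u u.ne_zero v

lemma pt_smul {F : Type} [Field F] (t : F) (ht : t ≠ 0) (v : Fin 4 → F) :
    pt (t • v) = pt v := by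
  by_cases hv : v = 0
  · simp [hv]
  · unfold pt
    rw [dif_pos hv, dif_pos (smul_ne_zero ht hv), Projectivization.mk_eq_mk_iff']
    exact ⟨t, rfl⟩

lemma pt_eq {F : Type} [Field F] {v w : Fin 4 → F} (hv : v ≠ 0) (hw : w ≠ 0) (h : pt v = pt w) :
    ∃ t : F, t ≠ 0 ∧ v = t • w := by
  unfold pt at h
  rw [dif_pos hv, dif_pos hw, Projectivization.mk_eq_mk_iff'] at h
  obtain ⟨t, ht⟩ := h
  refine ⟨t, ?_, ht.symm⟩
  rintro rfl
  simp at ht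
  exact hv ht.symm

lemma pt_self {F : Type} [Field F] (p : Projectivization F (Fin 4 → F)) : pt p.rep = p := by
  unfold pt
  rw [dif_pos p.rep_nonzero, Projectivization.mk_rep]


lemma Ev_affine {F : Type} [Field F] [Fintype F] [CharP F 2] (q : ℕ) (hq : 2 ≤ q)
  (hF : Fintype.card F = q ^ 2)
  (hadd : ∀ x y : F, (x + y) ^ q = x ^ q + y ^ q) (hinv : ∀ x : F, (x ^ q) ^ q = x)
    (a b d e f x y z : F) : Ev q a b d e f ![1, x, y, z] ↔
    (z = a * x ^ 2 + b * y ^ 2 + d * x + e * y + f ∧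
    Qf q a b ((x, y) + (d ^ q, e ^ q)) = Qf q a b (d ^ q, e ^ q) + (f ^ q + f)) := by
  have e0 : ∀ w : F, w + w = 0 := CharTwo.add_self_eq_zero
  have hz : a * x ^ 2 + b * y ^ 2 + d * x + e * y + f + z = 0 ↔
      z = a * x ^ 2 + b * y ^ 2 + d * x + e * y + f := by
    rw [CharTwo.add_eq_zero, eq_comm]
  unfold Ev
  simp only [Matrix.cons_val, mul_one, one_pow, one_mul]
  rw [hz, and_comm]
  apply and_congr_right
  rintro rfl
  rw [Q_add q hq hF hadd hinv]
  simp only [Qf, Bf, AddMonoidHom.comp_apply, AddMonoidHom.mk'_apply, Tq, hadd, mul_pow _ _ q, hinv]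
  rw [← sub_eq_zero (b := _ + (f ^ q + f))]
  have h2 : (2 : F) = 0 := CharTwo.two_eq_zero
  constructor
  · intro h; linear_combination h - (f ^ q + f) * h2
  · intro h; linear_combination h + (f ^ q + f) * h2

lemma count {F : Type} [Field F] [Fintype F] [CharP F 2] (q : ℕ) (hq : 2 ≤ q)
  (hF : Fintype.card F = q ^ 2)
  (hadd : ∀ x y : F, (x + y) ^ q = x ^ q + y ^ q) (hinv : ∀ x : F, (x ^ q) ^ q = x)
    (r s d e f : F) (hrs : ¬ (r = 0 ∧ s = 0)) :
    Set.ncard {p : Projectivization F (Fin 4 → F) | Ev q (s ^ 2) (r ^ 2) d e f p.rep} =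
    Gf q (s ^ 2) (r ^ 2) (Qf q (s ^ 2) (r ^ 2) (d ^ q, e ^ q) + (f ^ q + f)) +
      (if r ^ (q + 1) + s ^ (q + 1) = 0 then q ^ 2 else 0) + 1 := by
  have hq0 : q ≠ 0 := by omega
  set a := s ^ 2 with ha
  set b := r ^ 2 with hb
  set k := Qf q a b (d ^ q, e ^ q) + (f ^ q + f) with hk
  let A : Set (Fin 4 → F) := (fun p : F × F =>
    (![1, p.1, p.2, a * p.1 ^ 2 + b * p.2 ^ 2 + d * p.1 + e * p.2 + f] : Fin 4 → F)) ''
      {p | Qf q a b (p + (d ^ q, e ^ q)) = k}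
  let B : Set (Fin 4 → F) := (fun t : F => (![0, r, s, t] : Fin 4 → F)) ''
      {t | r ^ (q + 1) + s ^ (q + 1) = 0}
  let C : Set (Fin 4 → F) := {![0, 0, 0, 1]}
  have hA0 : ∀ v ∈ A, v 0 = 1 := by rintro _ ⟨p, _, rfl⟩; rfl
  have hB0 : ∀ v ∈ B, v 0 = 0 ∧ v 1 = r ∧ v 2 = s := by
    rintro _ ⟨p, _, rfl⟩; exact ⟨rfl, rfl, rfl⟩
  have hC0 : ∀ v ∈ C, v 0 = 0 ∧ v 1 = 0 ∧ v 2 = 0 ∧ v 3 = 1 := by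
    rintro _ rfl; exact ⟨rfl, rfl, rfl, rfl⟩
  have hAc : A.ncard = Gf q a b k := by
    rw [Set.ncard_image_of_injective]
    · rw [Gf, ← Set.ncard_coe_finset, ← Set.ncard_image_of_injective _ (add_left_injective (d ^ q, e ^ q))]
      congr 1
      ext v
      simp only [Set.mem_image, Set.mem_ofPred_eq, coe_filter, mem_univ, true_and]
      constructor
      · rintro ⟨p, hp, rfl⟩; exact hp
      · intro h; exact ⟨v - (d ^ q, e ^ q), by simpa using h, by simp⟩
    · intro p p' h
      exact Prod.ext (by simpa using congrFun h 1) (by simpa using congrFun h 2)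
  have hBc : B.ncard = if r ^ (q + 1) + s ^ (q + 1) = 0 then q ^ 2 else 0 := by
    rw [Set.ncard_image_of_injective]
    · split_ifs with h
      · simp [h, Set.ncard_univ, hF]
      · simp [h]
    · intro t t' h
      simpa using congrFun h 3
  have hne : ∀ v ∈ A ∪ B ∪ C, v ≠ 0 := by
    rintro v ((hv | hv) | hv) rfl
    · simpa using hA0 _ hv
    · have := hB0 _ hv
      exact hrs ⟨this.2.1.symm, this.2.2.symm⟩
    · simpa using hC0 _ hv
  have hS : {p : Projectivization F (Fin 4 → F) | Ev q a b d e f p.rep} = pt '' (A ∪ B ∪ C) := by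
    ext p
    simp only [Set.mem_ofPred_eq, Set.mem_image]
    constructor
    · intro hp
      have hp0 := p.rep_nonzero
      rw [← pt_self p]
      generalize p.rep = v at hp hp0
      by_cases h0 : v 0 = 0
      · have h2 := hp.2
        have h1 := hp.1
        simp only [h0, mul_zero, zero_mul, zero_pow hq0, add_zero, ne_eq, OfNat.ofNat_ne_zero,
          not_false_eq_true, zero_pow] at h1 h2
        have h3 : s * v 1 = r * v 2 := by
          apply sq_inj' q hq hF hadd hinv
          rw [CharTwo.add_eq_zero] at h2
          rw [mul_pow, mul_pow]; exact h2
        obtain ⟨t, ht1, ht2⟩ : ∃ t, v 1 = t * r ∧ v 2 = t * s := by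
          by_cases hr : r = 0
          · have hs : s ≠ 0 := fun h => hrs ⟨hr, h⟩
            refine ⟨v 2 / s, ?_, by field_simp⟩
            rw [hr, zero_mul] at h3
            rw [hr, mul_zero]
            exact (mul_eq_zero.mp h3).resolve_left hs
          · refine ⟨v 1 / r, by field_simp, ?_⟩
            field_simp
            linear_combination -h3
        by_cases ht : t = 0
        · have h3 : v 3 ≠ 0 := by
            intro h3
            apply hp0
            ext i
            fin_cases i <;> simp [h0, ht1, ht2, ht, h3]
          refine ⟨![0, 0, 0, 1], Or.inr rfl, ?_⟩
          rw [← pt_smul (v 3) h3]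
          congr 1
          ext i
          fin_cases i <;> simp [h0, ht1, ht2, ht]
        · refine ⟨![0, r, s, v 3 / t], Or.inl (Or.inr ⟨_, ?_, rfl⟩), ?_⟩
          · have h4 : t ^ (q + 1) * (r ^ (q + 1) + s ^ (q + 1)) = 0 := by
              rw [← h1, ht1, ht2]; ring
            exact (mul_eq_zero.mp h4).resolve_left (pow_ne_zero _ ht)
          · rw [← pt_smul t ht]
            congr 1
            ext i
            fin_cases i <;> simp [h0, ht1, ht2]
            field_simp
      · have hw : (v 0)⁻¹ • v = ![1, (v 0)⁻¹ * v 1, (v 0)⁻¹ * v 2, (v 0)⁻¹ * v 3] := by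
          ext i
          fin_cases i <;> simp [h0]
        rw [← pt_smul _ (inv_ne_zero h0) v, hw]
        rw [← Ev_smul _ _ _ _ _ _ _ (inv_ne_zero h0), hw, Ev_affine q hq hF hadd hinv] at hp
        refine ⟨_, Or.inl (Or.inl ⟨((v 0)⁻¹ * v 1, (v 0)⁻¹ * v 2), hp.2, rfl⟩), ?_⟩
        dsimp only
        rw [← hp.1]
    · rintro ⟨v, hv, rfl⟩
      rw [pt_rep _ _ _ _ _ _ _ (hne v hv)]
      rcases hv with (⟨p, hp, rfl⟩ | ⟨t, ht, rfl⟩) | rfl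
      · rw [Ev_affine q hq hF hadd hinv]
        exact ⟨rfl, hp⟩
      · have ht' : r ^ (q + 1) + s ^ (q + 1) = 0 := ht
        have : a * r ^ 2 + b * s ^ 2 = 0 := by
          rw [CharTwo.add_eq_zero, ha, hb]; ring
        simp [Ev, ht', this, hq0]
      · simp [Ev, hq0]
  have hinj : Set.InjOn pt (A ∪ B ∪ C) := by
    intro v hv w hw h
    obtain ⟨t, ht, hvw⟩ := pt_eq (hne v hv) (hne w hw) h
    have hc : ∀ i, v i = t * w i := fun i => by rw [hvw]; rfl
    suffices t = 1 by rw [hvw, this, one_smul]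
    rcases hv with (hv | hv) | hv <;> rcases hw with (hw | hw) | hw
    · have := hc 0
      rw [hA0 v hv, hA0 w hw] at this
      simpa using this.symm
    · have := hc 0
      rw [hA0 v hv, (hB0 w hw).1] at this
      simp at this
    · have := hc 0
      rw [hA0 v hv, (hC0 w hw).1] at this
      simp at this
    · have := hc 0
      rw [hA0 w hw, (hB0 v hv).1] at this
      simp [ht] at this
      exact absurd this.symm ht
    · have h1 := hc 1
      have h2 := hc 2
      rw [(hB0 v hv).2.1, (hB0 w hw).2.1] at h1
      rw [(hB0 v hv).2.2, (hB0 w hw).2.2] at h2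
      by_cases hr : r = 0
      · have hs : s ≠ 0 := fun h => hrs ⟨hr, h⟩
        exact mul_right_cancel₀ hs (by rw [← h2, one_mul])
      · exact mul_right_cancel₀ hr (by rw [← h1, one_mul])
    · have h1 := hc 1
      have h2 := hc 2
      rw [(hB0 v hv).2.1, (hC0 w hw).2.1, mul_zero] at h1
      rw [(hB0 v hv).2.2, (hC0 w hw).2.2.1, mul_zero] at h2
      exact absurd ⟨h1, h2⟩ hrs
    · have := hc 0
      rw [hA0 w hw, (hC0 v hv).1, mul_one] at this
      exact absurd this.symm ht
    · have h1 := hc 1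
      have h2 := hc 2
      rw [(hB0 w hw).2.1, (hC0 v hv).2.1] at h1
      rw [(hB0 w hw).2.2, (hC0 v hv).2.2.1] at h2
      exact absurd ⟨(mul_eq_zero.mp h1.symm).resolve_left ht,
        (mul_eq_zero.mp h2.symm).resolve_left ht⟩ hrs
    · have := hc 3
      rw [(hC0 w hw).2.2.2, (hC0 v hv).2.2.2, mul_one] at this
      exact this.symm
  rw [hS, hinj.ncard_image, Set.ncard_union_eq, Set.ncard_union_eq, hAc, hBc,
    Set.ncard_singleton]
  · rw [Set.disjoint_left]
    intro v hv hv'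
    have := hA0 v hv
    rw [(hB0 v hv').1] at this
    simp at this
  · rw [Set.disjoint_left]
    rintro v (hv | hv) hv'
    · have := hA0 v hv
      rw [(hC0 v hv').1] at this
      simp at this
    · have h1 := hB0 v hv
      have h2 := hC0 v hv'
      exact hrs ⟨by rw [← h1.2.1, h2.2.1], by rw [← h1.2.2, h2.2.2.1]⟩

lemma final {F : Type} [Field F] [Fintype F] [CharP F 2] (q : ℕ) (hq : 2 ≤ q)
  (hF : Fintype.card F = q ^ 2)
  (hadd : ∀ x y : F, (x + y) ^ q = x ^ q + y ^ q) (hinv : ∀ x : F, (x ^ q) ^ q = x)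
    (a b d e f : F) (hab : ¬ (a = 0 ∧ b = 0)) :
    Set.ncard {p : Projectivization F (Fin 4 → F) | Ev q a b d e f p.rep} ∈
      ({q ^ 3 - q ^ 2 + q + 1, q ^ 3 - q + 1, q ^ 3 + q + 1,
        q ^ 3 + q ^ 2 - q + 1, q ^ 3 + 2 * q ^ 2 - q + 1} : Set ℕ) := by
  obtain ⟨s, rfl⟩ := exists_sqrt q hq hF hadd hinv a
  obtain ⟨r, rfl⟩ := exists_sqrt q hq hF hadd hinv b
  have hrs : ¬ (r = 0 ∧ s = 0) := by
    rintro ⟨rfl, rfl⟩; simp at hab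
  rw [count q hq hF hadd hinv r s d e f hrs]
  have hk : (Qf q (s ^ 2) (r ^ 2) (d ^ q, e ^ q) + (f ^ q + f)) ^ q =
      Qf q (s ^ 2) (r ^ 2) (d ^ q, e ^ q) + (f ^ q + f) := by
    rw [hadd, Q_mem q hq hF hadd hinv, hadd, hinv, add_comm f]
  generalize Qf q (s ^ 2) (r ^ 2) (d ^ q, e ^ q) + (f ^ q + f) = k at hk
  have hcase := G_cases q hq hF hadd hinv (s ^ 2) (r ^ 2)
  have hconst := G_const q hq hF hadd hinv (s ^ 2) (r ^ 2) k hk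
  have hyp := G_hyp q hq hF hadd hinv r s hrs
  have p2 : 2 * q ≤ q ^ 2 := by nlinarith
  have p3 : 2 * q ^ 2 ≤ q ^ 3 := by nlinarith [sq_nonneg q]
  simp only [Set.mem_insert_iff, Set.mem_singleton_iff]
  simp only [← Nat.cast_pow] at hcase
  clear hF
  have hG : Gf q (s ^ 2) (r ^ 2) k = Gf q (s ^ 2) (r ^ 2) 0 ∨
      Gf q (s ^ 2) (r ^ 2) k = Gf q (s ^ 2) (r ^ 2) 1 := by
    by_cases hk0 : k = 0
    · left; rw [hk0]
    · right; exact hconst hk0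
  clear hconst
  generalize Gf q (s ^ 2) (r ^ 2) k = z at *
  generalize Gf q (s ^ 2) (r ^ 2) 0 = x at *
  generalize Gf q (s ^ 2) (r ^ 2) 1 = y at *
  generalize q ^ 3 = Q3 at *
  generalize q ^ 2 = Q2 at *
  split_ifs with hN
  · have := hyp hN
    rcases hG with rfl | rfl <;> rcases hcase with ⟨h1, h2⟩ | ⟨h1, h2⟩ <;> omega
  · rcases hG with rfl | rfl <;> rcases hcase with ⟨h1, h2⟩ | ⟨h1, h2⟩ <;> omega

end Helpers


/-- Theorem 1.1 of the paper (cone case): with `c = 0` and `(a,b) ≠ (0,0)`,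
the quadric is a cone and `|ℋ ∩ 𝒬|` lies in the stated set. -/
theorem stmt_1
    (h q : ℕ) (hh : 1 ≤ h) (hq : q = 2 ^ h)
    (F : Type) [Field F] [Fintype F] (hF : Fintype.card F = q ^ 2)
    (a b c d e f : F) (hc : c = 0) (hab : ¬(a = 0 ∧ b = 0)) :
    Set.ncard {p : Projectivization F (Fin 4 → F) |
        (p.rep 1) ^ (q + 1) + (p.rep 2) ^ (q + 1)
            + (p.rep 3) ^ q * p.rep 0 + p.rep 3 * (p.rep 0) ^ q = 0 ∧
        a * (p.rep 1) ^ 2 + b * (p.rep 2) ^ 2 + c * p.rep 1 * p.rep 2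
            + d * p.rep 1 * p.rep 0 + e * p.rep 2 * p.rep 0
            + f * (p.rep 0) ^ 2 + p.rep 0 * p.rep 3 = 0} ∈
      ({q ^ 3 - q ^ 2 + q + 1, q ^ 3 - q + 1, q ^ 3 + q + 1,
        q ^ 3 + q ^ 2 - q + 1, q ^ 3 + 2 * q ^ 2 - q + 1} : Set ℕ) := by
  subst hc
  have hprime : Nat.Prime 2 := Nat.prime_two
  have : Fact (Nat.Prime 2) := ⟨hprime⟩
  have hc2 : CharP F 2 := by
    obtain ⟨p, hp⟩ := CharP.exists F
    obtain ⟨n, hpp, hn⟩ := FiniteField.card F p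
    have hd : p ∣ 2 := by
      have h1 : p ∣ Fintype.card F := by
        rw [hn]; exact dvd_pow_self _ n.ne_zero
      rw [hF, hq, ← pow_mul] at h1
      exact hpp.dvd_of_dvd_pow h1
    rwa [(Nat.prime_dvd_prime_iff_eq hpp hprime).mp hd] at hp
  have hq2 : 2 ≤ q := by
    rw [hq]; calc 2 = 2 ^ 1 := rfl
      _ ≤ 2 ^ h := Nat.pow_le_pow_right (by norm_num) hh
  have hadd : ∀ x y : F, (x + y) ^ q = x ^ q + y ^ q := by
    intro x y; rw [hq]; exact add_pow_char_pow x y 2 h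
  have hinv : ∀ x : F, (x ^ q) ^ q = x := by
    intro x; rw [← pow_mul, ← sq, ← hF]; exact FiniteField.pow_card x
  have key := final q hq2 hF hadd hinv a b d e f hab
  simpa only [Ev, zero_mul, add_zero] using key
end

section
/- Let q = 2^h (h ≥ 1) and F = GF(q²). Let a,b,c,d,e,f ∈ F with c ≠ 0 and Tr(ab/c²) = 0 (so that 𝒬 is a hyperbolic quadric). Then the number of points of ℙ³(F) lying on both ℋ and 𝒬 belongs to the set {q² + 1, q³ − q² + 1, q³ − q² + q + 1, q³ − q + 1, q³ + 1, q³ + q + 1, q³ + q² − q + 1, q³ + q² + 1, q³ + 2q² − q + 1, q³ + 2q² + 1, q³ + 3q² − q + 1, 2q³ + q² + 1}. -/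
open Finset

/-- Fibres of the trace `x ↦ x + σ x` from `GF(q²)` to `GF(q)`. -/
lemma H_fix_fib {F : Type} [Field F] [Fintype F] [DecidableEq F] (q : ℕ) (hq : 2 ≤ q)
    (hF : Fintype.card F = q ^ 2) (h2 : (2 : F) = 0) (σ : F →+* F) (hσ : ∀ x, σ (σ x) = x)
    (hp : ∀ x, σ x = x ^ q) :
    #{x : F | σ x = x} = q ∧
      ∀ k, σ k = k → #{x : F | x + σ x = k} = q := by
  have hle : #{x : F | σ x = x} ≤ q := by
    have hne : (Polynomial.X ^ q - Polynomial.X : Polynomial F) ≠ 0 :=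
      FiniteField.X_pow_card_sub_X_ne_zero F (by omega)
    have hsub : ({x : F | σ x = x} : Finset F) ⊆
        (Polynomial.X ^ q - Polynomial.X : Polynomial F).roots.toFinset := by
      intro x hx
      simp only [mem_filter, mem_univ, true_and] at hx
      rw [Multiset.mem_toFinset, Polynomial.mem_roots hne]
      simp [Polynomial.IsRoot, ← hp, hx]
    calc _ ≤ _ := card_le_card hsub
      _ ≤ _ := Multiset.toFinset_card_le _
      _ ≤ _ := Polynomial.card_roots' _
      _ = q := FiniteField.X_pow_card_sub_X_natDegree_eq F (by omega)
  have hfle : ∀ k, #{x : F | x + σ x = k} ≤ #{x : F | σ x = x} := by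
    intro k
    by_cases hk : ∃ x0, x0 + σ x0 = k
    · obtain ⟨x0, h0⟩ := hk
      apply card_le_card_of_injOn (fun x => x + x0)
      · intro x hx
        simp only [coe_filter, mem_univ, true_and, Set.mem_ofPred_eq] at hx ⊢
        rw [map_add]
        grind
      · intro x _ y _ hxy
        simpa using hxy
    · push Not at hk
      rw [filter_false_of_mem]
      · simp
      · intro x _; exact hk x
  have hsum : ∑ k ∈ ({x : F | σ x = x} : Finset F), #{x : F | x + σ x = k} = q ^ 2 := by
    rw [← hF, ← card_univ]
    symm
    apply card_eq_sum_card_fiberwise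
    intro x _
    simp only [coe_filter, mem_univ, true_and, Set.mem_ofPred_eq]
    rw [map_add, hσ, add_comm]
  have hcard : #{x : F | σ x = x} = q := by
    have : q ^ 2 ≤ #{x : F | σ x = x} * #{x : F | σ x = x} := by
      rw [← hsum]
      calc _ ≤ ∑ k ∈ ({x : F | σ x = x} : Finset F), #{x : F | σ x = x} :=
            sum_le_sum fun k _ => hfle k
        _ = _ := by simp
    nlinarith
  refine ⟨hcard, ?_⟩
  have hall := (sum_eq_sum_iff_of_le (s := ({x : F | σ x = x} : Finset F))
    (f := fun k => #{x : F | x + σ x = k}) (g := fun _ => q)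
    (fun k _ => by rw [← hcard]; exact hfle k)).1 (by rw [hsum]; simp [hcard, sq])
  intro k hk
  exact hall k (by simpa using hk)

lemma H_fib {F : Type} [Field F] [Fintype F] [DecidableEq F] (q : ℕ) (σ : F →+* F) 
    (hfib : ∀ k, σ k = k → #{x : F | x + σ x = k} = q) (α : F) (hα : α ≠ 0) (k : F)
    (hk : σ k = k) : #{x : F | α * x + σ (α * x) = k} = q := by
  rw [← hfib k hk]
  apply card_bij (fun x _ => α * x)
  · intro x hx; simpa using hx
  · intro x _ y _ hxy; exact mul_left_cancel₀ hα hxy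
  · intro y hy
    refine ⟨α⁻¹ * y, ?_, ?_⟩
    · simp only [mem_filter, mem_univ, true_and] at hy ⊢
      rwa [mul_inv_cancel_left₀ hα]
    · rw [mul_inv_cancel_left₀ hα]

/-- Second moment count for a quadratic map with non-degenerate polar form. -/
lemma H_moment {F V : Type} [Field F] [Fintype F] [DecidableEq F] [AddCommGroup V] [Fintype V]
    (q M : ℕ) (hq : 2 ≤ q) (K : Finset F) (hK : #K = q) (h0K : (0 : F) ∈ K)
    (Q : V → F) (hQ : ∀ v, Q v ∈ K) (hV : Fintype.card V = M ^ 2)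
    (hbal : ∀ u, u ≠ 0 → q * #{w : V | Q (w + u) = Q w} = M ^ 2)
    (hsc : ∀ k ∈ K, k ≠ 0 → #{v : V | Q v = k} = #{v : V | Q v = 1}) :
    ∃ s : ℤ, (s = 1 ∨ s = -1) ∧ (q * #{v : V | Q v = 0} : ℤ) = M ^ 2 + s * (q - 1) * M ∧
      ∀ k ∈ K, k ≠ 0 → (q * #{v : V | Q v = k} : ℤ) = M ^ 2 - s * M := by
  classical
  set n0 := #{v : V | Q v = 0} with hn0
  set n1 := #{v : V | Q v = 1} with hn1
  have hsum1 : n0 + (q - 1) * n1 = M ^ 2 := by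
    have h1 : Fintype.card V = ∑ k ∈ K, #{v : V | Q v = k} := by
      rw [← card_univ]
      exact card_eq_sum_card_fiberwise (fun v _ => hQ v)
    rw [← hV, h1, ← add_sum_erase K _ h0K, sum_congr rfl (g := fun _ => n1)]
    · simp [card_erase_of_mem h0K, hK, hn0]
    · intro k hk
      rw [mem_erase] at hk
      exact hsc k hk.2 hk.1
  have hpair : #{p : V × V | Q p.1 = Q p.2} = n0 ^ 2 + (q - 1) * n1 ^ 2 := by
    rw [card_eq_sum_card_fiberwise (t := K) (f := fun p : V × V => Q p.1) (fun v _ => hQ v.1)]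
    have h3 : ∀ k, #{p ∈ ({p : V × V | Q p.1 = Q p.2} : Finset (V × V)) | Q p.1 = k}
        = #{v : V | Q v = k} ^ 2 := by
      intro k
      rw [sq, ← card_product]
      congr 1
      ext ⟨v, w⟩
      simp
      grind
    simp only [h3]
    rw [← add_sum_erase K _ h0K, sum_congr rfl (g := fun _ => n1 ^ 2)]
    · simp [card_erase_of_mem h0K, hK, hn0]
    · intro k hk
      rw [mem_erase] at hk
      rw [hsc k hk.2 hk.1]
  have hpair2 : #{p : V × V | Q p.1 = Q p.2} = ∑ u : V, #{w : V | Q (w + u) = Q w} := by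
    rw [card_eq_sum_card_fiberwise (t := (univ : Finset V)) (f := fun p : V × V => p.1 - p.2)
      (fun v _ => by simp)]
    apply sum_congr rfl
    intro u _
    apply card_bij (fun p _ => p.2)
    · rintro ⟨v, w⟩ hp
      simp only [mem_filter, mem_univ, true_and] at hp ⊢
      rw [← hp.2, add_sub_cancel, hp.1]
    · rintro ⟨v, w⟩ hp ⟨v', w'⟩ hp' hh
      simp only [mem_filter, mem_univ, true_and] at hp hp' hh
      subst hh
      have := hp.2.trans hp'.2.symm
      simp at this
      rw [this]
    · intro w hw
      refine ⟨(w + u, w), ?_, rfl⟩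
      simpa using hw
  have hpair3 : q * (n0 ^ 2 + (q - 1) * n1 ^ 2) = q * M ^ 2 + (M ^ 2 - 1) * M ^ 2 := by
    rw [← hpair, hpair2, ← add_sum_erase _ _ (mem_univ (0 : V)), mul_add, mul_sum,
      sum_congr rfl (g := fun _ => M ^ 2)]
    · simp [card_erase_of_mem, hV]
    · intro u hu
      exact hbal u (by simpa using hu)
  have hM : 1 ≤ M ^ 2 := by
    rw [← hV]; exact Fintype.card_pos
  obtain ⟨r, rfl⟩ : ∃ r, q = r + 1 := ⟨q - 1, by omega⟩
  obtain ⟨m, hm⟩ : ∃ m, M ^ 2 = m + 1 := ⟨M ^ 2 - 1, by omega⟩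
  simp only [hm, Nat.add_sub_cancel] at hsum1 hpair3
  zify at hsum1 hpair3 hm
  have hr : (r : ℤ) ≠ 0 := by have : r ≠ 0 := by omega
                              exact_mod_cast this
  have e0 : (n0 : ℤ) = m + 1 - r * n1 := by linarith
  have hD : (((r : ℤ) + 1) * n1 - (m + 1)) ^ 2 = M ^ 2 := by
    rw [e0] at hpair3
    have hr1 : (r : ℤ) + 1 ≠ 0 := by positivity
    apply mul_left_cancel₀ hr
    rw [hm]
    linear_combination hpair3
  rcases sq_eq_sq_iff_eq_or_eq_neg.1 hD with h | h
  · refine ⟨-1, Or.inr rfl, ?_, ?_⟩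
    · push_cast
      rw [hm, e0]
      linear_combination (-(r : ℤ)) * h
    · intro k hk hk0
      rw [hsc k hk hk0]
      push_cast
      rw [hm]
      linear_combination h
  · refine ⟨1, Or.inl rfl, ?_, ?_⟩
    · push_cast
      rw [hm, e0]
      linear_combination (-(r : ℤ)) * h
    · intro k hk hk0
      rw [hsc k hk hk0]
      push_cast
      rw [hm]
      linear_combination h

/-- Fibres of the additive map `x ↦ T(γ x² + δ x)`. -/
lemma H_addfib {F : Type} [Field F] [Fintype F] [DecidableEq F] (h q : ℕ) (hq : q = 2 ^ h)
    (hh : 1 ≤ h)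
    (hF : Fintype.card F = q ^ 2) (h2 : (2 : F) = 0) (σ : F →+* F) (hσ : ∀ x, σ (σ x) = x)
    (hp : ∀ x, σ x = x ^ q) (hK : #{x : F | σ x = x} = q) (γ δ : F) (hne : ¬ (γ = 0 ∧ δ = 0))
    (k : F) :
    #{x : F | (γ * x ^ 2 + δ * x) + σ (γ * x ^ 2 + δ * x) = k} ∈ ({0, q, 2 * q} : Set ℕ) := by
  let g : F →+ F :=
    { toFun := fun x => (γ * x ^ 2 + δ * x) + σ (γ * x ^ 2 + δ * x)
      map_zero' := by simp
      map_add' := by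
        intro x y
        simp only [map_add, map_mul, map_pow]
        grind }
  have hg : ∀ x, g x = (γ * x ^ 2 + δ * x) + σ (γ * x ^ 2 + δ * x) := fun x => rfl
  have hker : ∀ k, (∃ x0, g x0 = k) → #{x : F | g x = k} = #{x : F | g x = 0} := by
    rintro k ⟨x0, h0⟩
    apply card_bij (fun x _ => x - x0)
    · intro x hx
      simp only [mem_filter, mem_univ, true_and] at hx ⊢
      rw [map_sub, hx, h0, sub_self]
    · intro x _ y _ hxy
      simpa using hxy
    · intro y hy
      simp only [mem_filter, mem_univ, true_and] at hy
      exact ⟨y + x0, by simp [hy, h0], by simp⟩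
  have hkerle : ∀ k, #{x : F | g x = k} ≤ #{x : F | g x = 0} := by
    intro k
    by_cases hk : ∃ x0, g x0 = k
    · exact (hker k hk).le
    · push Not at hk
      rw [filter_false_of_mem]
      · simp
      · intro x _; exact hk x
  have hqpos : 0 < q := by rw [hq]; positivity
  have hlow : q ≤ #{x : F | g x = 0} := by
    have hsum : ∑ k ∈ ({x : F | σ x = x} : Finset F), #{x : F | g x = k} = q ^ 2 := by
      rw [← hF, ← card_univ]
      symm
      apply card_eq_sum_card_fiberwise
      intro x _
      simp only [coe_filter, mem_univ, true_and, Set.mem_ofPred_eq, hg]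
      rw [map_add, hσ, add_comm]
    have : q ^ 2 ≤ q * #{x : F | g x = 0} := by
      rw [← hsum]
      calc _ ≤ ∑ k ∈ ({x : F | σ x = x} : Finset F), #{x : F | g x = 0} :=
            sum_le_sum fun k _ => hkerle k
        _ = _ := by simp [hK]
    nlinarith
  have hup : #{x : F | g x = 0} ≤ 2 * q := by
    let P : Polynomial F := Polynomial.C (σ γ) * Polynomial.X ^ (2 * q) +
      Polynomial.C (σ δ) * Polynomial.X ^ q + Polynomial.C γ * Polynomial.X ^ 2
        + Polynomial.C δ * Polynomial.X
    have hq1 : 2 ≤ q := by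
      rw [hq]; calc 2 = 2 ^ 1 := rfl
        _ ≤ 2 ^ h := Nat.pow_le_pow_right (by norm_num) hh
    have hP : P ≠ 0 := by
      intro h0
      apply hne
      have hc1 : P.coeff (2 * q) = 0 := by rw [h0]; simp
      have hc2 : P.coeff 1 = 0 := by rw [h0]; simp
      simp only [P, Polynomial.coeff_add, Polynomial.coeff_C_mul, Polynomial.coeff_X_pow,
        Polynomial.coeff_X] at hc1 hc2
      rw [if_pos trivial, if_neg (by omega), if_neg (by omega), if_neg (by omega)] at hc1
      rw [if_neg (by omega), if_neg (by omega), if_neg (by omega), if_pos trivial] at hc2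
      simpa using And.intro hc1 hc2
    have hsub : ({x : F | g x = 0} : Finset F) ⊆ P.roots.toFinset := by
      intro x hx
      simp only [mem_filter, mem_univ, true_and, hg] at hx
      rw [Multiset.mem_toFinset, Polynomial.mem_roots hP]
      simp only [map_add, map_mul, map_pow] at hx
      rw [hp x] at hx
      simp only [Polynomial.IsRoot, P, Polynomial.eval_add, Polynomial.eval_mul,
        Polynomial.eval_C, Polynomial.eval_pow, Polynomial.eval_X]
      rw [mul_comm 2 q, pow_mul]
      linear_combination hx
    calc _ ≤ _ := card_le_card hsub
      _ ≤ _ := Multiset.toFinset_card_le _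
      _ ≤ _ := Polynomial.card_roots' _
      _ ≤ 2 * q := by
        simp only [P]
        compute_degree
        simp
        omega
  have hdvd : #{x : F | g x = 0} ∣ 2 ^ (2 * h) := by
    have h1 : Nat.card g.ker ∣ Nat.card F := AddSubgroup.card_addSubgroup_dvd_card g.ker
    have h3 : Nat.card g.ker = #{x : F | g x = 0} := 
      Nat.subtype_card _ (by simp [AddMonoidHom.mem_ker])
    rw [h3, Nat.card_eq_fintype_card, hF, hq, ← pow_mul, mul_comm] at h1
    exact h1
  have hval : #{x : F | g x = 0} = q ∨ #{x : F | g x = 0} = 2 * q := by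
    obtain ⟨j, _, hj⟩ := (Nat.dvd_prime_pow Nat.prime_two).1 hdvd
    rw [hj, hq, ← pow_succ'] at hup
    rw [hj, hq] at hlow
    rw [hj, hq, ← pow_succ']
    have h3 := (Nat.pow_le_pow_iff_right (by norm_num : 1 < 2)).1 hup
    have h4 := (Nat.pow_le_pow_iff_right (by norm_num : 1 < 2)).1 hlow
    have : j = h ∨ j = h + 1 := by omega
    rcases this with h | h <;> simp [h]
  simp only [← hg, Set.mem_insert_iff, Set.mem_singleton_iff]
  by_cases hk : ∃ x0, g x0 = k
  · rw [hker k hk]; tauto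
  · left
    push Not at hk
    rw [card_eq_zero, filter_false_of_mem]
    intro x _; exact hk x

lemma H_sqrt {F : Type} [Field F] [Fintype F] (h2 : (2 : F) = 0) (k : F) : ∃ l : F, l ^ 2 = k := by
  have hinj : Function.Injective (fun x : F => x ^ 2) := by
    intro x y hxy
    have : (x - y) ^ 2 = 0 := by
      simp only at hxy
      linear_combination hxy + (y ^ 2 - x * y) * h2
    exact sub_eq_zero.1 (pow_eq_zero_iff (by norm_num) |>.1 this)
  exact (Finite.injective_iff_surjective.1 hinj) k

lemma H_sqrt_fix {F : Type} [Field F] [Fintype F] (h2 : (2 : F) = 0) (σ : F →+* F) (k : F)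
    (hk : σ k = k) : ∃ l : F, l ^ 2 = k ∧ σ l = l := by
  obtain ⟨l, hl⟩ := H_sqrt h2 k
  refine ⟨l, hl, ?_⟩
  have h1 : (σ l) ^ 2 = l ^ 2 := by rw [← map_pow, hl, hk]
  have : (σ l - l) ^ 2 = 0 := by
    linear_combination h1 + (l ^ 2 - σ l * l) * h2
  exact sub_eq_zero.1 (pow_eq_zero_iff (by norm_num) |>.1 this)

/-- Fibres of a nonzero trace form on pairs. -/
lemma H_fib2 {F : Type} [Field F] [Fintype F] [DecidableEq F] (q : ℕ)
    (hF : Fintype.card F = q ^ 2) (σ : F →+* F) (hσ : ∀ x, σ (σ x) = x) (h2 : (2 : F) = 0)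
    (hfib : ∀ k, σ k = k → #{x : F | x + σ x = k} = q) (α β : F) (hα : ¬ (α = 0 ∧ β = 0)) (k : F)
    (hk : σ k = k) :
    #{p : F × F | (α * p.1 + β * p.2) + σ (α * p.1 + β * p.2) = k} = q ^ 3 := by
  by_cases h : α = 0
  · have hβ : β ≠ 0 := fun hb => hα ⟨h, hb⟩
    subst h
    have : ({p : F × F | (0 * p.1 + β * p.2) + σ (0 * p.1 + β * p.2) = k} : Finset (F × F)) =
        (univ : Finset F) ×ˢ ({x : F | β * x + σ (β * x) = k} : Finset F) := by
      ext ⟨x, y⟩; simp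
    rw [this, card_product, H_fib q σ hfib β hβ k hk, card_univ, hF]
    ring
  · rw [card_eq_sum_card_fiberwise (t := univ) (f := fun p : F × F => p.2) (by simp),
      sum_congr rfl (g := fun _ => q)]
    · simp [hF]; ring
    · intro y _
      rw [← H_fib q σ hfib α h (k + (β * y + σ (β * y)))
        (by simp only [map_add, hσ, hk]; ring)]
      apply card_bij (fun p _ => p.1)
      · rintro ⟨x, z⟩ hp
        simp only [mem_filter, mem_univ, true_and] at hp ⊢
        obtain ⟨hp, rfl⟩ := hp
        simp only [map_add] at hp
        rw [← hp]
        linear_combination -(β * z + σ (β * z)) * h2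
      · rintro ⟨x, z⟩ hp ⟨x', z'⟩ hp' hh
        simp only [mem_filter, mem_univ, true_and] at hp hp' hh
        rw [hh, hp.2, hp'.2]
      · intro x hx
        refine ⟨(x, y), ?_, rfl⟩
        simp only [mem_filter, mem_univ, true_and, and_true] at hx ⊢
        rw [map_add]
        linear_combination hx + (β * y + σ (β * y)) * h2

/-- The non-degenerate four-dimensional case. -/
lemma H_dim4 {F : Type} [Field F] [Fintype F] [DecidableEq F] (q : ℕ) (hq : 2 ≤ q)
    (hF : Fintype.card F = q ^ 2) (h2 : (2 : F) = 0) (σ : F →+* F) (hσ : ∀ x, σ (σ x) = x)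
    (hK : #{x : F | σ x = x} = q)
    (hfib : ∀ k, σ k = k → #{x : F | x + σ x = k} = q)
    (a b c d e f : F) (hc : c * σ c ≠ 1) (n : ℕ)
    (hn : n = #{p : F × F | p.1 * σ p.1 + p.2 * σ p.2 +
      (a * p.1 ^ 2 + b * p.2 ^ 2 + c * p.1 * p.2 + d * p.1 + e * p.2 + f) +
      σ (a * p.1 ^ 2 + b * p.2 ^ 2 + c * p.1 * p.2 + d * p.1 + e * p.2 + f) = 0}) :
    ((n : ℤ) = q ^ 3 + q ^ 2 - q ∨ (n : ℤ) = q ^ 3 - q ∨ (n : ℤ) = q ^ 3 - q ^ 2 + q ∨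
      (n : ℤ) = q ^ 3 + q) := by
  set Q : F × F → F := fun p => p.1 * σ p.1 + p.2 * σ p.2 +
      (a * p.1 ^ 2 + b * p.2 ^ 2 + c * p.1 * p.2) +
      σ (a * p.1 ^ 2 + b * p.2 ^ 2 + c * p.1 * p.2) with hQdef
  have hpol : ∀ w u : F × F, Q (w + u) = Q w + Q u +
      (((σ u.1 + c * u.2) * w.1 + (σ u.2 + c * u.1) * w.2) +
        σ ((σ u.1 + c * u.2) * w.1 + (σ u.2 + c * u.1) * w.2)) := by
    rintro ⟨x, y⟩ ⟨x', y'⟩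
    simp only [hQdef, Prod.mk_add_mk, map_add, map_mul, map_pow, hσ]
    linear_combination (a * x * x' + b * y * y' + σ a * σ x * σ x' + σ b * σ y * σ y') * h2
  have hrad : ∀ u : F × F, σ u.1 + c * u.2 = 0 → σ u.2 + c * u.1 = 0 → u = 0 := by
    rintro ⟨x, y⟩ h1 h3
    simp only at h1 h3
    have h4 : x + σ c * σ y = 0 := by
      have := congrArg σ h1
      simpa [hσ] using this
    have h5 : (1 - c * σ c) * x = 0 := by linear_combination h4 - σ c * h3
    have hx : x = 0 := by
      rcases mul_eq_zero.1 h5 with h | h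
      · exact absurd (sub_eq_zero.1 h).symm hc
      · exact h
    subst hx
    have hy : σ y = 0 := by simpa using h3
    have hy : y = 0 := by simpa using hy
    rw [hy]; rfl
  have hQK : ∀ v, σ (Q v) = Q v := by
    intro v
    simp only [hQdef, map_add, map_mul, map_pow, hσ]
    ring
  obtain ⟨s, hs, hs0, hs1⟩ := H_moment q (q ^ 2) hq ({x : F | σ x = x} : Finset F) hK (by simp) Q
    (fun v => by simp [hQK]) (by rw [Fintype.card_prod, hF]; ring) (by
      intro u hu
      have hne : ¬ (σ u.1 + c * u.2 = 0 ∧ σ u.2 + c * u.1 = 0) := fun h => hu (hrad u h.1 h.2)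
      have := H_fib2 q hF σ hσ h2 hfib _ _ hne (Q u) (hQK u)
      rw [show (q ^ 2) ^ 2 = q * q ^ 3 by ring, ← this]
      congr 2
      ext w
      simp only [mem_filter, mem_univ, true_and, hpol w u]
      constructor
      · intro h; linear_combination h - Q u * h2
      · intro h; linear_combination h + Q u * h2) (by
      intro k hk hk0
      obtain ⟨l, hl, hl2⟩ := H_sqrt_fix h2 σ k (by simpa using hk)
      have hl0 : l ≠ 0 := by rintro rfl; apply hk0; rw [← hl]; simp
      have hQs : ∀ v : F × F, Q (l * v.1, l * v.2) = k * Q v := by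
        intro v
        simp only [hQdef, map_add, map_mul, map_pow, hl2, ← hl]
        ring
      symm
      apply card_bij (fun v _ => (l * v.1, l * v.2))
      · intro v hv
        simp only [mem_filter, mem_univ, true_and] at hv ⊢
        rw [hQs, hv, mul_one]
      · rintro ⟨x, y⟩ _ ⟨x', y'⟩ _ hh
        simpa [hl0] using hh
      · rintro ⟨x, y⟩ hv
        simp only [mem_filter, mem_univ, true_and] at hv
        refine ⟨(l⁻¹ * x, l⁻¹ * y), ?_, ?_⟩
        · have := hQs (l⁻¹ * x, l⁻¹ * y)
          simp only [mul_inv_cancel_left₀ hl0, hv] at this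
          simp only [mem_filter, mem_univ, true_and]
          exact mul_left_cancel₀ hk0 (by rw [← this, mul_one])
        · simp [mul_inv_cancel_left₀ hl0])
  -- translation
  obtain ⟨u, hu⟩ : ∃ u : F × F, (σ u.1 + c * u.2, σ u.2 + c * u.1) = (d, e) := by
    let g : F × F →+ F × F :=
      { toFun := fun u => (σ u.1 + c * u.2, σ u.2 + c * u.1)
        map_zero' := by simp
        map_add' := by
          intro u v
          ext
          · simp; ring
          · simp; ring }
    have hgi : Function.Injective g := by
      rw [injective_iff_map_eq_zero]
      intro u hu
      have hu' : (σ u.1 + c * u.2, σ u.2 + c * u.1) = ((0 : F), (0 : F)) := hu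
      rw [Prod.mk.injEq] at hu'
      exact hrad u hu'.1 hu'.2
    exact Finite.injective_iff_surjective.1 hgi (d, e)
  rw [Prod.mk.injEq] at hu
  have hcount : n = #{v : F × F | Q v = Q u + (f + σ f)} := by
    rw [hn]
    apply card_bij (fun v _ => v + u)
    · rintro ⟨x, y⟩ hv
      simp only [mem_filter, mem_univ, true_and] at hv ⊢
      rw [hpol, hu.1, hu.2]
      simp only [map_add] at hv ⊢
      have : Q (x, y) = x * σ x + y * σ y + (a * x ^ 2 + b * y ^ 2 + c * x * y) +
        (σ (a * x ^ 2) + σ (b * y ^ 2) + σ (c * x * y)) := by simp only [hQdef, map_add]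
      rw [this]
      linear_combination hv - (f + σ f) * h2
    · intro v _ w _ hh
      simpa using hh
    · intro w hw
      refine ⟨w - u, ?_, by simp⟩
      simp only [mem_filter, mem_univ, true_and] at hw ⊢
      have h3 := hpol (w - u) u
      rw [sub_add_cancel, hw, hu.1, hu.2] at h3
      generalize w - u = v at h3 ⊢
      obtain ⟨x, y⟩ := v
      have : Q (x, y) = x * σ x + y * σ y + (a * x ^ 2 + b * y ^ 2 + c * x * y) +
        (σ (a * x ^ 2) + σ (b * y ^ 2) + σ (c * x * y)) := by simp only [hQdef, map_add]
      rw [this] at h3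
      simp only [map_add] at h3 ⊢
      linear_combination -h3 + (f + σ f) * h2
  have hq0 : (q : ℤ) ≠ 0 := by positivity
  by_cases hk0 : Q u + (f + σ f) = 0
  · rw [hk0] at hcount
    rw [← hcount] at hs0
    push_cast at hs0
    rcases hs with rfl | rfl
    · left
      apply mul_left_cancel₀ hq0
      rw [hs0]; ring
    · right; right; left
      apply mul_left_cancel₀ hq0
      rw [hs0]; ring
  · have := hs1 _ (by simp [hQK, hσ, add_comm]) hk0
    rw [← hcount] at this
    push_cast at this
    rcases hs with rfl | rfl
    · right; left
      apply mul_left_cancel₀ hq0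
      rw [this]; ring
    · right; right; right
      apply mul_left_cancel₀ hq0
      rw [this]; ring

/-- The two-dimensional count. -/
lemma H_dim2 {F : Type} [Field F] [Fintype F] [DecidableEq F] (q : ℕ) (hq : 2 ≤ q)
    (hF : Fintype.card F = q ^ 2) (h2 : (2 : F) = 0) (σ : F →+* F) (hσ : ∀ x, σ (σ x) = x)
    (hK : #{x : F | σ x = x} = q)
    (hfib : ∀ k, σ k = k → #{x : F | x + σ x = k} = q)
    (β ε : F) :
    ∃ s : ℤ, ∃ k0 : F, (s = 1 ∨ s = -1) ∧ σ k0 = k0 ∧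
      (s = 1 → ∃ w, w ≠ 0 ∧ w * σ w + (β * w ^ 2) + σ (β * w ^ 2) = 0) ∧
      ∀ k, σ k = k → (#{w : F | w * σ w + (β * w ^ 2 + ε * w) + σ (β * w ^ 2 + ε * w) = k} : ℤ) =
        if k = k0 then q + s * (q - 1) else q - s := by
  set Q : F → F := fun w => w * σ w + β * w ^ 2 + σ (β * w ^ 2) with hQdef
  have hpol : ∀ w u : F, Q (w + u) = Q w + Q u + (σ u * w + σ (σ u * w)) := by
    intro x y
    simp only [hQdef, map_add, map_mul, map_pow, hσ]
    linear_combination (β * x * y + σ β * σ x * σ y) * h2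
  have hQK : ∀ v, σ (Q v) = Q v := by
    intro v
    simp only [hQdef, map_add, map_mul, map_pow, hσ]
    ring
  obtain ⟨s, hs, hs0, hs1⟩ := H_moment q q hq ({x : F | σ x = x} : Finset F) hK (by simp) Q
    (fun v => by simp [hQK]) hF (by
      intro u hu
      have := H_fib q σ hfib (σ u) (by simpa using hu) (Q u) (hQK u)
      rw [sq]
      congr 1
      rw [← this]
      congr 1
      ext w
      simp only [mem_filter, mem_univ, true_and, hpol w u]
      constructor
      · intro h; linear_combination h - Q u * h2
      · intro h; linear_combination h + Q u * h2) (by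
      intro k hk hk0
      obtain ⟨l, hl, hl2⟩ := H_sqrt_fix h2 σ k (by simpa using hk)
      have hl0 : l ≠ 0 := by rintro rfl; apply hk0; rw [← hl]; simp
      have hQs : ∀ v : F, Q (l * v) = k * Q v := by
        intro v
        simp only [hQdef, map_mul, map_pow, hl2, ← hl]
        ring
      symm
      apply card_bij (fun v _ => l * v)
      · intro v hv
        simp only [mem_filter, mem_univ, true_and] at hv ⊢
        rw [hQs, hv, mul_one]
      · intro x _ y _ hh
        simpa [hl0] using hh
      · intro x hv
        simp only [mem_filter, mem_univ, true_and] at hv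
        refine ⟨l⁻¹ * x, ?_, ?_⟩
        · have := hQs (l⁻¹ * x)
          simp only [mul_inv_cancel_left₀ hl0, hv] at this
          simp only [mem_filter, mem_univ, true_and]
          exact mul_left_cancel₀ hk0 (by rw [← this, mul_one])
        · simp [mul_inv_cancel_left₀ hl0])
  have hq0 : (q : ℤ) ≠ 0 := by positivity
  have hQ0 : (#{v : F | Q v = 0} : ℤ) = q + s * (q - 1) := by
    apply mul_left_cancel₀ hq0
    rw [hs0]; ring
  have hQk : ∀ k, σ k = k → k ≠ 0 → (#{v : F | Q v = k} : ℤ) = q - s := by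
    intro k hk hk0
    apply mul_left_cancel₀ hq0
    rw [hs1 k (by simpa using hk) hk0]; ring
  refine ⟨s, Q (σ ε), hs, hQK _, ?_, ?_⟩
  · rintro rfl
    have : 1 < #{v : F | Q v = 0} := by
      zify; rw [hQ0]
      have : (2 : ℤ) ≤ q := by exact_mod_cast hq
      linarith
    obtain ⟨w, hw, hw0⟩ := exists_mem_ne this 0
    exact ⟨w, hw0, by simpa [hQdef] using hw⟩
  · intro k hk
    have hcount : #{w : F | w * σ w + (β * w ^ 2 + ε * w) + σ (β * w ^ 2 + ε * w) = k} =
        #{v : F | Q v = k + Q (σ ε)} := by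
      have key : ∀ w, Q (w + σ ε) =
          w * σ w + (β * w ^ 2 + ε * w) + σ (β * w ^ 2 + ε * w) + Q (σ ε) := by
        intro w
        rw [hpol, hσ, map_add]
        simp only [hQdef]
        ring
      apply card_bij (fun v _ => v + σ ε)
      · intro x hv
        simp only [mem_filter, mem_univ, true_and] at hv ⊢
        rw [key, hv]
      · intro v _ w _ hh
        simpa using hh
      · intro w hw
        refine ⟨w - σ ε, ?_, by simp⟩
        simp only [mem_filter, mem_univ, true_and] at hw ⊢
        have h3 := key (w - σ ε)
        rw [sub_add_cancel, hw] at h3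
        exact (add_right_cancel h3).symm
    rw [hcount]
    by_cases hkk : k = Q (σ ε)
    · rw [if_pos hkk, ← hQ0, hkk]
      congr 4
      ext v
      rw [show Q (σ ε) + Q (σ ε) = 0 by linear_combination Q (σ ε) * h2]
    · rw [if_neg hkk]
      apply hQk
      · rw [map_add, hk, hQK]
      · intro h
        apply hkk
        linear_combination h - Q (σ ε) * h2

/-- The degenerate case without common directions at infinity. -/
lemma H_deg {F : Type} [Field F] [Fintype F] [DecidableEq F] (h q : ℕ) (hqh : q = 2 ^ h)
    (hh : 1 ≤ h) (hq : 2 ≤ q)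
    (hF : Fintype.card F = q ^ 2) (h2 : (2 : F) = 0) (σ : F →+* F) (hσ : ∀ x, σ (σ x) = x)
    (hp : ∀ x, σ x = x ^ q)
    (hK : #{x : F | σ x = x} = q)
    (hfib : ∀ k, σ k = k → #{x : F | x + σ x = k} = q)
    (a b c d e f : F) (hc : c * σ c = 1)
    (hm : ∀ t, a + b * t ^ 2 + c * t = 0 → t * σ t ≠ 1) (n : ℕ)
    (hn : n = #{p : F × F | p.1 * σ p.1 + p.2 * σ p.2 +
      (a * p.1 ^ 2 + b * p.2 ^ 2 + c * p.1 * p.2 + d * p.1 + e * p.2 + f) +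
      σ (a * p.1 ^ 2 + b * p.2 ^ 2 + c * p.1 * p.2 + d * p.1 + e * p.2 + f) = 0}) :
    ((n : ℤ) = q ^ 3 + q ^ 2 ∨ (n : ℤ) = q ^ 3 - q ^ 2 ∨ (n : ℤ) = q ^ 3 ∨
      (n : ℤ) = q ^ 2) := by
  have hc0 : c ≠ 0 := by rintro rfl; simp at hc
  obtain ⟨β, hβ⟩ : ∃ β, β = b * σ c ^ 2 := ⟨_, rfl⟩
  obtain ⟨ε, hε⟩ : ∃ ε, ε = e * σ c := ⟨_, rfl⟩
  obtain ⟨γ, hγ⟩ : ∃ γ, γ = a + σ b * c ^ 2 := ⟨_, rfl⟩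
  obtain ⟨δ, hδ⟩ : ∃ δ, δ = d + σ e * c := ⟨_, rfl⟩
  obtain ⟨s, k0, hs, hk0, hs1, hcnt⟩ := H_dim2 q hq hF h2 σ hσ hK hfib β ε
  have key : ∀ x w : F, x * σ x + (σ c * (σ x + w)) * σ (σ c * (σ x + w)) +
      (a * x ^ 2 + b * (σ c * (σ x + w)) ^ 2 + c * x * (σ c * (σ x + w)) + d * x
        + e * (σ c * (σ x + w)) + f) +
      σ (a * x ^ 2 + b * (σ c * (σ x + w)) ^ 2 + c * x * (σ c * (σ x + w)) + d * x
        + e * (σ c * (σ x + w)) + f) =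
      (w * σ w + (β * w ^ 2 + ε * w) + σ (β * w ^ 2 + ε * w)) +
      ((γ * x ^ 2 + δ * x) + σ (γ * x ^ 2 + δ * x) + (f + σ f)) := by
    intro x w
    subst hβ hε hγ hδ
    simp only [map_add, map_mul, map_pow, hσ]
    linear_combination ((σ x + w) * (x + σ w) + x * (σ x + w) + σ x * (x + σ w)) * hc +
      (2 * x * σ x + x * w + σ x * σ w + b * σ c ^ 2 * σ x * w + σ b * c ^ 2 * x * σ w) * h2
  have hnsum : n = ∑ x : F, #{w : F | w * σ w + (β * w ^ 2 + ε * w) + σ (β * w ^ 2 + ε * w) =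
      (γ * x ^ 2 + δ * x) + σ (γ * x ^ 2 + δ * x) + (f + σ f)} := by
    rw [hn, card_eq_sum_card_fiberwise (t := univ) (f := fun p : F × F => p.1) (by simp)]
    apply sum_congr rfl
    intro x _
    symm
    apply card_bij (fun w _ => (x, σ c * (σ x + w)))
    · intro w hw
      simp only [mem_filter, mem_univ, true_and, and_true] at hw ⊢
      rw [key, hw]
      linear_combination ((γ * x ^ 2 + δ * x) + σ (γ * x ^ 2 + δ * x) + (f + σ f)) * h2
    · intro w _ w' _ hww
      simpa [hc0] using hww
    · rintro ⟨x', y⟩ hp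
      simp only [mem_filter, mem_univ, true_and] at hp
      obtain ⟨hp, rfl⟩ := hp
      have hy : y = σ c * (σ x' + (c * y + σ x')) := by
        linear_combination (-y) * hc - σ c * σ x' * h2
      refine ⟨c * y + σ x', ?_, ?_⟩
      · simp only [mem_filter, mem_univ, true_and]
        rw [hy, key] at hp
        linear_combination hp - ((γ * x' ^ 2 + δ * x') + σ (γ * x' ^ 2 + δ * x') + (f + σ f)) * h2
      · rw [← hy]
  have hnZ : (n : ℤ) = q ^ 2 * (q - s) +
      s * q * #{x : F | (γ * x ^ 2 + δ * x) + σ (γ * x ^ 2 + δ * x) = k0 + (f + σ f)} := by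
    rw [hnsum]
    push_cast
    have : ∀ x ∈ (univ : Finset F),
        (#{w : F | w * σ w + (β * w ^ 2 + ε * w) + σ (β * w ^ 2 + ε * w) =
      (γ * x ^ 2 + δ * x) + σ (γ * x ^ 2 + δ * x) + (f + σ f)} : ℤ) = (q - s) +
        if (γ * x ^ 2 + δ * x) + σ (γ * x ^ 2 + δ * x) = k0 + (f + σ f) then s * q else 0 := by
      intro x _
      rw [hcnt _ (by simp only [map_add, hσ]; ring)]
      by_cases hx : (γ * x ^ 2 + δ * x) + σ (γ * x ^ 2 + δ * x) = k0 + (f + σ f)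
      · rw [if_pos hx, if_pos]
        · ring
        · rw [hx]; linear_combination (f + σ f) * h2
      · rw [if_neg hx, if_neg]
        · ring
        · intro h'; apply hx; rw [← h']; linear_combination (-f - σ f) * h2
    rw [sum_congr rfl this, sum_add_distrib, ← sum_filter]
    simp [hF]
    ring
  by_cases hz : γ = 0 ∧ δ = 0
  · obtain ⟨hg, hd⟩ := hz
    have hset : #{x : F | (γ * x ^ 2 + δ * x) + σ (γ * x ^ 2 + δ * x) = k0 + (f + σ f)} =
        if k0 + (f + σ f) = 0 then q ^ 2 else 0 := by
      rw [hg, hd]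
      split_ifs with hk
      · simp [hk, hF]
      · have : ∀ x : F, ¬ (0 * x ^ 2 + 0 * x + σ (0 * x ^ 2 + 0 * x) = k0 + (f + σ f)) := by
          intro x hx; apply hk; rw [← hx]; simp
        simp [Ne.symm hk]
    rw [hset] at hnZ
    rcases hs with rfl | rfl
    · exfalso
      obtain ⟨w, hw0, hw⟩ := hs1 rfl
      have hsw : σ w ≠ 0 := by simpa using hw0
      apply hm (σ c * w / σ w)
      · have ha : a = σ b * c ^ 2 := by linear_combination hγ.symm.trans hg - σ b * c ^ 2 * h2
        rw [ha]
        subst hβ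
        simp only [map_mul, map_pow, hσ] at hw
        field_simp
        linear_combination hw + w * σ w * hc
      · rw [map_div₀, map_mul, hσ, hσ]
        field_simp
        linear_combination hc
    · split_ifs at hnZ with hk
      · right; right; right; rw [hnZ]; push_cast; ring
      · left; rw [hnZ]; push_cast; ring
  · have := H_addfib h q hqh hh hF h2 σ hσ hp hK γ δ hz (k0 + (f + σ f))
    simp only [Set.mem_insert_iff, Set.mem_singleton_iff] at this
    rcases this with h | h | h <;> rcases hs with rfl | rfl <;> rw [h] at hnZ <;>
      push_cast at hnZ <;> rw [hnZ]
    · right; left; ring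
    · left; ring
    · right; right; left; ring
    · right; right; left; ring
    · left; ring
    · right; left; ring

/-- Counting along a common direction at infinity. -/
lemma H_dir {F : Type} [Field F] [Fintype F] [DecidableEq F] (q : ℕ)
    (hF : Fintype.card F = q ^ 2) (h2 : (2 : F) = 0) (σ : F →+* F) (hσ : ∀ x, σ (σ x) = x)
    (hfib : ∀ k, σ k = k → #{x : F | x + σ x = k} = q)
    (a b c d e f t : F) (ht : a + b * t ^ 2 + c * t = 0) (ht1 : t * σ t = 1) (n : ℕ)
    (hn : n = #{p : F × F | p.1 * σ p.1 + p.2 * σ p.2 +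
      (a * p.1 ^ 2 + b * p.2 ^ 2 + c * p.1 * p.2 + d * p.1 + e * p.2 + f) +
      σ (a * p.1 ^ 2 + b * p.2 ^ 2 + c * p.1 * p.2 + d * p.1 + e * p.2 + f) = 0}) :
    (n : ℤ) = q ^ 3 - q * #{z : F | c * z + t * σ z + d + e * t = 0} +
      q ^ 2 * #{z : F | c * z + t * σ z + d + e * t = 0 ∧
        z * σ z + (b * z ^ 2 + e * z + f) + σ (b * z ^ 2 + e * z + f) = 0} := by
  have ha : a = b * t ^ 2 + c * t := by linear_combination ht - (b * t ^ 2 + c * t) * h2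
  have key : ∀ x z : F, x * σ x + (t * x + z) * σ (t * x + z) +
      (a * x ^ 2 + b * (t * x + z) ^ 2 + c * x * (t * x + z) + d * x + e * (t * x + z) + f) +
      σ (a * x ^ 2 + b * (t * x + z) ^ 2 + c * x * (t * x + z) + d * x + e * (t * x + z) + f) =
      ((c * z + t * σ z + d + e * t) * x + σ ((c * z + t * σ z + d + e * t) * x)) +
      (z * σ z + (b * z ^ 2 + e * z + f) + σ (b * z ^ 2 + e * z + f)) := by
    intro x z
    rw [ha]
    simp only [map_add, map_mul, map_pow, hσ]
    linear_combination (x * σ x) * ht1 + (x * σ x + b * t ^ 2 * x ^ 2 + c * t * x ^ 2 +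
      b * t * x * z + σ b * σ t ^ 2 * σ x ^ 2 + σ c * σ t * σ x ^ 2 + σ b * σ t * σ x * σ z) * h2
  have hnsum : n = ∑ z : F, #{x : F | (c * z + t * σ z + d + e * t) * x +
      σ ((c * z + t * σ z + d + e * t) * x) =
        z * σ z + (b * z ^ 2 + e * z + f) + σ (b * z ^ 2 + e * z + f)} := by
    rw [hn, card_eq_sum_card_fiberwise (t := univ) (f := fun p : F × F => p.2 - t * p.1)
      (by simp)]
    apply sum_congr rfl
    intro z _
    symm
    apply card_bij (fun x _ => (x, t * x + z))
    · intro x hx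
      simp only [mem_filter, mem_univ, true_and] at hx ⊢
      refine ⟨?_, by ring⟩
      rw [key, hx]
      linear_combination (z * σ z + (b * z ^ 2 + e * z + f) + σ (b * z ^ 2 + e * z + f)) * h2
    · intro w _ w' _ hww
      simp only [Prod.mk.injEq] at hww
      exact hww.1
    · rintro ⟨x, y⟩ hp
      simp only [mem_filter, mem_univ, true_and] at hp
      obtain ⟨hp, rfl⟩ := hp
      have hy : t * x + (y - t * x) = y := by ring
      refine ⟨x, ?_, ?_⟩
      · simp only [mem_filter, mem_univ, true_and]
        have h3 := key x (y - t * x)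
        rw [hy, hp] at h3
        generalize y - t * x = z at h3 ⊢
        linear_combination -h3 - (z * σ z + (b * z ^ 2 + e * z + f) +
          σ (b * z ^ 2 + e * z + f)) * h2
      · rw [hy]
  rw [hnsum]
  push_cast
  have : ∀ z ∈ (univ : Finset F), (#{x : F | (c * z + t * σ z + d + e * t) * x +
      σ ((c * z + t * σ z + d + e * t) * x) =
        z * σ z + (b * z ^ 2 + e * z + f) + σ (b * z ^ 2 + e * z + f)} : ℤ) =
      q - (if c * z + t * σ z + d + e * t = 0 then (q : ℤ) else 0) +
      (if c * z + t * σ z + d + e * t = 0 ∧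
        z * σ z + (b * z ^ 2 + e * z + f) + σ (b * z ^ 2 + e * z + f) = 0
        then (q : ℤ) ^ 2 else 0) := by
    intro z _
    by_cases hz : c * z + t * σ z + d + e * t = 0
    · rw [hz]
      generalize z * σ z + (b * z ^ 2 + e * z + f) + σ (b * z ^ 2 + e * z + f) = G
      by_cases hG : G = 0
      · rw [hG]; simp [hF]
      · simp [hG, Ne.symm hG]
    · rw [if_neg hz, if_neg (fun h => hz h.1), H_fib q σ hfib _ hz]
      · simp
      · simp only [map_add, map_mul, hσ]; ring
  rw [sum_congr rfl this, sum_add_distrib, sum_sub_distrib, ← sum_filter, ← sum_filter]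
  simp [hF]
  ring

/-- Number of zeros in `K` of a polynomial of degree at most two. -/
lemma H_quad {F : Type} [Field F] [DecidableEq F] (K : Finset F) (A B C : F) (hA : A ≠ 0) :
    #{l ∈ K | A * l ^ 2 + B * l + C = 0} ≤ 2 := by
  by_contra hcon
  push Not at hcon
  obtain ⟨x, hx, y, hy, z, hz, hxy, hxz, hyz⟩ := two_lt_card.1 hcon
  simp only [mem_filter] at hx hy hz
  have h1 : (x - y) * (A * (x + y) + B) = 0 := by linear_combination hx.2 - hy.2
  have h3 : (x - z) * (A * (x + z) + B) = 0 := by linear_combination hx.2 - hz.2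
  have h4 := (mul_eq_zero.1 h1).resolve_left (sub_ne_zero.2 hxy)
  have h5 := (mul_eq_zero.1 h3).resolve_left (sub_ne_zero.2 hxz)
  have h6 : A * (y - z) = 0 := by linear_combination h4 - h5
  exact (mul_ne_zero hA (sub_ne_zero.2 hyz)) h6

lemma H_lin {F : Type} [Field F] [DecidableEq F] (K : Finset F) (B C : F) :
    #{l ∈ K | B * l + C = 0} ≤ 1 ∨ #{l ∈ K | B * l + C = 0} = #K := by
  by_cases hB : B = 0
  · by_cases hC : C = 0
    · right; simp [hB, hC]
    · left; simp [hB, hC]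
  · left
    rw [card_le_one]
    intro x hx y hy
    simp only [mem_filter] at hx hy
    exact mul_left_cancel₀ hB (by linear_combination hx.2 - hy.2)

/-- The case with at least one common direction at infinity. -/
lemma H_pos {F : Type} [Field F] [Fintype F] [DecidableEq F] (q : ℕ) (hq : 2 ≤ q)
    (hF : Fintype.card F = q ^ 2) (h2 : (2 : F) = 0) (σ : F →+* F) (hσ : ∀ x, σ (σ x) = x)
    (hK : #{x : F | σ x = x} = q)
    (hfib : ∀ k, σ k = k → #{x : F | x + σ x = k} = q)
    (a b c d e f t : F) (hc0 : c ≠ 0)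
    (ht : a + b * t ^ 2 + c * t = 0) (ht1 : t * σ t = 1) (n m : ℕ)
    (hm : m = #{t : F | a + b * t ^ 2 + c * t = 0 ∧ t * σ t = 1})
    (hn : n = #{p : F × F | p.1 * σ p.1 + p.2 * σ p.2 +
      (a * p.1 ^ 2 + b * p.2 ^ 2 + c * p.1 * p.2 + d * p.1 + e * p.2 + f) +
      σ (a * p.1 ^ 2 + b * p.2 ^ 2 + c * p.1 * p.2 + d * p.1 + e * p.2 + f) = 0}) :
    (m = 1 ∧ ((n : ℤ) = q ^ 3 - q ∨ (n : ℤ) = q ^ 3 + q ^ 2 - q ∨ (n : ℤ) = q ^ 3 ∨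
      (n : ℤ) = q ^ 3 - q ^ 2 ∨ (n : ℤ) = q ^ 3 + q ^ 2)) ∨
    (m = 2 ∧ ((n : ℤ) = q ^ 3 - q ∨ (n : ℤ) = q ^ 3 + q ^ 2 - q ∨ (n : ℤ) = q ^ 3 ∨
      (n : ℤ) = q ^ 3 - q ^ 2 ∨ (n : ℤ) = 2 * q ^ 3 - q ^ 2)) := by
  have hnn := H_dir q hF h2 σ hσ hfib a b c d e f t ht ht1 n hn
  have ht0 : t ≠ 0 := by rintro rfl; simp at ht1
  have htm : t ∈ ({t : F | a + b * t ^ 2 + c * t = 0 ∧ t * σ t = 1} : Finset F) := by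
    simp [ht, ht1]
  -- any further direction
  have hother : ∀ t', a + b * t' ^ 2 + c * t' = 0 → t' ≠ t → b * (t + t') = c := by
    intro t' ht' hne
    have h1 : (t' - t) * (b * (t + t') + c) = 0 := by linear_combination ht' - ht
    have h3 := (mul_eq_zero.1 h1).resolve_left (sub_ne_zero.2 hne)
    linear_combination h3 - c * h2
  have hm1 : 1 ≤ m := by rw [hm]; exact card_pos.2 ⟨t, htm⟩
  have hm2 : m ≤ 2 := by
    have hsub : ({t : F | a + b * t ^ 2 + c * t = 0 ∧ t * σ t = 1} : Finset F) ⊆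
        {t, t + c / b} := by
      intro t' ht'
      simp only [mem_filter, mem_univ, true_and] at ht'
      rw [mem_insert, mem_singleton]
      by_cases hne : t' = t
      · exact Or.inl hne
      · right
        have h1 := hother t' ht'.1 hne
        have hb : b ≠ 0 := by rintro rfl; apply hc0; rw [← h1]; ring
        rw [← h1]
        field_simp
        linear_combination -t * h2
    rw [hm]
    exact (card_le_card hsub).trans card_le_two
  by_cases hcc : c * σ c = 1
  · by_cases hA : ∃ z0, c * z0 + t * σ z0 + d + e * t = 0
    · obtain ⟨z0, hz0⟩ := hA
      obtain ⟨ζ, hζ0, hζ⟩ : ∃ ζ, ζ ≠ 0 ∧ c * ζ = t * σ ζ := by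
        have hgen : ∀ v, c * (v + t * σ c * σ v) = t * σ (v + t * σ c * σ v) := by
          intro v
          simp only [map_add, map_mul, hσ]
          linear_combination t * σ v * hcc - c * v * ht1
        by_cases h1 : (1 : F) + t * σ c = 0
        · obtain ⟨v, hv⟩ := card_pos.1 (by rw [hfib 1 (map_one σ)]; omega :
            0 < #{x : F | x + σ x = 1})
          simp only [mem_filter, mem_univ, true_and] at hv
          refine ⟨_, ?_, hgen v⟩
          have : v + t * σ c * σ v = 1 := by linear_combination hv + σ v * h1 - σ v * h2
          rw [this]; exact one_ne_zero
        · refine ⟨_, ?_, hgen 1⟩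
          simpa using h1
      have hsζ : σ ζ = c * σ t * ζ := by linear_combination -σ t * hζ - σ ζ * ht1
      obtain ⟨A, hAdef⟩ : ∃ A, A = ζ * σ ζ + b * ζ ^ 2 + σ (b * ζ ^ 2) := ⟨_, rfl⟩
      obtain ⟨B, hBdef⟩ : ∃ B, B = (σ z0 * ζ + e * ζ) + σ (σ z0 * ζ + e * ζ) := ⟨_, rfl⟩
      obtain ⟨C, hCdef⟩ : ∃ C, C = z0 * σ z0 + (b * z0 ^ 2 + e * z0 + f) +
        σ (b * z0 ^ 2 + e * z0 + f) := ⟨_, rfl⟩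
      have hsolve : ∀ z, c * z + t * σ z + d + e * t = 0 → ∃ l, σ l = l ∧ z = z0 + l * ζ := by
        intro z hz
        refine ⟨(z - z0) / ζ, ?_, by field_simp; ring⟩
        have hsζ0 : σ ζ ≠ 0 := by simpa using hζ0
        rw [map_div₀, map_sub, div_eq_div_iff hsζ0 hζ0]
        have h3 : c * (z - z0) = t * σ z - t * σ z0 := by
          linear_combination hz - hz0 + (t * σ z0 - t * σ z) * h2
        apply mul_left_cancel₀ (mul_ne_zero hc0 ht0)
        linear_combination (-t * σ ζ) * h3 + (t * (σ z - σ z0)) * hζ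
      have hback : ∀ l, σ l = l → c * (z0 + l * ζ) + t * σ (z0 + l * ζ) + d + e * t = 0 := by
        intro l hl
        simp only [map_add, map_mul, hl]
        linear_combination hz0 + l * hζ + l * t * σ ζ * h2
      have hcardA : #{z : F | c * z + t * σ z + d + e * t = 0} = q := by
        rw [← hK]
        symm
        apply card_bij (fun l _ => z0 + l * ζ)
        · intro l hl
          simp only [mem_filter, mem_univ, true_and] at hl ⊢
          exact hback l hl
        · intro l _ l' _ hll
          simpa [hζ0] using hll
        · intro z hz
          simp only [mem_filter, mem_univ, true_and] at hz
          obtain ⟨l, hl, rfl⟩ := hsolve z hz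
          exact ⟨l, by simpa using hl, rfl⟩
      have hGl : ∀ l, σ l = l → (z0 + l * ζ) * σ (z0 + l * ζ) +
          (b * (z0 + l * ζ) ^ 2 + e * (z0 + l * ζ) + f) +
          σ (b * (z0 + l * ζ) ^ 2 + e * (z0 + l * ζ) + f) = A * l ^ 2 + B * l + C := by
        intro l hl
        rw [hAdef, hBdef, hCdef]
        simp only [map_add, map_mul, map_pow, hl, hσ]
        linear_combination (b * z0 * l * ζ + σ b * σ z0 * l * σ ζ) * h2
      have hj : #{z : F | c * z + t * σ z + d + e * t = 0 ∧
          z * σ z + (b * z ^ 2 + e * z + f) + σ (b * z ^ 2 + e * z + f) = 0} =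
          #{l ∈ ({x : F | σ x = x} : Finset F) | A * l ^ 2 + B * l + C = 0} := by
        symm
        apply card_bij (fun l _ => z0 + l * ζ)
        · intro l hl
          simp only [mem_filter, mem_univ, true_and] at hl ⊢
          refine ⟨hback l hl.1, ?_⟩
          rw [hGl l hl.1, hl.2]
        · intro l _ l' _ hll
          simpa [hζ0] using hll
        · intro z hz
          simp only [mem_filter, mem_univ, true_and] at hz
          obtain ⟨l, hl, rfl⟩ := hsolve z hz.1
          refine ⟨l, ?_, rfl⟩
          simp only [mem_filter, mem_univ, true_and]
          refine ⟨hl, ?_⟩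
          rw [← hGl l hl, hz.2]
      rw [hcardA, hj] at hnn
      have hA2 : A = ζ ^ 2 * (c * σ t) * (1 + b * t * σ c + σ b * c * σ t) := by
        rw [hAdef]
        simp only [map_mul, map_pow]
        rw [hsζ]
        linear_combination (-b * ζ ^ 2 * (t * σ t)) * hcc - b * ζ ^ 2 * ht1
      have hst0 : σ t ≠ 0 := by simpa using ht0
      by_cases hA0 : A = 0
      · have hE : 1 + b * t * σ c + σ b * c * σ t = 0 := by
          rw [hA0] at hA2
          exact (mul_eq_zero.1 hA2.symm).resolve_left
            (mul_ne_zero (pow_ne_zero _ hζ0) (mul_ne_zero hc0 hst0))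
        have hb : b ≠ 0 := by rintro rfl; simp at hE
        have hsb : σ b ≠ 0 := by simpa using hb
        right
        refine ⟨?_, ?_⟩
        · have hsub : ({t, t + c / b} : Finset F) ⊆
              ({t : F | a + b * t ^ 2 + c * t = 0 ∧ t * σ t = 1} : Finset F) := by
            intro t' ht'
            rw [mem_insert, mem_singleton] at ht'
            rcases ht' with rfl | rfl
            · exact htm
            · simp only [mem_filter, mem_univ, true_and]
              constructor
              · have : b * (c / b) = c := by field_simp
                linear_combination ht + (2 * t + c / b) * this + (c * t + (c / b) * c) * h2
              · rw [map_add, map_div₀]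
                field_simp
                linear_combination hE + b * σ b * ht1 + hcc
          have hcard2 : #({t, t + c / b} : Finset F) = 2 := by
            rw [card_pair]
            simp [hc0, hb]
          have := card_le_card hsub
          rw [hcard2, ← hm] at this
          omega
        · simp only [hA0, zero_mul, zero_add] at hnn
          rcases H_lin ({x : F | σ x = x} : Finset F) B C with hl | hl
          · interval_cases hh : #{l ∈ ({x : F | σ x = x} : Finset F) | B * l + C = 0}
            · right; right; right; left; rw [hnn]; push_cast; ring
            · right; right; left; rw [hnn]; push_cast; ring
          · right; right; right; right
            rw [hl, hK] at hnn
            rw [hnn]; ring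
      · left
        refine ⟨?_, ?_⟩
        · by_contra hmne
          have hlt : 1 < #{t : F | a + b * t ^ 2 + c * t = 0 ∧ t * σ t = 1} := by
            rw [← hm]; omega
          obtain ⟨t', ht', hne⟩ := exists_mem_ne hlt t
          simp only [mem_filter, mem_univ, true_and] at ht'
          have h1 := hother t' ht'.1 hne
          have hb : b ≠ 0 := by rintro rfl; apply hc0; rw [← h1]; ring
          have h3 : σ b * (σ t + σ t') = σ c := by rw [← map_add, ← map_mul, h1]
          apply hA0
          rw [hA2]
          apply mul_eq_zero_of_right
          have h4 : b * t' = c - b * t := by linear_combination h1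
          have h5 : σ b * σ t' = σ c - σ b * σ t := by linear_combination h3
          have h6 : b * σ b = (c - b * t) * (σ c - σ b * σ t) := by
            rw [← h4, ← h5]; linear_combination (-b * σ b) * ht'.2
          linear_combination -h6 - hcc - b * σ b * ht1 + (b * t * σ c + σ b * c * σ t) * h2
        · have := H_quad ({x : F | σ x = x} : Finset F) A B C hA0
          interval_cases hh : #{l ∈ ({x : F | σ x = x} : Finset F) | A * l ^ 2 + B * l + C = 0}
          · right; right; right; left; rw [hnn]; push_cast; ring
          · right; right; left; rw [hnn]; push_cast; ring
          · right; right; right; right; rw [hnn]; push_cast; ring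
    · push Not at hA
      have hn3 : (n : ℤ) = q ^ 3 := by
        rw [hnn, filter_false_of_mem (fun z _ => hA z),
          filter_false_of_mem (fun z _ hz => hA z hz.1)]
        simp
      have : m = 1 ∨ m = 2 := by omega
      tauto
  · have hAcard : #{z : F | c * z + t * σ z + d + e * t = 0} = 1 := by
      let g : F →+ F :=
        { toFun := fun z => c * z + t * σ z
          map_zero' := by simp
          map_add' := by intro u v; simp; ring }
      have hgi : Function.Injective g := by
        rw [injective_iff_map_eq_zero]
        intro z hz
        have hz' : c * z + t * σ z = 0 := hz
        have hz2 : σ c * σ z + σ t * z = 0 := by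
          have := congrArg σ hz'
          simpa [hσ] using this
        have h3 : (c * σ c - 1) * z = 0 := by
          linear_combination σ c * hz' - t * hz2 + z * ht1
        exact (mul_eq_zero.1 h3).resolve_left (sub_ne_zero.2 hcc)
      rw [card_eq_one]
      obtain ⟨z0, hz0⟩ := Finite.injective_iff_surjective.1 hgi (d + e * t)
      refine ⟨z0, ?_⟩
      ext z
      simp only [mem_filter, mem_univ, true_and, mem_singleton]
      rw [← hgi.eq_iff (a := z), hz0]
      change _ ↔ c * z + t * σ z = _
      constructor
      · intro h; linear_combination h - (d + e * t) * h2
      · intro h; linear_combination h + (d + e * t) * h2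
    have hj : #{z : F | c * z + t * σ z + d + e * t = 0 ∧
        z * σ z + (b * z ^ 2 + e * z + f) + σ (b * z ^ 2 + e * z + f) = 0} ≤ 1 := by
      rw [← hAcard]
      apply card_le_card
      intro z hz
      simp only [mem_filter, mem_univ, true_and] at hz ⊢
      exact hz.1
    rw [hAcard] at hnn
    have hm12 : m = 1 ∨ m = 2 := by omega
    have hn2 : (n : ℤ) = q ^ 3 - q ∨ (n : ℤ) = q ^ 3 + q ^ 2 - q := by
      interval_cases hh : #{z : F | c * z + t * σ z + d + e * t = 0 ∧
        z * σ z + (b * z ^ 2 + e * z + f) + σ (b * z ^ 2 + e * z + f) = 0}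
      · left; rw [hnn]; push_cast; ring
      · right; rw [hnn]; push_cast; ring
    tauto

/-- Counting the projective points. -/
lemma H_proj {F : Type} [Field F] [Fintype F] [DecidableEq F] (q : ℕ) (hq : 2 ≤ q)
    (hF : Fintype.card F = q ^ 2) (h2 : (2 : F) = 0) (σ : F →+* F) 
    (hp : ∀ x, σ x = x ^ q) (a b c d e f : F) (S : Set (Projectivization F (Fin 4 → F)))
    (hS : S = {p : Projectivization F (Fin 4 → F) |
        (p.rep 1) ^ (q + 1) + (p.rep 2) ^ (q + 1)
            + (p.rep 3) ^ q * p.rep 0 + p.rep 3 * (p.rep 0) ^ q = 0 ∧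
        a * (p.rep 1) ^ 2 + b * (p.rep 2) ^ 2 + c * p.rep 1 * p.rep 2
            + d * p.rep 1 * p.rep 0 + e * p.rep 2 * p.rep 0
            + f * (p.rep 0) ^ 2 + p.rep 0 * p.rep 3 = 0}) :
    S.ncard = #{p : F × F | p.1 * σ p.1 + p.2 * σ p.2 +
      (a * p.1 ^ 2 + b * p.2 ^ 2 + c * p.1 * p.2 + d * p.1 + e * p.2 + f) +
      σ (a * p.1 ^ 2 + b * p.2 ^ 2 + c * p.1 * p.2 + d * p.1 + e * p.2 + f) = 0} +
      (#{t : F | a + b * t ^ 2 + c * t = 0 ∧ t * σ t = 1} * q ^ 2 + 1) := by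
  have hq0 : q ≠ 0 := by omega
  set P : (Fin 4 → F) → Prop := fun v => v 1 ^ (q + 1) + v 2 ^ (q + 1)
            + v 3 ^ q * v 0 + v 3 * v 0 ^ q = 0 ∧
        a * v 1 ^ 2 + b * v 2 ^ 2 + c * v 1 * v 2
            + d * v 1 * v 0 + e * v 2 * v 0 + f * v 0 ^ 2 + v 0 * v 3 = 0 with hP
  have hhom : ∀ (u : F) (v : Fin 4 → F), u ≠ 0 → (P (u • v) ↔ P v) := by
    intro u v hu
    have e1 : (u • v) 1 ^ (q + 1) + (u • v) 2 ^ (q + 1)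
            + (u • v) 3 ^ q * (u • v) 0 + (u • v) 3 * (u • v) 0 ^ q =
        u ^ (q + 1) * (v 1 ^ (q + 1) + v 2 ^ (q + 1) + v 3 ^ q * v 0 + v 3 * v 0 ^ q) := by
      simp only [Pi.smul_apply, smul_eq_mul, mul_pow]; ring
    have e2 : a * (u • v) 1 ^ 2 + b * (u • v) 2 ^ 2 + c * (u • v) 1 * (u • v) 2
            + d * (u • v) 1 * (u • v) 0 + e * (u • v) 2 * (u • v) 0 + f * (u • v) 0 ^ 2
            + (u • v) 0 * (u • v) 3 = u ^ 2 * (a * v 1 ^ 2 + b * v 2 ^ 2 + c * v 1 * v 2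
            + d * v 1 * v 0 + e * v 2 * v 0 + f * v 0 ^ 2 + v 0 * v 3) := by
      simp only [Pi.smul_apply, smul_eq_mul, mul_pow]; ring
    simp only [hP]
    rw [e1, e2, mul_eq_zero, mul_eq_zero, or_iff_right (pow_ne_zero _ hu),
      or_iff_right (pow_ne_zero _ hu)]
  have hmem : ∀ (v : Fin 4 → F) (hv : v ≠ 0), Projectivization.mk F v hv ∈ S ↔ P v := by
    intro v hv
    obtain ⟨u, hu⟩ := Projectivization.exists_smul_eq_mk_rep F v hv
    rw [hS]
    change P (Projectivization.mk F v hv).rep ↔ _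
    rw [← hu]
    exact hhom u v u.ne_zero
  let g : F → F → F := fun x y => a * x ^ 2 + b * y ^ 2 + c * x * y + d * x + e * y + f
  have hg : ∀ x y, g x y = a * x ^ 2 + b * y ^ 2 + c * x * y + d * x + e * y + f :=
    fun _ _ => rfl
  let vec : (F × F) ⊕ ((F × F) ⊕ Unit) → (Fin 4 → F) := fun i => match i with
    | Sum.inl p => ![1, p.1, p.2, g p.1 p.2]
    | Sum.inr (Sum.inl p) => ![0, 1, p.1, p.2]
    | Sum.inr (Sum.inr _) => ![0, 0, 0, 1]
  have hvec : ∀ i, vec i ≠ 0 := by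
    rintro (p | p | p) h0
    · simpa [vec] using congrFun h0 0
    · simpa [vec] using congrFun h0 1
    · simpa [vec] using congrFun h0 3
  let φ : (F × F) ⊕ ((F × F) ⊕ Unit) → Projectivization F (Fin 4 → F) :=
    fun i => Projectivization.mk F (vec i) (hvec i)
  have hφ : Function.Injective φ := by
    intro i j hij
    obtain ⟨u, hu⟩ := (Projectivization.mk_eq_mk_iff' F _ _ (hvec i) (hvec j)).1 hij
    have h0 := congrFun hu 0
    have h1 := congrFun hu 1
    have h3 := congrFun hu 2
    have h4 := congrFun hu 3
    rcases i with ⟨x, y⟩ | ⟨x, y⟩ | i <;> rcases j with ⟨x', y'⟩ | ⟨x', y'⟩ | j <;>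
      simp [vec] at h0 h1 h3 h4 ⊢ <;> grind
  let T : Finset ((F × F) ⊕ ((F × F) ⊕ Unit)) :=
    ({p : F × F | p.1 * σ p.1 + p.2 * σ p.2 + g p.1 p.2 + σ (g p.1 p.2) = 0} :
      Finset (F × F)).disjSum
      ((({t : F | a + b * t ^ 2 + c * t = 0 ∧ t * σ t = 1} : Finset F) ×ˢ
        (univ : Finset F)).disjSum {()})
  have hT : ∀ i, i ∈ T ↔ P (vec i) := by
    rintro (⟨x, y⟩ | ⟨t, z⟩ | i)
    · simp only [T, inl_mem_disjSum, mem_filter, mem_univ, true_and, hP, vec]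
      simp only [hp]
      simp
      have e2 : a * x ^ 2 + b * y ^ 2 + c * x * y + d * x + e * y + f + g x y = 0 := by
        rw [hg]; linear_combination (a * x ^ 2 + b * y ^ 2 + c * x * y + d * x + e * y + f) * h2
      constructor
      · intro h; exact ⟨by linear_combination h, e2⟩
      · rintro ⟨h, -⟩; linear_combination h
    · simp only [T, inl_mem_disjSum, inr_mem_disjSum, mem_product, mem_filter, mem_univ, true_and,
        and_true, hP, vec]
      simp only [hp]
      simp [hq0]
      constructor
      · rintro ⟨h, h'⟩; exact ⟨by linear_combination h' + h2, h⟩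
      · rintro ⟨h, h'⟩; exact ⟨h', by linear_combination h - h2⟩
    · simp [T, hP, vec, hq0]
  have hST : S = φ '' (T : Set _) := by
    ext p
    constructor
    · intro hpS
      have hPv : P p.rep := by rw [← hmem p.rep p.rep_nonzero, p.mk_rep]; exact hpS
      have fin : ∀ i (u : F), u ≠ 0 → p.rep = u • vec i → p ∈ φ '' (T : Set _) := by
        intro i u hu hi
        refine ⟨i, ?_, ?_⟩
        · rw [mem_coe, hT, ← hhom u _ hu, ← hi]; exact hPv
        · rw [← p.mk_rep]
          exact ((Projectivization.mk_eq_mk_iff' F _ _ p.rep_nonzero (hvec i)).2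
            ⟨u, hi.symm⟩).symm
      have hne := p.rep_nonzero
      generalize p.rep = v at hPv fin hne
      obtain ⟨hP1, hP2⟩ := hPv
      by_cases h0 : v 0 = 0
      · by_cases h1 : v 1 = 0
        · rw [h0, h1] at hP1
          have hv2 : v 2 = 0 := by simpa [hq0] using hP1
          have hv3 : v 3 ≠ 0 := by
            intro hv3
            apply hne
            ext i
            fin_cases i <;> simp [h0, h1, hv2, hv3]
          refine fin (Sum.inr (Sum.inr ())) (v 3) hv3 ?_
          ext i
          fin_cases i <;> simp [vec, h0, h1, hv2]
        · refine fin (Sum.inr (Sum.inl (v 2 / v 1, v 3 / v 1))) (v 1) h1 ?_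
          ext i
          fin_cases i <;> simp [vec, h0] <;> field_simp
      · refine fin (Sum.inl (v 1 / v 0, v 2 / v 0)) (v 0) h0 ?_
        ext i
        fin_cases i
        · simp [vec]
        · simp [vec]; field_simp
        · simp [vec]; field_simp
        · simp [vec, hg]
          field_simp
          linear_combination hP2 - (a * v 1 ^ 2 + b * v 2 ^ 2 + c * v 1 * v 2
            + d * v 1 * v 0 + e * v 2 * v 0 + f * v 0 ^ 2) * h2
    · rintro ⟨i, hi, rfl⟩
      rw [hmem]
      exact (hT i).1 hi
  rw [hST, Set.ncard_image_of_injective _ hφ, Set.ncard_coe_finset, card_disjSum, card_disjSum,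
    card_product, card_univ, hF, card_singleton]


/-- Theorem 1.1 of the paper (hyperbolic case): with `c ≠ 0` and `Tr(ab/c²) = 0`,
the quadric is hyperbolic and `|ℋ ∩ 𝒬|` lies in the stated set. -/
theorem stmt_2
    (h q : ℕ) (hh : 1 ≤ h) (hq : q = 2 ^ h)
    (F : Type) [Field F] [Fintype F] (hF : Fintype.card F = q ^ 2)
    (a b c d e f : F) (hc : c ≠ 0)
    (htr : ∑ i ∈ Finset.range (2 * h), (a * b / c ^ 2) ^ 2 ^ i = 0) :
    Set.ncard {p : Projectivization F (Fin 4 → F) |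
        (p.rep 1) ^ (q + 1) + (p.rep 2) ^ (q + 1)
            + (p.rep 3) ^ q * p.rep 0 + p.rep 3 * (p.rep 0) ^ q = 0 ∧
        a * (p.rep 1) ^ 2 + b * (p.rep 2) ^ 2 + c * p.rep 1 * p.rep 2
            + d * p.rep 1 * p.rep 0 + e * p.rep 2 * p.rep 0
            + f * (p.rep 0) ^ 2 + p.rep 0 * p.rep 3 = 0} ∈
      ({q ^ 2 + 1, q ^ 3 - q ^ 2 + 1, q ^ 3 - q ^ 2 + q + 1, q ^ 3 - q + 1,
        q ^ 3 + 1, q ^ 3 + q + 1, q ^ 3 + q ^ 2 - q + 1, q ^ 3 + q ^ 2 + 1,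
        q ^ 3 + 2 * q ^ 2 - q + 1, q ^ 3 + 2 * q ^ 2 + 1,
        q ^ 3 + 3 * q ^ 2 - q + 1, 2 * q ^ 3 + q ^ 2 + 1} : Set ℕ) := by

  classical
  have hq2 : 2 ≤ q := by
    rw [hq]
    calc 2 = 2 ^ 1 := rfl
      _ ≤ 2 ^ h := Nat.pow_le_pow_right (by norm_num) hh
  have h2 : (2 : F) = 0 := by
    have h1 : ((Fintype.card F : ℕ) : F) = 0 := Nat.cast_card_eq_zero F
    rw [hF, hq] at h1
    push_cast at h1
    exact pow_eq_zero_iff (by omega) |>.1 (pow_eq_zero_iff (by norm_num) |>.1 h1)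
  have : CharP F 2 := CharTwo.of_one_ne_zero_of_two_eq_zero one_ne_zero h2
  obtain ⟨σ, hp⟩ : ∃ σ : F →+* F, ∀ x, σ x = x ^ q :=
    ⟨iterateFrobenius F 2 h, fun x => by rw [iterateFrobenius_def, hq]⟩
  have hσ : ∀ x, σ (σ x) = x := by
    intro x
    rw [hp, hp, ← pow_mul, ← sq, ← hF, FiniteField.pow_card]
  obtain ⟨hK, hfib⟩ := H_fix_fib q hq2 hF h2 σ hσ hp
  rw [H_proj q hq2 hF h2 σ hp a b c d e f _ rfl]
  obtain ⟨n, hn⟩ : ∃ n, n = #{p : F × F | p.1 * σ p.1 + p.2 * σ p.2 +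
      (a * p.1 ^ 2 + b * p.2 ^ 2 + c * p.1 * p.2 + d * p.1 + e * p.2 + f) +
      σ (a * p.1 ^ 2 + b * p.2 ^ 2 + c * p.1 * p.2 + d * p.1 + e * p.2 + f) = 0} := ⟨_, rfl⟩
  obtain ⟨m, hm⟩ : ∃ m, m = #{t : F | a + b * t ^ 2 + c * t = 0 ∧ t * σ t = 1} := ⟨_, rfl⟩
  rw [← hn, ← hm]
  have hle1 : 2 * q ≤ q ^ 2 := by nlinarith
  have hle2 : 2 * q ^ 2 ≤ q ^ 3 := by nlinarith [sq_nonneg q]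
  have hfin : (m = 0 ∧ ((n : ℤ) = q ^ 3 + q ^ 2 - q ∨ (n : ℤ) = q ^ 3 - q ∨
        (n : ℤ) = q ^ 3 - q ^ 2 + q ∨ (n : ℤ) = q ^ 3 + q ∨
        (n : ℤ) = q ^ 3 + q ^ 2 ∨ (n : ℤ) = q ^ 3 - q ^ 2 ∨ (n : ℤ) = q ^ 3 ∨
        (n : ℤ) = q ^ 2)) ∨
      (m = 1 ∧ ((n : ℤ) = q ^ 3 - q ∨ (n : ℤ) = q ^ 3 + q ^ 2 - q ∨ (n : ℤ) = q ^ 3 ∨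
      (n : ℤ) = q ^ 3 - q ^ 2 ∨ (n : ℤ) = q ^ 3 + q ^ 2)) ∨
    (m = 2 ∧ ((n : ℤ) = q ^ 3 - q ∨ (n : ℤ) = q ^ 3 + q ^ 2 - q ∨ (n : ℤ) = q ^ 3 ∨
      (n : ℤ) = q ^ 3 - q ^ 2 ∨ (n : ℤ) = 2 * q ^ 3 - q ^ 2)) := by
    by_cases hex : ∃ t, a + b * t ^ 2 + c * t = 0 ∧ t * σ t = 1
    · obtain ⟨t, ht, ht1⟩ := hex
      right
      exact H_pos q hq2 hF h2 σ hσ hK hfib a b c d e f t hc ht ht1 n m hm hn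
    · left
      push Not at hex
      refine ⟨?_, ?_⟩
      · rw [hm, card_eq_zero, filter_false_of_mem]
        intro t _ htt
        exact hex t htt.1 htt.2
      · by_cases hcc : c * σ c = 1
        · have := H_deg h q hq hh hq2 hF h2 σ hσ hp hK hfib a b c d e f hcc hex n hn
          tauto
        · have := H_dim4 q hq2 hF h2 σ hσ hK hfib a b c d e f hcc n hn
          tauto
  clear hn hm htr hF
  simp only [Set.mem_insert_iff, Set.mem_singleton_iff]
  zify at hle1 hle2
  have c2 : ((q ^ 2 : ℕ) : ℤ) = (q : ℤ) ^ 2 := by push_cast; rfl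
  have c3 : ((q ^ 3 : ℕ) : ℤ) = (q : ℤ) ^ 3 := by push_cast; rfl
  rw [← c2] at hfin hle1 hle2
  rw [← c3] at hfin hle2
  clear c2 c3
  generalize q ^ 2 = u at *
  generalize q ^ 3 = w at *
  clear hp hσ hK hfib
  rcases hfin with ⟨rfl, hx⟩ | ⟨rfl, hx⟩ | ⟨rfl, hx⟩
  · rcases hx with hx | hx | hx | hx | hx | hx | hx | hx <;>
      (repeat (first | (left; omega) | right)) <;> omega
  · rcases hx with hx | hx | hx | hx | hx <;>
      (repeat (first | (left; omega) | right)) <;> omega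
  · rcases hx with hx | hx | hx | hx | hx <;>
      (repeat (first | (left; omega) | right)) <;> omega
end

section
/- Let q = 2^h (h ≥ 1) and F = GF(q²). Let a,b,c,d,e,f ∈ F with c ≠ 0 and Tr(ab/c²) = 1 (elliptic case). Then the number of triples (x,y,z) ∈ F³ satisfying both z^q + z = x^{q+1} + y^{q+1} and z = ax² + by² + cxy + dx + ey + f belongs to the set {q³ − q², q³ − q² + q, q³ − q, q³, q³ + q, q³ + q² − q, q³ + q²}. -/
section
open Finset

/-- Data: a field of characteristic two with an involution and a sign character. -/
structure HQ (F : Type) [Field F] [Fintype F] (q : ℕ) where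
  two : (2 : F) = 0
  q0 : 0 < q
  card : Fintype.card F = q ^ 2
  σ : F →+* F
  inv : ∀ x, σ (σ x) = x
  K : Finset F
  memK : ∀ t, t ∈ K ↔ σ t = t
  cardK : K.card = q
  ω : F
  hω : ω + σ ω = 1
  ψ : F → ℤ
  padd : ∀ x y, ψ (x + y) = ψ x * ψ y
  conj : ∀ x, ψ (σ x) = ψ x
  psq : ∀ x, ψ (x ^ 2) = ψ x
  zero : ψ 0 = 1
  s0 : F
  hs0 : ψ s0 = -1

namespace HQ
variable {F : Type} [Field F] [Fintype F] {q : ℕ} (H : HQ F q)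

lemma self {F : Type} [Field F] [Fintype F] {q : ℕ} (H : HQ F q) (x : F) : x + x = 0 := by
  have h2 := H.two
  linear_combination x * h2

lemma psiT (x : F) : H.ψ (H.ω * (x + H.σ x)) = H.ψ x := by
  have : H.ω * (x + H.σ x) = x + (H.σ H.ω * x + H.σ (H.σ H.ω * x)) := by
    simp only [map_mul, H.inv]
    linear_combination x * H.hω - (H.σ H.ω * x) * H.two
  rw [this, H.padd, H.padd, H.conj, ← H.padd, H.self, H.zero, mul_one]

lemma sumF [DecidableEq F] (α : F) : ∑ x, H.ψ (α * x) = if α = 0 then (q : ℤ) ^ 2 else 0 := by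
  split_ifs with h
  · simp [h, H.zero, H.card]
  · have : ∑ x, H.ψ (α * x) = ∑ x, H.ψ (α * (x + H.s0 / α)) :=
      (Equiv.sum_comp (Equiv.addRight (H.s0 / α)) (fun x => H.ψ (α * x))).symm
    have h2 : ∀ x, H.ψ (α * (x + H.s0 / α)) = - H.ψ (α * x) := by
      intro x
      rw [mul_add, mul_div_cancel₀ _ h, H.padd, H.hs0]; ring
    simp only [h2, sum_neg_distrib] at this
    linarith

lemma sumK [DecidableEq F] (κ : F) (hκ : H.σ κ = κ) :
    ∑ t ∈ H.K, H.ψ (H.ω * (t * κ)) = if κ = 0 then (q : ℤ) else 0 := by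
  split_ifs with h
  · simp [h, H.zero, H.cardK]
  · set u := (H.s0 + H.σ H.s0) / κ with hu
    have huK : H.σ u = u := by
      simp only [hu, map_div₀, map_add, H.inv, hκ]; rw [add_comm]
    have hψ : H.ψ (H.ω * (u * κ)) = -1 := by
      rw [hu, div_mul_cancel₀ _ h, H.psiT, H.hs0]
    have : ∑ t ∈ H.K, H.ψ (H.ω * (t * κ)) = ∑ t ∈ H.K, - H.ψ (H.ω * (t * κ)) := by
      refine Finset.sum_bij' (fun t _ => t + u) (fun t _ => t + u) ?_ ?_ ?_ ?_ ?_
      · intro t ht; rw [H.memK] at *; simp [ht, huK]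
      · intro t ht; rw [H.memK] at *; simp [ht, huK]
      · intro t ht; rw [add_assoc, H.self, add_zero]
      · intro t ht; rw [add_assoc, H.self, add_zero]
      · intro t ht
        rw [add_mul, mul_add, H.padd, hψ]; ring
    simp only [sum_neg_distrib] at this
    linarith

/-- The relative trace form defining the intersection. -/
def G (a b c d e f : F) (x y : F) : F :=
  (a * x ^ 2 + b * y ^ 2 + c * x * y + d * x + e * y + f)
  + H.σ (a * x ^ 2 + b * y ^ 2 + c * x * y + d * x + e * y + f) + x * H.σ x + y * H.σ y

lemma G_fix (a b c d e f x y : F) : H.σ (H.G a b c d e f x y) = H.G a b c d e f x y := by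
  simp only [G, map_add, map_mul, H.inv, map_pow]; ring

lemma G_polar (a b c d e f x y u v : F) :
    H.G a b c d e f x y + H.G a b c d e f (x + u) (y + v) =
      (H.G a b c d e f u v + H.G a b c d e f 0 0) +
      (((c * v + H.σ u) * x + (c * u + H.σ v) * y) +
        H.σ ((c * v + H.σ u) * x + (c * u + H.σ v) * y)) := by
  rw [← sub_eq_zero]
  simp only [G, map_add, map_mul, H.inv, map_pow, map_zero]
  have := H.two
  grind

/-- The character sum. -/
def S (a b c d e f t : F) : ℤ := ∑ x, ∑ y, H.ψ (H.ω * (t * H.G a b c d e f x y))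

lemma S_zero (a b c d e f : F) : H.S a b c d e f 0 = (q : ℤ) ^ 4 := by
  simp [S, H.zero, H.card]; ring

lemma S_sq (a b c d e f t : F) (ht : H.σ t = t) (ht0 : t ≠ 0) [DecidableEq F] :
    H.S a b c d e f t ^ 2 = (q : ℤ) ^ 4 * ∑ u, ∑ v,
      if c * v + H.σ u = 0 ∧ c * u + H.σ v = 0 then
        H.ψ (H.ω * (t * (H.G a b c d e f u v + H.G a b c d e f 0 0))) else 0 := by
  have e1 : H.S a b c d e f t ^ 2 = ∑ x, ∑ y, ∑ u, ∑ v,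
      H.ψ (H.ω * (t * H.G a b c d e f x y)) *
      H.ψ (H.ω * (t * H.G a b c d e f (x + u) (y + v))) := by
    have : ∀ x y, ∑ u, ∑ v, H.ψ (H.ω * (t * H.G a b c d e f (x + u) (y + v))) =
        H.S a b c d e f t := by
      intro x y
      rw [S, eq_comm, ← Equiv.sum_comp (Equiv.addLeft x)]
      refine sum_congr rfl fun u _ => ?_
      rw [← Equiv.sum_comp (Equiv.addLeft y)]
      rfl
    simp_rw [← mul_sum, this, ← sum_mul]
    rw [pow_two]; rfl
  have e2 : ∀ x y u v, H.ψ (H.ω * (t * H.G a b c d e f x y)) *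
      H.ψ (H.ω * (t * H.G a b c d e f (x + u) (y + v))) =
      H.ψ (H.ω * (t * (H.G a b c d e f u v + H.G a b c d e f 0 0))) *
      (H.ψ ((t * (c * v + H.σ u)) * x) * H.ψ ((t * (c * u + H.σ v)) * y)) := by
    intro x y u v
    rw [← H.padd, ← mul_add, ← mul_add, G_polar, mul_add, mul_add, H.padd]
    congr 1
    rw [← H.padd, ← H.psiT (t * (c * v + H.σ u) * x + t * (c * u + H.σ v) * y)]
    congr 2
    simp only [map_add, map_mul, H.inv, ht]
    ring
  rw [e1]
  simp_rw [e2]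
  have e3 : ∀ g : F → F → F → F → ℤ, ∑ x, ∑ y, ∑ u, ∑ v, g x y u v =
      ∑ u, ∑ v, ∑ x, ∑ y, g x y u v := by
    intro g
    calc _ = ∑ x, ∑ u, ∑ y, ∑ v, g x y u v := sum_congr rfl fun x _ => sum_comm
      _ = ∑ u, ∑ x, ∑ y, ∑ v, g x y u v := sum_comm
      _ = ∑ u, ∑ x, ∑ v, ∑ y, g x y u v :=
        sum_congr rfl fun u _ => sum_congr rfl fun x _ => sum_comm
      _ = _ := sum_congr rfl fun u _ => sum_comm
  rw [e3, mul_sum]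
  refine sum_congr rfl fun u _ => ?_
  rw [mul_sum]
  refine sum_congr rfl fun v _ => ?_
  simp_rw [← mul_sum, ← sum_mul, H.sumF, mul_eq_zero, ht0, false_or]
  clear e1 e2 e3
  by_cases h1 : c * v + H.σ u = 0
  · by_cases h2 : c * u + H.σ v = 0
    · rw [if_pos h1, if_pos h2, if_pos ⟨h1, h2⟩]; ring
    · rw [if_neg h2, if_neg (show ¬ (c * v + H.σ u = 0 ∧ c * u + H.σ v = 0) from fun h => h2 h.2)]; ring
  · rw [if_neg h1, if_neg (show ¬ (c * v + H.σ u = 0 ∧ c * u + H.σ v = 0) from fun h => h1 h.1)]; ring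

lemma count (a b c d e f : F) [DecidableEq F] :
    (q : ℤ) * ((univ : Finset (F × F)).filter
      (fun p => H.G a b c d e f p.1 p.2 = 0)).card =
    q ^ 4 + ∑ t ∈ H.K.erase 0, H.S a b c d e f t := by
  have h0 : (0 : F) ∈ H.K := by rw [H.memK, map_zero]
  rw [← H.S_zero a b c d e f, add_sum_erase _ _ h0]
  simp only [S]
  rw [sum_comm, card_filter, Fintype.sum_prod_type]
  push_cast
  rw [mul_sum]
  refine sum_congr rfl fun x _ => ?_
  rw [sum_comm, mul_sum]
  refine sum_congr rfl fun y _ => ?_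
  rw [H.sumK _ (H.G_fix ..)]
  split_ifs <;> simp

lemma rad_trivial (c : F) (hc : c * H.σ c ≠ 1) (u v : F) :
    (c * v + H.σ u = 0 ∧ c * u + H.σ v = 0) ↔ (u = 0 ∧ v = 0) := by
  constructor
  · rintro ⟨h1, h2⟩
    have h3 : H.σ c * H.σ u + v = 0 := by
      have := congrArg H.σ h2; simpa [H.inv] using this
    have h4 : (c * H.σ c - 1) * H.σ u = 0 := by
      linear_combination c * h3 - h1
    have h5 : u = 0 := by
      rcases mul_eq_zero.1 h4 with h | h
      · exact absurd (sub_eq_zero.1 h) hc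
      · simpa using h
    subst h5
    simpa using h3
  · rintro ⟨rfl, rfl⟩; simp

lemma case1 (a b c d e f : F) (hc : c * H.σ c ≠ 1) [DecidableEq F] :
    ∃ (s : ℤ), s ^ 2 = (q : ℤ) ^ 4 ∧ (∑ t ∈ H.K.erase 0, H.S a b c d e f t = - s ∨
      ∑ t ∈ H.K.erase 0, H.S a b c d e f t = s * (q - 1)) := by
  have hS : H.S a b c 0 0 0 1 ^ 2 = (q : ℤ) ^ 4 := by
    rw [H.S_sq _ _ _ _ _ _ _ (map_one _) one_ne_zero]
    simp_rw [H.rad_trivial c hc, ite_and]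
    simp [G, H.zero]
  refine ⟨_, hS, ?_⟩
  obtain ⟨⟨u, v⟩, huv⟩ : ∃ p : F × F, (c * p.2 + H.σ p.1, c * p.1 + H.σ p.2) = (d, e) := by
    have inj : Function.Injective
        (fun p : F × F => (c * p.2 + H.σ p.1, c * p.1 + H.σ p.2)) := by
      rintro ⟨u, v⟩ ⟨u', v'⟩ hp
      simp only [Prod.mk.injEq] at hp
      have := (H.rad_trivial c hc (u - u') (v - v')).1
        ⟨by rw [map_sub]; linear_combination hp.1, by rw [map_sub]; linear_combination hp.2⟩
      rw [Prod.mk.injEq]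
      exact ⟨sub_eq_zero.1 this.1, sub_eq_zero.1 this.2⟩
    exact (Finite.injective_iff_surjective.1 inj) (d, e)
  simp only [Prod.mk.injEq] at huv
  obtain ⟨rfl, rfl⟩ := huv
  set k := H.G a b c 0 0 0 u v + f + H.σ f with hk
  have hkf : H.σ k = k := by
    simp only [hk, map_add, H.G_fix, H.inv]; ring
  have hG : ∀ x y, H.G a b c (c * v + H.σ u) (c * u + H.σ v) f x y =
      H.G a b c 0 0 0 (x + u) (y + v) + k := by
    intro x y
    rw [hk, ← sub_eq_zero]
    simp only [G, map_add, map_mul, H.inv, map_pow, map_zero]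
    have := H.two
    grind
  clear_value k
  have hSt : ∀ t ∈ H.K.erase 0, H.S a b c (c * v + H.σ u) (c * u + H.σ v) f t =
      H.S a b c 0 0 0 1 * H.ψ (H.ω * (t * k)) := by
    intro t ht
    rw [mem_erase, H.memK] at ht
    obtain ⟨r, hr⟩ : ∃ r : F, r ^ 2 = t := by
      have inj : Function.Injective (fun r : F => r ^ 2) := by
        intro x y hxy
        have : (x - y) ^ 2 = 0 := by
          simp only at hxy
          linear_combination hxy + (y ^ 2 - x * y) * H.two
        exact sub_eq_zero.1 (pow_eq_zero_iff (two_ne_zero) |>.1 this)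
      exact (Finite.injective_iff_surjective.1 inj) t
    have hr0 : r ≠ 0 := by rintro rfl; apply ht.1; rw [← hr]; simp
    have hrσ : H.σ r = r := by
      have : (H.σ r - r) ^ 2 = 0 := by
        have h1 : H.σ r ^ 2 = r ^ 2 := by rw [← map_pow, hr, ht.2]
        linear_combination h1 + (r ^ 2 - H.σ r * r) * H.two
      exact sub_eq_zero.1 (pow_eq_zero_iff (two_ne_zero) |>.1 this)
    simp only [S]
    rw [sum_mul, eq_comm]
    let E : F → (F ≃ F) := fun w => (Equiv.addRight w).trans (Equiv.mulLeft₀ r hr0)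
    rw [← Equiv.sum_comp (E u)]
    refine sum_congr rfl fun x _ => ?_
    rw [sum_mul, ← Equiv.sum_comp (E v)]
    refine sum_congr rfl fun y _ => ?_
    rw [hG, mul_add, mul_add, H.padd]
    congr 3
    have hE : ∀ w z, E w z = r * (z + w) := fun w z => rfl
    simp only [hE, G, map_add, map_mul, hrσ, map_pow, map_zero, ← hr]
    ring
  rw [sum_congr rfl hSt, ← mul_sum]
  have h0 : (0 : F) ∈ H.K := by rw [H.memK, map_zero]
  have hs := H.sumK k hkf
  rw [← add_sum_erase _ _ h0] at hs
  simp only [zero_mul, mul_zero, H.zero] at hs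
  have hs' : ∑ t ∈ H.K.erase 0, H.ψ (H.ω * (t * k)) = (if k = 0 then (q : ℤ) else 0) - 1 := by
    linarith
  rw [hs']
  split_ifs
  · right; rfl
  · left; ring

lemma case2 (a b c d e f : F) (hc : c * H.σ c = 1) (hA : a + H.σ b * c ^ 2 ≠ 0)
    [DecidableEq F] :
    ∑ t ∈ H.K.erase 0, H.S a b c d e f t = 0 ∨
    (∑ t ∈ H.K.erase 0, H.S a b c d e f t) ^ 2 = (q : ℤ) ^ 6 := by
  set A := a + H.σ b * c ^ 2 with hAd
  set D := d + H.σ e * c with hD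
  have hsq : ∀ t ∈ H.K.erase 0, H.S a b c d e f t ^ 2 =
      if A = t * D ^ 2 then (q : ℤ) ^ 6 else 0 := by
    intro t ht
    rw [mem_erase, H.memK] at ht
    rw [H.S_sq _ _ _ _ _ _ _ ht.2 ht.1]
    have hR : ∀ u v, (c * v + H.σ u = 0 ∧ c * u + H.σ v = 0) ↔ v = H.σ (c * u) := by
      intro u v
      constructor
      · rintro ⟨-, h2⟩
        have h3 : H.σ c * H.σ u + v = 0 := by
          have := congrArg H.σ h2; simpa [H.inv] using this
        rw [map_mul]
        linear_combination h3 - (H.σ c * H.σ u) * H.two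
      · rintro rfl
        simp only [map_mul, H.inv]
        exact ⟨by linear_combination H.σ u * hc + H.σ u * H.two,
          by linear_combination (c * u) * H.two⟩
    simp_rw [hR, sum_ite_eq', if_pos (mem_univ _)]
    have hv : ∀ u, H.ψ (H.ω * (t * (H.G a b c d e f u (H.σ (c * u)) + H.G a b c d e f 0 0)))
        = H.ψ ((t * A + t ^ 2 * D ^ 2) * u ^ 2) := by
      intro u
      have : H.ω * (t * (H.G a b c d e f u (H.σ (c * u)) + H.G a b c d e f 0 0)) =
          H.ω * ((t * A * u ^ 2 + t * D * u) + H.σ (t * A * u ^ 2 + t * D * u)) := by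
        congr 1
        rw [← sub_eq_zero]
        simp only [hAd, hD, G, map_add, map_mul, H.inv, map_pow, map_zero, ht.2]
        have := H.two
        grind
      rw [this, H.psiT, H.padd, ← H.psq (t * D * u), ← H.padd]
      congr 1; ring
    simp_rw [hv]
    have inj : Function.Injective (fun r : F => r ^ 2) := by
      intro x y hxy
      have : (x - y) ^ 2 = 0 := by
        simp only at hxy
        linear_combination hxy + (y ^ 2 - x * y) * H.two
      exact sub_eq_zero.1 (pow_eq_zero_iff (two_ne_zero) |>.1 this)
    have := Equiv.sum_comp (Equiv.ofBijective _ (Finite.injective_iff_bijective.1 inj))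
      (fun x => H.ψ ((t * A + t ^ 2 * D ^ 2) * x))
    simp only [Equiv.ofBijective_apply] at this
    rw [this, H.sumF]
    have hiff : t * A + t ^ 2 * D ^ 2 = 0 ↔ A = t * D ^ 2 := by
      constructor
      · intro h
        have : t * (A - t * D ^ 2) = 0 := by
          linear_combination h - t ^ 2 * D ^ 2 * H.two
        exact sub_eq_zero.1 ((mul_eq_zero.1 this).resolve_left ht.1)
      · intro h
        rw [h]; linear_combination t ^ 2 * D ^ 2 * H.two
    simp_rw [hiff]
    split_ifs <;> ring
  by_cases hex : ∃ t ∈ H.K.erase 0, A = t * D ^ 2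
  · obtain ⟨t, ht, hAt⟩ := hex
    right
    rw [Finset.sum_eq_single_of_mem t ht, hsq t ht, if_pos hAt]
    intro t' ht' hne
    have := hsq t' ht'
    rw [if_neg] at this
    · exact pow_eq_zero_iff two_ne_zero |>.1 this
    · intro h
      have hD0 : D ^ 2 ≠ 0 := by
        intro h0; rw [h0, mul_zero] at h; exact hA h
      exact hne (mul_right_cancel₀ hD0 (h.symm.trans hAt))
  · left
    refine Finset.sum_eq_zero fun t ht => ?_
    have := hsq t ht
    rw [if_neg (fun h => hex ⟨t, ht, h⟩)] at this
    exact pow_eq_zero_iff two_ne_zero |>.1 this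

end HQ

lemma stmt_5_aux
    (h q : ℕ) (hq : q = 2 ^ h)
    (F : Type) [Field F] [Fintype F] (hF : Fintype.card F = q ^ 2)
    (s : F) (htr : ∑ i ∈ Finset.range (2 * h), s ^ 2 ^ i = 1) :
    ∃ H : HQ F q, ∀ x, H.σ x = x ^ q := by
  classical
  have hcardF : Fintype.card F = 2 ^ (2 * h) := by rw [hF, hq, ← pow_mul, mul_comm]
  have : Fact (Nat.Prime 2) := ⟨Nat.prime_two⟩
  have : CharP F 2 := charP_of_card_eq_prime_pow hcardF
  have two : (2 : F) = 0 := CharTwo.two_eq_zero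
  have q0 : 0 < q := by rw [hq]; positivity
  have hh : h ≠ 0 := by
    rintro rfl
    simp at htr
  have q1 : 1 < q := by rw [hq]; exact Nat.one_lt_two_pow hh
  obtain ⟨σ, hσ⟩ : ∃ σ : F →+* F, ∀ x, σ x = x ^ q :=
    ⟨iterateFrobenius F 2 h, fun x => by rw [iterateFrobenius_def, hq]⟩
  have inv : ∀ x, σ (σ x) = x := by
    intro x
    rw [hσ, hσ, ← pow_mul, ← sq, ← hF, FiniteField.pow_card]
  set K : Finset F := univ.filter (fun t => σ t = t) with hK
  have memK : ∀ t, t ∈ K ↔ σ t = t := by intro t; simp [hK]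
  have hKle : K.card ≤ q := by
    have hne := FiniteField.X_pow_card_sub_X_ne_zero F q1
    have hsub : K ⊆ (Polynomial.X ^ q - Polynomial.X : Polynomial F).roots.toFinset := by
      intro t ht
      rw [memK, hσ] at ht
      rw [Multiset.mem_toFinset, Polynomial.mem_roots hne]
      simp [ht]
    calc K.card ≤ _ := card_le_card hsub
      _ ≤ _ := Multiset.toFinset_card_le _
      _ ≤ _ := Polynomial.card_roots' _
      _ = q := FiniteField.X_pow_card_sub_X_natDegree_eq F q1
  set I : Finset F := univ.image (fun x => x + σ x) with hI
  have hIK : I ⊆ K := by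
    intro y hy
    rw [hI, mem_image] at hy
    obtain ⟨x, -, rfl⟩ := hy
    rw [memK, map_add, inv, add_comm]
  have hfib : (univ : Finset F).card ≤ K.card * I.card := by
    refine Finset.card_le_mul_card_image _ _ ?_
    intro y hy
    obtain ⟨x0, -, hx0⟩ := mem_image.1 hy
    refine Finset.card_le_card_of_injOn (fun x => x - x0) ?_ ?_
    · intro x hx
      have hx : x + σ x = y := by simpa using hx
      have : σ (x - x0) = x - x0 := by
        rw [map_sub]
        linear_combination hx - hx0 - (x - x0) * two
      simpa [memK] using this
    · intro x _ x' _ hxx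
      simpa using hxx
  rw [card_univ, hF] at hfib
  have hIle := card_le_card hIK
  have cardK : K.card = q := by nlinarith
  have cardI : K.card ≤ I.card := by rw [cardK] at *; nlinarith
  have hIeq : I = K := eq_of_subset_of_card_le hIK cardI
  obtain ⟨ω, hω⟩ : ∃ ω, ω + σ ω = 1 := by
    have : (1 : F) ∈ I := by rw [hIeq, memK, map_one]
    rw [hI, mem_image] at this
    obtain ⟨x, -, hx⟩ := this
    exact ⟨x, hx⟩
  set τ : F → F := fun x => ∑ i ∈ Finset.range (2 * h), x ^ 2 ^ i with hτ
  have τadd : ∀ x y, τ (x + y) = τ x + τ y := by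
    intro x y
    simp only [hτ, add_pow_char_pow, sum_add_distrib]
  have τsq : ∀ x, τ (x ^ 2) = τ x := by
    intro x
    have h1 := Finset.sum_range_succ (fun i => x ^ 2 ^ i) (2 * h)
    have h2 := Finset.sum_range_succ' (fun i => x ^ 2 ^ i) (2 * h)
    rw [h1, ← hcardF, FiniteField.pow_card] at h2
    simp only [pow_zero, pow_one, add_left_inj] at h2
    simp only [hτ]
    rw [h2]
    refine sum_congr rfl fun i _ => ?_
    rw [← pow_mul, pow_succ, mul_comm]
  have τ2 : ∀ x, τ (x ^ 2) = τ x ^ 2 := by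
    intro x
    simp only [hτ]
    rw [sum_pow_char]
    refine sum_congr rfl fun i _ => ?_
    rw [← pow_mul, ← pow_mul, mul_comm]
  have τ01 : ∀ x, τ x = 0 ∨ τ x = 1 := by
    intro x
    have : τ x * (τ x - 1) = 0 := by
      linear_combination (τ2 x).symm.trans (τsq x)
    rcases mul_eq_zero.1 this with h | h
    · exact Or.inl h
    · exact Or.inr (sub_eq_zero.1 h)
  have τσ : ∀ x, τ (σ x) = τ x := by
    intro x
    rw [hσ, hq]
    clear_value τ
    have : ∀ n, τ (x ^ 2 ^ n) = τ x := by
      intro n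
      induction n with
      | zero => simp
      | succ n ih => rw [pow_succ, pow_mul, τsq, ih]
    exact this h
  have τs : τ s = 1 := htr
  have τ0 : τ 0 = 0 := by simpa using τadd 0 0
  clear_value τ
  refine ⟨⟨two, q0, hF, σ, inv, K, memK, cardK, ω, hω, fun x => if τ x = 0 then 1 else -1,
    ?_, ?_, ?_, ?_, s, ?_⟩, hσ⟩
  · intro x y
    rw [τadd]
    have h11 : (1 : F) + 1 = 0 := by linear_combination two
    rcases τ01 x with hx | hx <;> rcases τ01 y with hy | hy <;> simp [hx, hy, h11]
  · intro x; simp only [τσ]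
  · intro x; simp only [τsq]
  · simp [τ0]
  · simp [τs]

end



/-- Lemma 3.2 of the paper (elliptic case): the number of affine points of
`ℋ ∩ 𝒬`, i.e. triples `(x,y,z) ∈ F³` with `z^q + z = x^{q+1} + y^{q+1}` and
`z = ax² + by² + cxy + dx + ey + f`, when `c ≠ 0` and `Tr(ab/c²) = 1`. -/
theorem stmt_5
    (h q : ℕ) (hh : 1 ≤ h) (hq : q = 2 ^ h)
    (F : Type) [Field F] [Fintype F] (hF : Fintype.card F = q ^ 2)
    (a b c d e f : F) (hc : c ≠ 0)
    (htr : ∑ i ∈ Finset.range (2 * h), (a * b / c ^ 2) ^ 2 ^ i = 1) :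
    Set.ncard {t : F × F × F |
        t.2.2 ^ q + t.2.2 = t.1 ^ (q + 1) + t.2.1 ^ (q + 1) ∧
        t.2.2 = a * t.1 ^ 2 + b * t.2.1 ^ 2 + c * t.1 * t.2.1
            + d * t.1 + e * t.2.1 + f} ∈
      ({q ^ 3 - q ^ 2, q ^ 3 - q ^ 2 + q, q ^ 3 - q, q ^ 3, q ^ 3 + q,
        q ^ 3 + q ^ 2 - q, q ^ 3 + q ^ 2} : Set ℕ) := by
  classical
  obtain ⟨H, hσ⟩ := stmt_5_aux h q hq F hF _ htr
  have hcard : Set.ncard {t : F × F × F |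
        t.2.2 ^ q + t.2.2 = t.1 ^ (q + 1) + t.2.1 ^ (q + 1) ∧
        t.2.2 = a * t.1 ^ 2 + b * t.2.1 ^ 2 + c * t.1 * t.2.1
            + d * t.1 + e * t.2.1 + f} =
      ((Finset.univ : Finset (F × F)).filter
        (fun p => H.G a b c d e f p.1 p.2 = 0)).card := by
    rw [← Set.ncard_coe_finset]
    symm
    refine Set.ncard_congr (fun p _ => (p.1, p.2, a * p.1 ^ 2 + b * p.2 ^ 2 + c * p.1 * p.2
            + d * p.1 + e * p.2 + f)) ?_ ?_ ?_
    · rintro ⟨x, y⟩ hp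
      simp only [Finset.coe_filter, Finset.mem_univ, true_and, Set.mem_ofPred_eq] at hp ⊢
      refine ⟨?_, trivial⟩
      rw [HQ.G, hσ (_ + f), hσ x, hσ y] at hp
      rw [pow_succ, pow_succ]
      linear_combination hp - (x * x ^ q + y * y ^ q) * H.two
    · rintro ⟨x, y⟩ ⟨x', y'⟩ _ _ hp
      simp only [Prod.mk.injEq] at hp ⊢
      exact ⟨hp.1, hp.2.1⟩
    · rintro ⟨x, y, z⟩ ⟨h1, h2⟩
      simp only at h1 h2
      refine ⟨(x, y), ?_, ?_⟩
      · simp only [Finset.coe_filter, Finset.mem_univ, true_and, Set.mem_ofPred_eq]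
        rw [HQ.G, ← h2, hσ, hσ, hσ]
        rw [pow_succ, pow_succ] at h1
        linear_combination h1 + (x * x ^ q + y * y ^ q) * H.two
      · simp only [← h2]
  rw [hcard]
  have hN := H.count a b c d e f
  generalize ((Finset.univ : Finset (F × F)).filter
        (fun p => H.G a b c d e f p.1 p.2 = 0)).card = N at hN ⊢
  have hqZ : (0 : ℤ) < q := by exact_mod_cast H.q0
  have hq0 : (q : ℤ) ≠ 0 := hqZ.ne'
  have h12 : q ≤ q ^ 2 := Nat.le_self_pow two_ne_zero q
  have h23 : q ^ 2 ≤ q ^ 3 := Nat.pow_le_pow_right H.q0 (by norm_num)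
  have key : (N : ℤ) = q ^ 3 - q ^ 2 ∨ (N : ℤ) = q ^ 3 - q ^ 2 + q ∨ (N : ℤ) = q ^ 3 - q ∨
      (N : ℤ) = q ^ 3 ∨ (N : ℤ) = q ^ 3 + q ∨ (N : ℤ) = q ^ 3 + q ^ 2 - q ∨
      (N : ℤ) = q ^ 3 + q ^ 2 := by
    by_cases hcc : c * H.σ c = 1
    · have hA : a + H.σ b * c ^ 2 ≠ 0 := by
        intro hA
        have ha : a * b / c ^ 2 = b * H.σ b := by
          rw [div_eq_iff (pow_ne_zero 2 hc)]
          linear_combination b * hA - (b * H.σ b * c ^ 2) * H.two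
        rw [ha] at htr
        have hfix : (b * H.σ b) ^ q = b * H.σ b := by
          rw [← hσ, map_mul, H.inv, mul_comm]
        rw [two_mul, Finset.sum_range_add] at htr
        simp_rw [pow_add, pow_mul, ← hq, hfix] at htr
        rw [H.self] at htr
        exact zero_ne_one htr
      rcases H.case2 a b c d e f hcc hA with h0 | h0
      · rw [h0] at hN
        have : (N : ℤ) = q ^ 3 := mul_left_cancel₀ hq0 (by linear_combination hN)
        tauto
      · have : (∑ t ∈ H.K.erase 0, H.S a b c d e f t) ^ 2 = ((q : ℤ) ^ 3) ^ 2 := by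
          rw [h0]; ring
        rcases sq_eq_sq_iff_eq_or_eq_neg.1 this with h1 | h1 <;> rw [h1] at hN
        · have : (N : ℤ) = q ^ 3 + q ^ 2 := mul_left_cancel₀ hq0 (by linear_combination hN)
          tauto
        · have : (N : ℤ) = q ^ 3 - q ^ 2 := mul_left_cancel₀ hq0 (by linear_combination hN)
          tauto
    · obtain ⟨s, hs, hs'⟩ := H.case1 a b c d e f hcc
      have : s ^ 2 = ((q : ℤ) ^ 2) ^ 2 := by rw [hs]; ring
      rcases sq_eq_sq_iff_eq_or_eq_neg.1 this with h1 | h1 <;> rcases hs' with h2 | h2 <;>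
        rw [h2, h1] at hN
      · have : (N : ℤ) = q ^ 3 - q := mul_left_cancel₀ hq0 (by linear_combination hN)
        tauto
      · have : (N : ℤ) = q ^ 3 + q ^ 2 - q := mul_left_cancel₀ hq0 (by linear_combination hN)
        tauto
      · have : (N : ℤ) = q ^ 3 + q := mul_left_cancel₀ hq0 (by linear_combination hN)
        tauto
      · have : (N : ℤ) = q ^ 3 - q ^ 2 + q := mul_left_cancel₀ hq0 (by linear_combination hN)
        tauto
  simp only [Set.mem_insert_iff, Set.mem_singleton_iff]
  zify [h23, h12.trans h23, h12.trans (Nat.le_add_left (q ^ 2) (q ^ 3))]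
  exact key
end
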